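/- arXiv:2603.08121 — 3 statements merged into one kernel-verified Lean document; each statement's English description precedes it below -/
import Mathlib

section
/- Let d ≥ 3 be odd, ℓ a positive integer and ε > 0. There exists a constant C = C(ε,ℓ,d) > 0 such that for all coprime squarefree positive integers A_1, A_2 with a = A_1·A_2² > 1 and x^d − a irreducible over ℚ, the pure field K = ℚ(a^{1/d}) of degree d satisfies #Cl_K[ℓ] ≤ C · D_K^{1/2 − 1/(2(d−1)ℓ) + ε} · (A_2^{d−2}/A_1)^{1/(2dℓ)}. -/
open NumberField Polynomial

/-- The denominator ideal of `α ∈ K`: the set of `x ∈ 𝓞 K` with `x·α ∈ 𝓞 K`.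
Its absolute norm is the non-archimedean part `∏_v max(1,|α|_v)^{d_v}` of the height. -/
noncomputable def denIdeal (K : Type*) [Field K] [NumberField K] (α : K) : Ideal (𝓞 K) where
  carrier := {x : 𝓞 K | ∃ y : 𝓞 K, (x : K) * α = (y : K)}
  zero_mem' := ⟨0, by simp⟩
  add_mem' := by
    rintro a b ⟨ya, ha⟩ ⟨yb, hb⟩
    exact ⟨ya + yb, by push_cast; rw [add_mul, ha, hb]⟩
  smul_mem' := by
    rintro c x ⟨y, hy⟩
    exact ⟨c * y, by rw [smul_eq_mul]; push_cast; rw [mul_assoc, hy]⟩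

/-- The relative multiplicative Weil height `H_K(α) = ∏_{v ∈ M_K} max(1,|α|_v)^{d_v}`. -/
noncomputable def heightK (K : Type*) [Field K] [NumberField K] (α : K) : ℝ :=
  (Ideal.absNorm (denIdeal K α) : ℝ) * ∏ w : InfinitePlace K, max 1 (w α) ^ w.mult

/-- `N'_K(X)`: the number of `α ∈ K` with `ℚ(α) = K` and `H_K(α) < X`. -/
noncomputable def NprimeK (K : Type*) [Field K] [NumberField K] (X : ℝ) : ℕ :=
  Nat.card {α : K // IntermediateField.adjoin ℚ {α} = ⊤ ∧ heightK K α < X}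

/-- `M_{K,ℓ} = inf_{X > 0} X^{-1/ℓ}(1 + N'_K(X))`. -/
noncomputable def MKl (K : Type*) [Field K] [NumberField K] (ℓ : ℕ) : ℝ :=
  ⨅ X : {X : ℝ // 0 < X}, (X : ℝ) ^ (-(1:ℝ)/ℓ) * (1 + (NprimeK K X : ℝ))

/-- `η(K)`: the minimal height of a primitive element of `K`. -/
noncomputable def etaK (K : Type*) [Field K] [NumberField K] : ℝ :=
  sInf {x : ℝ | ∃ α : K, IntermediateField.adjoin ℚ {α} = ⊤ ∧ heightK K α = x}

/-- `D_K`: the absolute value of the discriminant. -/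
noncomputable def DK (K : Type*) [Field K] [NumberField K] : ℕ :=
  (NumberField.discr K).natAbs

section PrimesInProgressions

open ArithmeticFunction Finset

/-- Abel summation estimate, in the form needed for an induction. -/
theorem norm_sum_Ico_mul_sub_le {g : ℕ → ℂ} {f : ℕ → ℝ} {B : ℝ} {m : ℕ}
    (hg : ∀ n, m ≤ n → ‖∑ k ∈ Ico m n, g k‖ ≤ B)
    (hf : ∀ n, m ≤ n → f (n + 1) ≤ f n) (n : ℕ) (hn : m ≤ n) :
    ‖∑ k ∈ Ico m n, g k * f k - f n * ∑ k ∈ Ico m n, g k‖ ≤ B * (f m - f n) := by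
  induction n, hn using Nat.le_induction with
  | base => simp
  | succ n hn ih =>
    have h1 := hg (n + 1) (by omega)
    rw [sum_Ico_succ_top hn] at h1 ⊢
    rw [sum_Ico_succ_top hn]
    have key : ∑ k ∈ Ico m n, g k * f k + g n * f n - f (n + 1) * (∑ k ∈ Ico m n, g k + g n)
        = (∑ k ∈ Ico m n, g k * f k - f n * ∑ k ∈ Ico m n, g k)
          + ((f n - f (n + 1) : ℝ) : ℂ) * (∑ k ∈ Ico m n, g k + g n) := by
      push_cast; ring
    rw [key]
    refine (norm_add_le _ _).trans ?_
    rw [norm_mul, Complex.norm_real, Real.norm_of_nonneg (sub_nonneg.2 (hf n hn))]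
    have := mul_le_mul_of_nonneg_left h1 (sub_nonneg.2 (hf n hn))
    linarith

/-- **Abel's inequality**. -/
theorem norm_sum_Ico_mul_le {g : ℕ → ℂ} {f : ℕ → ℝ} {B : ℝ} {m : ℕ}
    (hg : ∀ n, m ≤ n → ‖∑ k ∈ Ico m n, g k‖ ≤ B)
    (hf : ∀ n, m ≤ n → f (n + 1) ≤ f n) (hf0 : ∀ n, m ≤ n → 0 ≤ f n) (n : ℕ) (hn : m ≤ n) :
    ‖∑ k ∈ Ico m n, g k * f k‖ ≤ B * f m := by
  have h1 := norm_sum_Ico_mul_sub_le hg hf n hn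
  have h2 : ‖(f n : ℂ) * ∑ k ∈ Ico m n, g k‖ ≤ f n * B := by
    rw [norm_mul, Complex.norm_real, Real.norm_of_nonneg (hf0 n hn)]
    exact mul_le_mul_of_nonneg_left (hg n hn) (hf0 n hn)
  have h3 := norm_add_le (∑ k ∈ Ico m n, g k * f k - f n * ∑ k ∈ Ico m n, g k)
    (f n * ∑ k ∈ Ico m n, g k)
  rw [sub_add_cancel] at h3
  linarith

variable {q : ℕ} [NeZero q]

theorem DirichletCharacter.sum_range_mul_eq_zero {χ : DirichletCharacter ℂ q} (hχ : χ ≠ 1) :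
    ∑ k ∈ range q, χ k = 0 := by
  have h := MulChar.sum_eq_zero_of_ne_one hχ
  rw [← h]
  refine sum_bij (fun k _ => (k : ZMod q)) (fun _ _ => mem_univ _) ?_ ?_ (fun _ _ => rfl)
  · intro a ha b hb hab
    rw [ZMod.natCast_eq_natCast_iff] at hab
    exact Nat.ModEq.eq_of_lt_of_lt hab (mem_range.1 ha) (mem_range.1 hb)
  · intro b _
    exact ⟨b.val, mem_range.2 (ZMod.val_lt b), ZMod.natCast_zmod_val b⟩

theorem DirichletCharacter.norm_sum_range_le {χ : DirichletCharacter ℂ q} (hχ : χ ≠ 1) (n : ℕ) :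
    ‖∑ k ∈ range n, χ k‖ ≤ q := by
  have hper : Function.Periodic (fun n : ℕ => ∑ k ∈ range n, χ (k : ZMod q)) q := by
    intro n
    simp only
    rw [add_comm, sum_range_add, sum_range_mul_eq_zero hχ, zero_add]
    simp
  have := hper.map_mod_nat n
  rw [← this]
  refine (norm_sum_le _ _).trans ((sum_le_sum fun k _ => χ.norm_le_one _).trans ?_)
  simp only [sum_const, card_range, nsmul_eq_mul, mul_one, Nat.cast_le]
  exact (Nat.mod_lt _ (NeZero.pos q)).le

theorem DirichletCharacter.norm_sum_Ico_le {χ : DirichletCharacter ℂ q} (hχ : χ ≠ 1) (m n : ℕ)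
    (h : m ≤ n) : ‖∑ k ∈ Ico m n, χ k‖ ≤ 2 * q := by
  rw [sum_Ico_eq_sub _ h]
  have h1 := norm_sum_range_le hχ m
  have h2 := norm_sum_range_le hχ n
  have h3 := norm_sub_le (∑ k ∈ range n, χ k) (∑ k ∈ range m, χ k)
  linarith

theorem DirichletCharacter.norm_sum_range_rpow_sub_LFunction_le {χ : DirichletCharacter ℂ q}
    (hχ : χ ≠ 1) {s : ℝ} (hs : 1 < s) (m : ℕ) (hm : 0 < m) :
    ‖∑ k ∈ range m, χ k * ((k : ℝ) ^ (-s) : ℝ) - χ.LFunction s‖ ≤ 2 * q * (m : ℝ) ^ (-s) := by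
  have hs' : 1 < (s : ℂ).re := by simpa using hs
  have hsum := (DirichletCharacter.LSeriesSummable_of_one_lt_re χ hs').LSeriesHasSum
  rw [← χ.LFunction_eq_LSeries hs'] at hsum
  have hterm : ∀ k : ℕ, LSeries.term (fun n => χ n) s k = χ k * ((k : ℝ) ^ (-s) : ℝ) := by
    intro k
    rcases Nat.eq_zero_or_pos k with rfl | hk
    · simp [Real.zero_rpow (by linarith : -s ≠ 0)]
    · rw [LSeries.term_of_ne_zero hk.ne', div_eq_mul_inv, Complex.ofReal_cpow (by positivity)]
      push_cast
      rw [Complex.cpow_neg]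
  have ht := hsum.tendsto_sum_nat
  simp only [hterm] at ht
  have h1 : Filter.Tendsto (fun n => ‖∑ k ∈ range m, χ k * ((k : ℝ) ^ (-s) : ℝ)
      - ∑ k ∈ range n, χ k * ((k : ℝ) ^ (-s) : ℝ)‖) Filter.atTop
      (nhds ‖∑ k ∈ range m, χ k * ((k : ℝ) ^ (-s) : ℝ) - χ.LFunction s‖) :=
    (tendsto_const_nhds.sub ht).norm
  refine le_of_tendsto h1 (Filter.eventually_atTop.2 ⟨m, fun n hn => ?_⟩)
  rw [norm_sub_rev, ← sum_Ico_eq_sub _ hn]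
  refine norm_sum_Ico_mul_le (fun n hn => norm_sum_Ico_le hχ m n hn) ?_
    (fun n _ => by positivity) n hn
  intro n hn
  have : (0 : ℝ) < n := by exact_mod_cast hm.trans_le hn
  exact Real.rpow_le_rpow_of_nonpos this (by push_cast; linarith) (by linarith)

theorem DirichletCharacter.norm_sum_range_inv_sub_LFunction_le {χ : DirichletCharacter ℂ q}
    (hχ : χ ≠ 1) (m : ℕ) (hm : 0 < m) :
    ‖∑ k ∈ range m, χ k * ((k : ℝ)⁻¹ : ℝ) - χ.LFunction 1‖ ≤ 2 * q * (m : ℝ)⁻¹ := by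
  have hL : Filter.Tendsto (fun s : ℝ => χ.LFunction s) (nhdsWithin 1 (Set.Ioi 1))
      (nhds (χ.LFunction 1)) := by
    have h := (differentiable_LFunction hχ).continuous.comp Complex.continuous_ofReal
    have h2 := h.tendsto 1
    simp only [Function.comp, Complex.ofReal_one] at h2
    exact h2.mono_left nhdsWithin_le_nhds
  have hpow : ∀ k : ℕ, 0 < k → Filter.Tendsto (fun s : ℝ => (k : ℝ) ^ (-s))
      (nhdsWithin 1 (Set.Ioi 1)) (nhds ((k : ℝ)⁻¹)) := by
    intro k hk
    have hc : Continuous fun s : ℝ => (k : ℝ) ^ (-s) :=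
      Continuous.rpow continuous_const continuous_neg (fun _ => Or.inl (by positivity))
    have := hc.tendsto 1
    rw [Real.rpow_neg_one] at this
    exact this.mono_left nhdsWithin_le_nhds
  have hterm : ∀ k ∈ range m, Filter.Tendsto (fun s : ℝ => χ k * ((k : ℝ) ^ (-s) : ℝ))
      (nhdsWithin 1 (Set.Ioi 1)) (nhds (χ k * ((k : ℝ)⁻¹ : ℝ))) := by
    intro k _
    rcases Nat.eq_zero_or_pos k with rfl | hk
    · have : (fun s : ℝ => χ (0 : ℕ) * (((0 : ℕ) : ℝ) ^ (-s) : ℝ)) =ᶠ[nhdsWithin 1 (Set.Ioi 1)]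
          fun _ => 0 := by
        filter_upwards [self_mem_nhdsWithin] with s hs
        have : (1 : ℝ) < s := hs
        simp [Real.zero_rpow (by linarith : -s ≠ 0)]
      rw [Filter.tendsto_congr' this]
      simp
    · exact tendsto_const_nhds.mul
        ((Complex.continuous_ofReal.tendsto _).comp (hpow k hk))
  refine le_of_tendsto_of_tendsto (((tendsto_finsetSum _ hterm).sub hL).norm)
    ((hpow m hm).const_mul (2 * q : ℝ)) ?_
  filter_upwards [self_mem_nhdsWithin] with s hs
  exact norm_sum_range_rpow_sub_LFunction_le hχ hs m hm

theorem DirichletCharacter.exists_norm_sum_mul_log_div_le {χ : DirichletCharacter ℂ q}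
    (hχ : χ ≠ 1) : ∃ C : ℝ, ∀ N : ℕ,
      ‖∑ n ∈ Ioc 0 N, χ n * ((Real.log n / n : ℝ) : ℂ)‖ ≤ C := by
  refine ⟨∑ n ∈ Ico (0 : ℕ) 3, ‖χ n * ((Real.log n / n : ℝ) : ℂ)‖ +
    2 * q * (Real.log (3 : ℕ) / (3 : ℕ)), fun N => ?_⟩
  have hI : ∑ n ∈ Ioc 0 N, χ n * ((Real.log n / n : ℝ) : ℂ) =
      ∑ n ∈ Ico 0 (N + 1), χ n * ((Real.log n / n : ℝ) : ℂ) := by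
    rw [sum_eq_sum_Ico_succ_bot (Nat.succ_pos N)]
    simp only [CharP.cast_eq_zero, div_zero, Complex.ofReal_zero, mul_zero, zero_add]
    refine sum_congr ?_ fun _ _ => rfl
    ext; simp; omega
  rw [hI]
  have hpos : (0 : ℝ) ≤ 2 * q * (Real.log (3 : ℕ) / (3 : ℕ)) := by positivity
  rcases le_total (N + 1) 3 with h | h
  · refine (norm_sum_le _ _).trans ((sum_le_sum_of_subset_of_nonneg
      (Ico_subset_Ico_right h) fun _ _ _ => norm_nonneg _).trans ?_)
    linarith
  · rw [← sum_Ico_consecutive _ (Nat.zero_le 3) h]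
    refine (norm_add_le _ _).trans (add_le_add (norm_sum_le _ _) ?_)
    refine norm_sum_Ico_mul_le (f := fun n => Real.log n / n)
      (fun n hn => norm_sum_Ico_le hχ 3 n hn) ?_ (fun n _ => by positivity) (N + 1) h
    intro n hn
    have h3 : Real.exp 1 ≤ n := by
      have := Real.exp_one_lt_d9
      have h3' : (3 : ℝ) ≤ n := by exact_mod_cast hn
      linarith
    refine Real.log_div_self_antitoneOn h3 ?_ ?_
    · show Real.exp 1 ≤ _; push_cast; linarith
    · push_cast; linarith

/-- For a nontrivial character, `∑_{n ≤ N} χ(n) Λ(n) / n` is bounded. -/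
theorem DirichletCharacter.exists_norm_sum_mul_vonMangoldt_div_le {χ : DirichletCharacter ℂ q}
    (hχ : χ ≠ 1) : ∃ C : ℝ, ∀ N : ℕ,
      ‖∑ n ∈ Ioc 0 N, χ n * ((vonMangoldt n / n : ℝ) : ℂ)‖ ≤ C := by
  obtain ⟨C, hC⟩ := exists_norm_sum_mul_log_div_le hχ
  set L := χ.LFunction 1 with hLdef
  have hL : L ≠ 0 := LFunction_apply_one_ne_zero hχ
  refine ⟨(C + 2 * q * (Real.log 4 + 4)) / ‖L‖, fun N => ?_⟩
  let F : ArithmeticFunction ℂ := ⟨fun n => χ n * ((vonMangoldt n / n : ℝ) : ℂ), by simp⟩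
  let G : ArithmeticFunction ℂ := ⟨fun n => χ n * (((n : ℝ)⁻¹ : ℝ) : ℂ), by simp⟩
  have hFG : ∀ n, (F * G) n = χ n * ((Real.log n / n : ℝ) : ℂ) := by
    intro n
    rw [ArithmeticFunction.mul_apply, ← vonMangoldt_sum]
    rw [← Nat.sum_divisorsAntidiagonal (f := fun i _ => vonMangoldt i)]
    push_cast
    rw [sum_div, mul_sum]
    refine sum_congr rfl fun x hx => ?_
    have hx' := (Nat.mem_divisorsAntidiagonal.1 hx).1
    rw [← hx']
    simp only [F, G, ArithmeticFunction.coe_mk]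
    push_cast
    rw [map_mul]
    simp only [div_eq_mul_inv, mul_inv]
    ring
  have h1 : ‖∑ n ∈ Ioc 0 N, F n * ∑ m ∈ Ioc 0 (N / n), G m‖ ≤ C := by
    rw [← sum_Ioc_mul_eq_sum_sum]
    simp only [hFG]
    exact hC N
  have h2 : ∀ n ∈ Ioc 0 N, ‖F n * (∑ m ∈ Ioc 0 (N / n), G m - L)‖ ≤
      vonMangoldt n * (2 * q / N) := by
    intro n hn
    obtain ⟨hn0, hnN⟩ := mem_Ioc.1 hn
    have hG : ∑ m ∈ Ioc 0 (N / n), G m =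
        ∑ k ∈ range (N / n + 1), χ k * ((k : ℝ)⁻¹ : ℝ) := by
      rw [range_eq_Ico, sum_eq_sum_Ico_succ_bot (Nat.succ_pos _)]
      simp only [CharP.cast_eq_zero, inv_zero, Complex.ofReal_zero, mul_zero, zero_add]
      refine sum_congr ?_ fun _ _ => rfl
      ext; simp; omega
    have hb := norm_sum_range_inv_sub_LFunction_le hχ (N / n + 1) (Nat.succ_pos _)
    rw [norm_mul, hG]
    have hF : ‖F n‖ ≤ vonMangoldt n / n := by
      simp only [F, ArithmeticFunction.coe_mk, norm_mul, Complex.norm_real]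
      rw [Real.norm_of_nonneg (div_nonneg vonMangoldt_nonneg n.cast_nonneg)]
      exact mul_le_of_le_one_left (div_nonneg vonMangoldt_nonneg n.cast_nonneg)
        (χ.norm_le_one _)
    have hn0' : (0 : ℝ) < n := by exact_mod_cast hn0
    have hN0 : (0 : ℝ) < N := by exact_mod_cast hn0.trans_le hnN
    have hNn : (N : ℝ) / n ≤ (N / n + 1 : ℕ) := by
      rw [div_le_iff₀ hn0']
      have := Nat.lt_div_mul_add (a := N) hn0
      have h' : N ≤ (N / n + 1) * n := by rw [add_mul, one_mul]; omega
      exact_mod_cast h'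
    have hinv : ((N / n + 1 : ℕ) : ℝ)⁻¹ ≤ n / N := by
      rw [← inv_div]
      exact inv_anti₀ (by positivity) hNn
    calc ‖F n‖ * _ ≤ (vonMangoldt n / n) * (2 * q * (n / N)) := by
          refine mul_le_mul hF (hb.trans ?_) (norm_nonneg _)
            (div_nonneg vonMangoldt_nonneg n.cast_nonneg)
          exact mul_le_mul_of_nonneg_left hinv (by positivity)
      _ = _ := by field_simp
  have h3 : ‖∑ n ∈ Ioc 0 N, F n * (∑ m ∈ Ioc 0 (N / n), G m - L)‖ ≤
      2 * q * (Real.log 4 + 4) := by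
    refine (norm_sum_le_of_le _ h2).trans ?_
    rw [← sum_mul]
    have hpsi := Chebyshev.psi_le_const_mul_self (x := N) N.cast_nonneg
    rw [Chebyshev.psi, Nat.floor_natCast] at hpsi
    rcases Nat.eq_zero_or_pos N with rfl | hN
    · simp; positivity
    · have hN0 : (0 : ℝ) < N := by exact_mod_cast hN
      calc _ ≤ ((Real.log 4 + 4) * N) * (2 * q / N) :=
            mul_le_mul_of_nonneg_right hpsi (by positivity)
        _ = _ := by field_simp
  have h4 : (∑ n ∈ Ioc 0 N, F n) * L = ∑ n ∈ Ioc 0 N, F n * ∑ m ∈ Ioc 0 (N / n), G m -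
      ∑ n ∈ Ioc 0 N, F n * (∑ m ∈ Ioc 0 (N / n), G m - L) := by
    rw [← sum_sub_distrib, sum_mul]
    exact sum_congr rfl fun _ _ => by ring
  have h5 : ‖∑ n ∈ Ioc 0 N, F n‖ * ‖L‖ ≤ C + 2 * q * (Real.log 4 + 4) := by
    rw [← norm_mul, h4]
    exact (norm_sub_le _ _).trans (add_le_add h1 h3)
  rw [le_div_iff₀ (norm_pos_iff.2 hL)]
  exact h5

/-- Mertens' first theorem for the von Mangoldt function. -/
theorem abs_sum_vonMangoldt_div_sub_log_le (N : ℕ) (hN : 0 < N) :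
    |∑ n ∈ Ioc 0 N, vonMangoldt n / n - Real.log N| ≤ Real.log 4 + 4 := by
  have hN0 : (0 : ℝ) < N := by exact_mod_cast hN
  have hN1 : (1 : ℝ) ≤ N := by exact_mod_cast hN
  have h1 : ∑ n ∈ Ioc 0 N, Real.log n = ∑ n ∈ Ioc 0 N, vonMangoldt n * ((N / n : ℕ) : ℝ) := by
    rw [← sum_Ioc_mul_zeta_eq_sum, vonMangoldt_mul_zeta]
    rfl
  have hpsi := Chebyshev.psi_le_const_mul_self (x := N) N.cast_nonneg
  rw [Chebyshev.psi, Nat.floor_natCast] at hpsi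
  have hup : ∑ n ∈ Ioc 0 N, Real.log n ≤ N * Real.log N := by
    calc _ ≤ ∑ n ∈ Ioc 0 N, Real.log N := by
          refine sum_le_sum fun n hn => ?_
          obtain ⟨hn0, hnN⟩ := mem_Ioc.1 hn
          exact Real.log_le_log (by exact_mod_cast hn0) (by exact_mod_cast hnN)
      _ = _ := by simp
  have hlow : N * Real.log N - N ≤ ∑ n ∈ Ioc 0 N, Real.log n := by
    have hind : ∀ M : ℕ, M * Real.log M - M ≤ ∑ n ∈ Ioc 0 M, Real.log n := by
      intro M
      induction M with
      | zero => simp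
      | succ M ih =>
        rw [sum_Ioc_succ_top (Nat.zero_le M)]
        rcases Nat.eq_zero_or_pos M with rfl | hM
        · simp
        · have hM0 : (0 : ℝ) < M := by exact_mod_cast hM
          have h := Real.log_le_sub_one_of_pos (x := ((M : ℝ) + 1) / M) (by positivity)
          rw [Real.log_div (by positivity) (by positivity)] at h
          have h' : M * (Real.log (M + 1) - Real.log M) ≤ 1 := by
            calc _ ≤ M * (((M : ℝ) + 1) / M - 1) := mul_le_mul_of_nonneg_left h hM0.le
              _ = 1 := by field_simp; ring
          push_cast
          nlinarith
    exact hind N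
  have ha : N * ∑ n ∈ Ioc 0 N, vonMangoldt n / n ≤
      ∑ n ∈ Ioc 0 N, Real.log n + ∑ n ∈ Ioc 0 N, vonMangoldt n := by
    rw [h1, ← sum_add_distrib, mul_sum]
    refine sum_le_sum fun n hn => ?_
    obtain ⟨hn0, hnN⟩ := mem_Ioc.1 hn
    have hn0' : (0 : ℝ) < n := by exact_mod_cast hn0
    have hNn : (N : ℝ) / n ≤ (N / n : ℕ) + 1 := by
      rw [div_le_iff₀ hn0']
      have := Nat.lt_div_mul_add (a := N) hn0
      have h' : N ≤ (N / n + 1) * n := by rw [add_mul, one_mul]; omega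
      exact_mod_cast h'
    have := mul_le_mul_of_nonneg_left hNn (vonMangoldt_nonneg (n := n))
    calc _ = vonMangoldt n * (N / n) := by ring
      _ ≤ _ := by linarith
  have hb : ∑ n ∈ Ioc 0 N, Real.log n ≤ N * ∑ n ∈ Ioc 0 N, vonMangoldt n / n := by
    rw [h1, mul_sum]
    refine sum_le_sum fun n hn => ?_
    obtain ⟨hn0, hnN⟩ := mem_Ioc.1 hn
    calc _ ≤ vonMangoldt n * (N / n) :=
          mul_le_mul_of_nonneg_left Nat.cast_div_le vonMangoldt_nonneg
      _ = _ := by ring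
  have hlog4 : 0 ≤ Real.log 4 := Real.log_nonneg (by norm_num)
  rw [abs_le]
  constructor
  · have : N * (Real.log N - 1) ≤ N * ∑ n ∈ Ioc 0 N, vonMangoldt n / n := by linarith
    have := le_of_mul_le_mul_left this hN0
    linarith
  · have : N * ∑ n ∈ Ioc 0 N, vonMangoldt n / n ≤ N * (Real.log N + (Real.log 4 + 4)) := by
      linarith
    have := le_of_mul_le_mul_left this hN0
    linarith

theorem DirichletCharacter.exists_norm_sum_one_mul_vonMangoldt_div_sub_log_le (q : ℕ) [NeZero q] :
    ∃ C : ℝ, ∀ N : ℕ, 0 < N →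
      ‖∑ n ∈ Ioc 0 N, (1 : DirichletCharacter ℂ q) n * ((vonMangoldt n / n : ℝ) : ℂ)
        - (Real.log N : ℂ)‖ ≤ C := by
  have hsum := vonMangoldt.summable_residueClass_non_primes_div (a := (0 : ZMod 1))
  have hres : ∀ n : ℕ, vonMangoldt.residueClass (0 : ZMod 1) n = vonMangoldt n := by
    intro n
    rw [vonMangoldt.residueClass, Set.indicator_of_mem]
    exact Subsingleton.elim _ _
  simp only [hres] at hsum
  have hterm0 : ∀ n : ℕ, 0 ≤ (if n.Prime then 0 else vonMangoldt n) / (n : ℝ) := by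
    intro n
    split_ifs
    · simp
    · exact div_nonneg vonMangoldt_nonneg n.cast_nonneg
  have hdiv0 : ∀ n : ℕ, 0 ≤ vonMangoldt n / (n : ℝ) :=
    fun n => div_nonneg vonMangoldt_nonneg n.cast_nonneg
  refine ⟨(∑ n ∈ q.divisors, vonMangoldt n / n +
    ∑' n : ℕ, (if n.Prime then 0 else vonMangoldt n) / (n : ℝ)) + (Real.log 4 + 4),
    fun N hN => ?_⟩
  have h1 := abs_sum_vonMangoldt_div_sub_log_le N hN
  have h2 : ‖∑ n ∈ Ioc 0 N, ((1 : DirichletCharacter ℂ q) n - 1) * ((vonMangoldt n / n : ℝ) : ℂ)‖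
      ≤ ∑ n ∈ q.divisors, vonMangoldt n / n +
        ∑' n : ℕ, (if n.Prime then 0 else vonMangoldt n) / (n : ℝ) := by
    have hle : ∀ n ∈ Ioc 0 N,
        ‖((1 : DirichletCharacter ℂ q) n - 1) * ((vonMangoldt n / n : ℝ) : ℂ)‖ ≤
        (if n ∈ q.divisors then vonMangoldt n / n else 0) +
          (if n.Prime then 0 else vonMangoldt n) / (n : ℝ) := by
      intro n _
      by_cases hn : IsUnit (n : ZMod q)
      · rw [MulChar.one_apply hn]
        simp only [sub_self, zero_mul, norm_zero]
        refine add_nonneg ?_ (hterm0 n)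
        split_ifs
        · exact hdiv0 n
        · exact le_rfl
      · rw [MulChar.map_nonunit _ hn]
        simp only [zero_sub, neg_mul, one_mul, norm_neg, Complex.norm_real]
        rw [Real.norm_of_nonneg (hdiv0 n)]
        by_cases hp : n.Prime
        · have : n ∈ q.divisors := by
            rw [Nat.mem_divisors]
            refine ⟨?_, NeZero.ne q⟩
            rw [ZMod.isUnit_iff_coprime] at hn
            exact (hp.coprime_iff_not_dvd.not_left.1 hn)
          simp [this, hp]
        · rw [if_neg hp]
          have : 0 ≤ (if n ∈ q.divisors then vonMangoldt n / (n : ℝ) else 0) := by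
            split_ifs
            · exact hdiv0 n
            · exact le_rfl
          linarith
    refine (norm_sum_le_of_le _ hle).trans ?_
    rw [sum_add_distrib]
    refine add_le_add ?_ (hsum.sum_le_tsum _ fun n _ => hterm0 n)
    rw [← sum_filter]
    refine sum_le_sum_of_subset_of_nonneg ?_ fun n _ _ => hdiv0 n
    intro n hn
    exact (mem_filter.1 hn).2
  have h3 : ∑ n ∈ Ioc 0 N, (1 : DirichletCharacter ℂ q) n * ((vonMangoldt n / n : ℝ) : ℂ)
        - (Real.log N : ℂ) =
      ∑ n ∈ Ioc 0 N, ((1 : DirichletCharacter ℂ q) n - 1) * ((vonMangoldt n / n : ℝ) : ℂ) +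
        ((∑ n ∈ Ioc 0 N, vonMangoldt n / n - Real.log N : ℝ) : ℂ) := by
    push_cast
    rw [← add_sub_assoc, ← sum_add_distrib]
    congr 1
    exact sum_congr rfl fun _ _ => by ring
  rw [h3]
  refine (norm_add_le _ _).trans (add_le_add h2 ?_)
  rw [Complex.norm_real]
  exact h1

/-- Mertens' first theorem in arithmetic progressions, for the von Mangoldt function. -/
theorem exists_abs_sum_residueClass_div_sub_log_le {a : ZMod q} (ha : IsUnit a) :
    ∃ C : ℝ, ∀ N : ℕ, 0 < N →
      |∑ n ∈ Ioc 0 N, vonMangoldt.residueClass a n / n - (q.totient : ℝ)⁻¹ * Real.log N| ≤ C := by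
  classical
  have hS : ∀ χ : DirichletCharacter ℂ q, ∃ C : ℝ, ∀ N : ℕ, 0 < N →
      ‖∑ n ∈ Ioc 0 N, χ n * ((vonMangoldt n / n : ℝ) : ℂ)
        - (if χ = 1 then (Real.log N : ℂ) else 0)‖ ≤ C := by
    intro χ
    by_cases hχ : χ = 1
    · subst hχ
      simpa using DirichletCharacter.exists_norm_sum_one_mul_vonMangoldt_div_sub_log_le q
    · obtain ⟨C, hC⟩ := DirichletCharacter.exists_norm_sum_mul_vonMangoldt_div_le hχ
      exact ⟨C, fun N _ => by simpa [hχ] using hC N⟩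
  choose C hC using hS
  refine ⟨(q.totient : ℝ)⁻¹ * ∑ χ, C χ, fun N hN => ?_⟩
  have h1 : ((∑ n ∈ Ioc 0 N, vonMangoldt.residueClass a n / n
      - (q.totient : ℝ)⁻¹ * Real.log N : ℝ) : ℂ) =
      (q.totient : ℂ)⁻¹ * ∑ χ : DirichletCharacter ℂ q, χ a⁻¹ *
        (∑ n ∈ Ioc 0 N, χ n * ((vonMangoldt n / n : ℝ) : ℂ)
          - (if χ = 1 then (Real.log N : ℂ) else 0)) := by
    have hone : ∑ χ : DirichletCharacter ℂ q, χ a⁻¹ * (if χ = 1 then (Real.log N : ℂ) else 0) =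
        Real.log N := by
      rw [Finset.sum_eq_single 1]
      · have : IsUnit a⁻¹ := by
          rw [isUnit_iff_exists_inv]
          exact ⟨a, ZMod.inv_mul_of_unit a ha⟩
        rw [MulChar.one_apply this]
        simp
      · intro χ _ hχ
        simp [hχ]
      · simp
    simp only [mul_sub, sum_sub_distrib]
    rw [hone]
    push_cast
    congr 1
    rw [Finset.mul_sum]
    simp only [Finset.mul_sum]
    rw [sum_comm]
    refine sum_congr rfl fun n _ => ?_
    rw [vonMangoldt.residueClass_apply ha, Finset.mul_sum, Finset.sum_div]
    refine sum_congr rfl fun χ _ => ?_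
    ring
  rw [← Real.norm_eq_abs, ← Complex.norm_real, h1, norm_mul]
  have h2 : ‖(q.totient : ℂ)⁻¹‖ = (q.totient : ℝ)⁻¹ := by simp
  rw [h2]
  refine mul_le_mul_of_nonneg_left (norm_sum_le_of_le _ fun χ _ => ?_) (by positivity)
  rw [norm_mul]
  exact (mul_le_of_le_one_left (norm_nonneg _) (χ.norm_le_one _)).trans (hC χ N hN)

/-- A Chebyshev-type lower bound for the number of primes in an arithmetic progression. -/
theorem exists_card_primes_eq_ge {a : ZMod q} (ha : IsUnit a) :
    ∃ c : ℝ, 0 < c ∧ ∃ N₀ : ℕ, ∀ N : ℕ, N₀ ≤ N →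
      c * N ≤ #((Ioc 0 N).filter fun p : ℕ => p.Prime ∧ (p : ZMod q) = a) * Real.log N := by
  obtain ⟨C, hC⟩ := exists_abs_sum_residueClass_div_sub_log_le ha
  have hsum := vonMangoldt.summable_residueClass_non_primes_div (a := a)
  set T := ∑' n : ℕ, (if n.Prime then 0 else vonMangoldt.residueClass a n) / (n : ℝ) with hT
  have hterm0 : ∀ n : ℕ, 0 ≤ (if n.Prime then 0 else vonMangoldt.residueClass a n) / (n : ℝ) := by
    intro n
    split_ifs
    · simp
    · exact div_nonneg (vonMangoldt.residueClass_nonneg a n) n.cast_nonneg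
  have hφ : (0 : ℝ) < (q.totient : ℝ) := by exact_mod_cast Nat.totient_pos.2 (NeZero.pos q)
  obtain ⟨R, hR⟩ := exists_nat_gt (Real.exp (q.totient * (2 * C + T + 1)))
  have hR0 : (0 : ℝ) < R := (Real.exp_pos _).trans hR
  have hRn : 0 < R := by exact_mod_cast hR0
  have hlogR : q.totient * (2 * C + T + 1) ≤ Real.log R := by
    rw [Real.le_log_iff_exp_le hR0]; exact hR.le
  refine ⟨1 / (2 * R), by positivity, R, fun N hN => ?_⟩
  have hNpos : 0 < N := hRn.trans_le hN
  have hN0 : (0 : ℝ) < N := by exact_mod_cast hNpos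
  set M := N / R with hM
  have hMpos : 0 < M := Nat.div_pos hN hRn
  have hM0 : (0 : ℝ) < M := by exact_mod_cast hMpos
  have hMN : M ≤ N := Nat.div_le_self _ _
  have hMR : (M : ℝ) ≤ N / R := Nat.cast_div_le
  have hM2 : (N : ℝ) / R < M + 1 := by
    rw [div_lt_iff₀ hR0]
    have := Nat.lt_div_mul_add (a := N) hRn
    have h' : N < (M + 1) * R := by rw [add_mul, one_mul, hM]; omega
    exact_mod_cast h'
  have h1 := (abs_le.1 (hC N hNpos)).1
  have h2 := (abs_le.1 (hC M hMpos)).2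
  have hsplit : ∑ n ∈ Ioc 0 N, vonMangoldt.residueClass a n / n =
      ∑ n ∈ Ioc 0 M, vonMangoldt.residueClass a n / n +
        ∑ n ∈ Ioc M N, vonMangoldt.residueClass a n / n := by
    rw [sum_Ioc_consecutive _ (Nat.zero_le M) hMN]
  have hlogM : Real.log M ≤ Real.log N - Real.log R := by
    rw [← Real.log_div hN0.ne' hR0.ne']
    exact Real.log_le_log hM0 hMR
  have hmain : T + 1 ≤ ∑ n ∈ Ioc M N, vonMangoldt.residueClass a n / (n : ℝ) := by
    have h3 : (q.totient : ℝ)⁻¹ * Real.log M ≤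
        (q.totient : ℝ)⁻¹ * Real.log N - (2 * C + T + 1) := by
      have : (2 * C + T + 1) ≤ (q.totient : ℝ)⁻¹ * Real.log R := by
        rw [inv_mul_eq_div, le_div_iff₀ hφ]; linarith
      have := mul_le_mul_of_nonneg_left hlogM (inv_nonneg.2 hφ.le)
      linarith
    linarith
  have hle : ∀ n ∈ Ioc M N, vonMangoldt.residueClass a n / (n : ℝ) ≤
      (if n.Prime ∧ (n : ZMod q) = a then Real.log N * (R / N) else 0) +
        (if n.Prime then 0 else vonMangoldt.residueClass a n) / (n : ℝ) := by
    intro n hn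
    obtain ⟨hn1, hn2⟩ := mem_Ioc.1 hn
    have hn0 : (0 : ℝ) < n := by exact_mod_cast (Nat.zero_le M).trans_lt hn1
    by_cases hp : n.Prime
    · by_cases hna : (n : ZMod q) = a
      · have hval : vonMangoldt.residueClass a n = Real.log n := by
          rw [vonMangoldt.residueClass, Set.indicator_of_mem (by exact hna),
            vonMangoldt_apply_prime hp]
        simp only [hp, hna, and_self, if_true, zero_div, add_zero]
        rw [hval, div_eq_mul_inv]
        have hinv : (n : ℝ)⁻¹ ≤ R / N := by
          rw [← inv_div]
          refine inv_anti₀ (by positivity) (hM2.le.trans ?_)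
          exact_mod_cast hn1
        refine mul_le_mul (Real.log_le_log hn0 (by exact_mod_cast hn2)) hinv (by positivity) ?_
        exact Real.log_natCast_nonneg N
      · have hval : vonMangoldt.residueClass a n = 0 := by
          rw [vonMangoldt.residueClass, Set.indicator_of_notMem (by exact hna)]
        simp [hna]
    · simp [hp]
  have h4 := hmain.trans (sum_le_sum hle)
  rw [sum_add_distrib, ← sum_filter, sum_const, nsmul_eq_mul] at h4
  have h5 : ∑ n ∈ Ioc M N, (if n.Prime then 0 else vonMangoldt.residueClass a n) / (n : ℝ) ≤ T :=
    hsum.sum_le_tsum _ fun n _ => hterm0 n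
  have h6 : (#((Ioc M N).filter fun p : ℕ => p.Prime ∧ (p : ZMod q) = a) : ℝ) ≤
      #((Ioc 0 N).filter fun p : ℕ => p.Prime ∧ (p : ZMod q) = a) := by
    exact_mod_cast card_le_card (filter_subset_filter _ (Ioc_subset_Ioc_left (Nat.zero_le M)))
  have h7 : 1 ≤ (#((Ioc 0 N).filter fun p : ℕ => p.Prime ∧ (p : ZMod q) = a) : ℝ) * (Real.log N * (R / N)) := by
    have := mul_le_mul_of_nonneg_right h6
      (mul_nonneg (Real.log_natCast_nonneg N) (by positivity : (0 : ℝ) ≤ R / N))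
    linarith
  have h8 : (N : ℝ) / R ≤ #((Ioc 0 N).filter fun p : ℕ => p.Prime ∧ (p : ZMod q) = a) * Real.log N := by
    calc (N : ℝ) / R = 1 * (N / R) := by ring
      _ ≤ _ := mul_le_mul_of_nonneg_right h7 (by positivity)
      _ = _ := by field_simp
  refine le_trans ?_ h8
  rw [div_mul_eq_mul_div, one_mul]
  exact div_le_div_of_nonneg_left hN0.le hR0 (by linarith)

end PrimesInProgressions

section IdealCounting

variable {K : Type*} [Field K] [NumberField K]

theorem NumberField.exists_injOn_primesOver_fin (p : ℕ) (hp : p.Prime) :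
    ∃ f : Ideal (𝓞 K) → Fin (Module.finrank ℚ K),
      Set.InjOn f {P | P.IsPrime ∧ Ideal.absNorm (P.under ℤ) = p} := by
  classical
  have : (Ideal.span {(p : ℤ)}).IsMaximal :=
    PrincipalIdealRing.isMaximal_of_irreducible (Nat.prime_iff_prime_int.mp hp).irreducible
  have hp0 : Ideal.span {(p : ℤ)} ≠ ⊥ := by simpa using hp.ne_zero
  have hcard : (IsDedekindDomain.primesOverFinset (Ideal.span {(p : ℤ)}) (𝓞 K)).card
      ≤ Fintype.card (Fin (Module.finrank ℚ K)) := by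
    rw [Fintype.card_fin]
    exact Ideal.card_primesOverFinset_le_finrank (𝓞 K) ℚ K hp0
  have hne : Nonempty (Fin (Module.finrank ℚ K)) := ⟨⟨0, Module.finrank_pos⟩⟩
  have hle : (Fintype.card ↥(IsDedekindDomain.primesOverFinset (Ideal.span {(p : ℤ)}) (𝓞 K)))
      ≤ Fintype.card (Fin (Module.finrank ℚ K)) := by rwa [Fintype.card_coe]
  obtain ⟨e⟩ := Function.Embedding.nonempty_of_card_le hle
  have hmem : ∀ P : Ideal (𝓞 K), P.IsPrime ∧ Ideal.absNorm (P.under ℤ) = p →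
      P ∈ IsDedekindDomain.primesOverFinset (Ideal.span {(p : ℤ)}) (𝓞 K) := by
    rintro P ⟨hP, hPp⟩
    rw [IsDedekindDomain.mem_primesOverFinset_iff hp0]
    refine ⟨hP, ⟨?_⟩⟩
    rw [← hPp, Int.ideal_span_absNorm_eq_self]
  refine ⟨fun P => if h : P ∈ IsDedekindDomain.primesOverFinset (Ideal.span {(p : ℤ)}) (𝓞 K)
    then e ⟨P, h⟩ else hne.some, ?_⟩
  intro P hP Q hQ hPQ
  simp only [dif_pos (hmem P hP), dif_pos (hmem Q hQ)] at hPQ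
  simpa using e.injective hPQ

theorem NumberField.exists_tuple_injOn_ideals :
    ∃ φ : Ideal (𝓞 K) → Fin (Module.finrank ℚ K) → ℕ,
      Set.InjOn φ {J | J ≠ ⊥} ∧ ∀ J, J ≠ ⊥ →
        (∀ i, 0 < φ J i) ∧ ∏ i, φ J i ≤ Ideal.absNorm J := by
  classical
  choose f hf using fun p : ℕ => fun hp : p.Prime =>
    NumberField.exists_injOn_primesOver_fin (K := K) p hp
  have hne : Nonempty (Fin (Module.finrank ℚ K)) := ⟨⟨0, Module.finrank_pos⟩⟩
  set pp : Ideal (𝓞 K) → ℕ := fun P => Ideal.absNorm (P.under ℤ) with hpp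
  set lab : Ideal (𝓞 K) → Fin (Module.finrank ℚ K) := fun P =>
    if h : (pp P).Prime then f (pp P) h P else hne.some with hlab
  have hprime : ∀ P : Ideal (𝓞 K), P.IsPrime → P ≠ ⊥ → (pp P).Prime := by
    intro P hP hP0
    have : NeZero P := ⟨hP0⟩
    exact Nat.absNorm_under_prime P
  have hinj : ∀ i, Set.InjOn pp {P | P.IsPrime ∧ P ≠ ⊥ ∧ lab P = i} := by
    rintro i P ⟨hP, hP0, hPi⟩ Q ⟨hQ, hQ0, hQi⟩ hPQ
    have h1 : lab P = lab Q := hPi.trans hQi.symm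
    simp only [hlab, dif_pos (hprime P hP hP0), dif_pos (hprime Q hQ hQ0)] at h1
    refine hf (pp P) (hprime P hP hP0) ⟨hP, rfl⟩ ⟨hQ, hPQ.symm⟩ ?_
    rw [h1]
    congr 1
    simp only [hPQ]
  have hfac : ∀ J : Ideal (𝓞 K), J ≠ ⊥ → ∀ P ∈ UniqueFactorizationMonoid.normalizedFactors J,
      P.IsPrime ∧ P ≠ ⊥ := by
    intro J hJ P hP
    have := UniqueFactorizationMonoid.prime_of_normalized_factor P hP
    exact ⟨Ideal.isPrime_of_prime this, this.ne_zero⟩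
  refine ⟨fun J i => (((UniqueFactorizationMonoid.normalizedFactors J).filter
    (fun P => lab P = i)).map pp).prod, ?_, ?_⟩
  · intro J hJ J' hJ' h
    have hkey : ∀ i, (UniqueFactorizationMonoid.normalizedFactors J).filter (fun P => lab P = i) =
        (UniqueFactorizationMonoid.normalizedFactors J').filter (fun P => lab P = i) := by
      intro i
      have h1 := congrFun h i
      have h2 : ∀ L : Ideal (𝓞 K), L ≠ ⊥ → UniqueFactorizationMonoid.normalizedFactors
          ((((UniqueFactorizationMonoid.normalizedFactors L).filter
            (fun P => lab P = i)).map pp).prod) =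
          (((UniqueFactorizationMonoid.normalizedFactors L).filter
            (fun P => lab P = i)).map pp) := by
        intro L hL
        apply UniqueFactorizationMonoid.normalizedFactors_prod_of_prime
        intro p hp
        rw [Multiset.mem_map] at hp
        obtain ⟨P, hP, rfl⟩ := hp
        rw [Multiset.mem_filter] at hP
        exact (hprime P (hfac L hL P hP.1).1 (hfac L hL P hP.1).2).prime
      have h3 : ∀ L : Ideal (𝓞 K), L ≠ ⊥ →
          (((UniqueFactorizationMonoid.normalizedFactors L).filter
            (fun P => lab P = i)).map pp).map
            (Function.invFunOn pp {P | P.IsPrime ∧ P ≠ ⊥ ∧ lab P = i}) =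
          (UniqueFactorizationMonoid.normalizedFactors L).filter (fun P => lab P = i) := by
        intro L hL
        rw [Multiset.map_map]
        conv_rhs => rw [← Multiset.map_id ((UniqueFactorizationMonoid.normalizedFactors L).filter
          (fun P => lab P = i))]
        apply Multiset.map_congr rfl
        intro P hP
        rw [Multiset.mem_filter] at hP
        exact (hinj i).leftInvOn_invFunOn
          ⟨(hfac L hL P hP.1).1, (hfac L hL P hP.1).2, hP.2⟩
      rw [← h3 J hJ, ← h3 J' hJ', ← h2 J hJ, ← h2 J' hJ']
      exact congrArg (fun n => (UniqueFactorizationMonoid.normalizedFactors n).map _) h1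
    have h4 : UniqueFactorizationMonoid.normalizedFactors J =
        UniqueFactorizationMonoid.normalizedFactors J' := by
      ext P
      have := congrArg (Multiset.count P) (hkey (lab P))
      rwa [Multiset.count_filter, Multiset.count_filter, if_pos rfl, if_pos rfl] at this
    rw [← Ideal.prod_normalizedFactors_eq_self hJ, h4, Ideal.prod_normalizedFactors_eq_self hJ']
  · intro J hJ
    constructor
    · intro i
      refine Nat.pos_of_ne_zero ?_
      intro h0
      rw [Multiset.prod_eq_zero_iff, Multiset.mem_map] at h0
      obtain ⟨P, hP, h0⟩ := h0
      rw [Multiset.mem_filter] at hP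
      exact (hprime P (hfac J hJ P hP.1).1 (hfac J hJ P hP.1).2).ne_zero h0
    · have h1 : ∏ i, (((UniqueFactorizationMonoid.normalizedFactors J).filter
          (fun P => lab P = i)).map pp).prod =
          ((UniqueFactorizationMonoid.normalizedFactors J).map pp).prod := by
        generalize UniqueFactorizationMonoid.normalizedFactors J = m
        induction m using Multiset.induction_on with
        | empty => simp
        | cons P m ih =>
          rw [Multiset.map_cons, Multiset.prod_cons, ← ih]
          rw [← Finset.mul_prod_erase _ _ (Finset.mem_univ (lab P)),
            ← Finset.mul_prod_erase Finset.univ (fun i => ((m.filter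
              (fun P => lab P = i)).map pp).prod) (Finset.mem_univ (lab P)),
            Multiset.filter_cons_of_pos (p := fun Q => lab Q = lab P) m rfl, Multiset.map_cons, Multiset.prod_cons, mul_assoc]
          congr 2
          refine Finset.prod_congr rfl fun i hi => ?_
          rw [Multiset.filter_cons_of_neg]
          exact (Finset.ne_of_mem_erase hi).symm
      rw [h1]
      have h2 : Ideal.absNorm J = ((UniqueFactorizationMonoid.normalizedFactors J).map
          Ideal.absNorm).prod := by
        conv_lhs => rw [← Ideal.prod_normalizedFactors_eq_self hJ]
        rw [map_multiset_prod]
      rw [h2]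
      refine Nat.le_of_dvd ?_ ?_
      · rw [← h2]
        exact Nat.pos_of_ne_zero (fun h => hJ (Ideal.absNorm_eq_zero_iff.mp h))
      · exact Multiset.prod_dvd_prod_of_dvd _ _ fun P _ => Int.absNorm_under_dvd_absNorm P

/-- The number of nonzero ideals of norm at most `Y` is `O(Y ^ s)` for `s > 1`, with an explicit
constant depending only on the degree. -/
theorem NumberField.card_ideals_absNorm_le (S : Finset (Ideal (𝓞 K))) {Y s : ℝ} (hY0 : 0 ≤ Y) (hs : 1 < s)
    (hS : ∀ J ∈ S, J ≠ ⊥ ∧ (Ideal.absNorm J : ℝ) ≤ Y) :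
    (S.card : ℝ) ≤ Y ^ s * (∑' n : ℕ, 1 / (n : ℝ) ^ s) ^ (Module.finrank ℚ K) := by
  classical
  obtain ⟨φ, hφ, hφ'⟩ := NumberField.exists_tuple_injOn_ideals (K := K)
  have hsum : Summable fun n : ℕ => 1 / (n : ℝ) ^ s := Real.summable_one_div_nat_rpow.mpr hs
  set g : ℕ → ℝ := fun n => 1 / (n : ℝ) ^ s with hg
  have hg0 : ∀ n, 0 ≤ g n := fun n => by positivity
  set T : Finset ℕ := S.biUnion fun J => Finset.univ.image (φ J) with hT
  have h1 : ∀ J ∈ S, 1 ≤ Y ^ s * ∏ i, g (φ J i) := by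
    intro J hJ
    obtain ⟨hJ0, hJY⟩ := hS J hJ
    obtain ⟨hpos, hle⟩ := hφ' J hJ0
    have hpos' : 0 < ∏ i, (φ J i : ℝ) :=
      Finset.prod_pos fun i _ => Nat.cast_pos.mpr (hpos i)
    have hle' : ∏ i, (φ J i : ℝ) ≤ Y := le_trans (by exact_mod_cast hle) hJY
    have hprod : ∏ i, g (φ J i) = 1 / (∏ i, (φ J i : ℝ)) ^ s := by
      simp only [hg, one_div, Finset.prod_inv_distrib]
      rw [Real.finsetProd_rpow _ _ fun i _ => Nat.cast_nonneg _]
    rw [hprod, mul_one_div, le_div_iff₀ (Real.rpow_pos_of_pos hpos' s), one_mul]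
    exact Real.rpow_le_rpow hpos'.le hle' (by linarith)
  have hinj : Set.InjOn φ S := hφ.mono fun J hJ => (hS J hJ).1
  have hY : 0 ≤ Y ^ s := Real.rpow_nonneg hY0 s
  calc (S.card : ℝ) = ∑ J ∈ S, (1 : ℝ) := by simp
    _ ≤ ∑ J ∈ S, Y ^ s * ∏ i, g (φ J i) := Finset.sum_le_sum h1
    _ = Y ^ s * ∑ J ∈ S, ∏ i, g (φ J i) := by rw [Finset.mul_sum]
    _ = Y ^ s * ∑ x ∈ S.image φ, ∏ i, g (x i) := by rw [Finset.sum_image hinj]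
    _ ≤ Y ^ s * ∑ x ∈ Fintype.piFinset (fun _ : Fin (Module.finrank ℚ K) => T), ∏ i, g (x i) := by
        refine mul_le_mul_of_nonneg_left ?_ hY
        refine Finset.sum_le_sum_of_subset_of_nonneg ?_ fun x _ _ =>
          Finset.prod_nonneg fun i _ => hg0 _
        intro x hx
        obtain ⟨J, hJ, rfl⟩ := Finset.mem_image.mp hx
        refine Fintype.mem_piFinset.mpr fun i => ?_
        exact Finset.mem_biUnion.mpr ⟨J, hJ, Finset.mem_image_of_mem _ (Finset.mem_univ i)⟩
    _ = Y ^ s * ∏ _i : Fin (Module.finrank ℚ K), ∑ n ∈ T, g n := by rw [Finset.prod_univ_sum]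
    _ = Y ^ s * (∑ n ∈ T, g n) ^ Module.finrank ℚ K := by simp
    _ ≤ Y ^ s * (∑' n : ℕ, g n) ^ Module.finrank ℚ K := by
        refine mul_le_mul_of_nonneg_left ?_ hY
        refine pow_le_pow_left₀ (Finset.sum_nonneg fun n _ => hg0 n) ?_ _
        exact hsum.sum_le_tsum T fun n _ => hg0 n

end IdealCounting

section TorsionPigeonhole

variable {K : Type*} [Field K] [NumberField K]

theorem NumberField.exists_mem_ideal_forall_place_lt {I : Ideal (𝓞 K)} (hI : I ≠ ⊥)
    (f : InfinitePlace K → NNReal)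
    (h : (2 : ℝ) ^ Module.finrank ℚ K * √|(discr K : ℝ)| * Ideal.absNorm I <
      ∏ w, (f w : ℝ) ^ w.mult) :
    ∃ β ∈ I, β ≠ 0 ∧ ∀ w : InfinitePlace K, w (β : K) < f w := by
  classical
  have hI' : (I : FractionalIdeal (nonZeroDivisors (𝓞 K)) K) ≠ 0 := by
    simpa [FractionalIdeal.coeIdeal_eq_zero] using hI
  have hbound : mixedEmbedding.minkowskiBound K (Units.mk0 _ hI') <
      MeasureTheory.volume (mixedEmbedding.convexBodyLT K f) := by
    have h1 : mixedEmbedding.minkowskiBound K (Units.mk0 _ hI') ≤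
        ENNReal.ofReal ((2 : ℝ) ^ Module.finrank ℚ K * √|(discr K : ℝ)| * Ideal.absNorm I) := by
      rw [mixedEmbedding.minkowskiBound,
        mixedEmbedding.volume_fundamentalDomain_fractionalIdealLatticeBasis,
        mixedEmbedding.volume_fundamentalDomain_latticeBasis, mixedEmbedding.finrank,
        Units.val_mk0, FractionalIdeal.coeIdeal_absNorm]
      have h2 : (2 : ENNReal)⁻¹ ^ InfinitePlace.nrComplexPlaces K ≤ 1 :=
        pow_le_one' (ENNReal.inv_le_one.mpr one_le_two) _
      have h3 : ((NNReal.sqrt ‖discr K‖₊ : NNReal) : ENNReal) =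
          ENNReal.ofReal (√|(discr K : ℝ)|) := by
        rw [← ENNReal.ofReal_coe_nnreal, Real.coe_sqrt, coe_nnnorm, Int.norm_eq_abs]
      have h4 : (2 : ENNReal) = ENNReal.ofReal 2 := by simp
      calc _ ≤ ENNReal.ofReal ((Ideal.absNorm I : ℚ) : ℝ) *
            (1 * ENNReal.ofReal (√|(discr K : ℝ)|)) * 2 ^ Module.finrank ℚ K := by
            rw [← h3]; gcongr
        _ = _ := by
            rw [one_mul, h4, ← ENNReal.ofReal_pow (by norm_num), ← ENNReal.ofReal_mul (by positivity),
              ← ENNReal.ofReal_mul (by positivity)]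
            congr 1
            push_cast
            ring
    refine h1.trans_lt ?_
    rw [mixedEmbedding.convexBodyLT_volume]
    have h5 : ((∏ w, (f w) ^ (w.mult) : NNReal) : ENNReal) =
        ENNReal.ofReal (∏ w, (f w : ℝ) ^ w.mult) := by
      rw [← ENNReal.ofReal_coe_nnreal]
      push_cast
      rfl
    have h6 : (1 : ENNReal) ≤ (mixedEmbedding.convexBodyLTFactor K : ENNReal) := by
      exact_mod_cast mixedEmbedding.one_le_convexBodyLTFactor K
    calc _ < ENNReal.ofReal (∏ w, (f w : ℝ) ^ w.mult) :=
          (ENNReal.ofReal_lt_ofReal_iff_of_nonneg (by positivity)).mpr h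
      _ = 1 * ((∏ w, (f w) ^ (w.mult) : NNReal) : ENNReal) := by rw [h5, one_mul]
      _ ≤ _ := by gcongr
  obtain ⟨a, ha, ha0, haf⟩ := mixedEmbedding.exists_ne_zero_mem_ideal_lt K _ hbound
  rw [Units.val_mk0, FractionalIdeal.mem_coeIdeal] at ha
  obtain ⟨β, hβ, rfl⟩ := ha
  refine ⟨β, hβ, ?_, haf⟩
  rintro rfl
  simp at ha0

theorem NumberField.InfinitePlace.prod_pow_mult_eq_absNorm_span (x : 𝓞 K) :
    ∏ w : InfinitePlace K, w (x : K) ^ w.mult = Ideal.absNorm (Ideal.span {x}) := by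
  rw [InfinitePlace.prod_eq_abs_norm, Ideal.absNorm_span_singleton, ← Algebra.coe_norm_int]
  simp [Nat.cast_natAbs]

theorem NumberField.exists_reduced_mul {I P : Ideal (𝓞 K)} (hI : I ≠ ⊥) (hP : P ≠ ⊥)
    {ℓ : ℕ} (hℓ : 0 < ℓ) {g : 𝓞 K} (hg : I ^ ℓ = Ideal.span {g}) {B : ℝ} (hB : 1 ≤ B)
    (hBd : (2 : ℝ) ^ Module.finrank ℚ K * √|(discr K : ℝ)| < B ^ Module.finrank ℚ K) :
    ∃ (β : 𝓞 K) (J : Ideal (𝓞 K)) (t : InfinitePlace K → ℝ), β ≠ 0 ∧ J ≠ ⊥ ∧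
      Ideal.span {β} = J * (I * P) ∧ (Ideal.absNorm J : ℝ) ≤ B ^ Module.finrank ℚ K ∧
      (∀ w, 0 < t w ∧ t w ≤ B ∧ 1 ≤ t w * B ^ (Module.finrank ℚ K - 1)) ∧
      ∀ w : InfinitePlace K, w (β : K) ^ ℓ =
        t w ^ ℓ * w (g : K) * (Ideal.absNorm P : ℝ) ^ ((ℓ : ℝ) / Module.finrank ℚ K) := by
  set d := Module.finrank ℚ K with hd
  have hd0 : 0 < d := Module.finrank_pos
  have hB0 : 0 < B := by linarith
  have hg0 : g ≠ 0 := by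
    rintro rfl
    rw [Ideal.span_singleton_zero] at hg
    exact hI (pow_eq_zero_iff hℓ.ne' |>.mp hg)
  have hgw : ∀ w : InfinitePlace K, 0 < w (g : K) := fun w =>
    InfinitePlace.pos_iff.mpr (by simpa using hg0)
  have hNI : 0 < (Ideal.absNorm I : ℝ) :=
    Nat.cast_pos.mpr (Nat.pos_of_ne_zero fun h => hI (Ideal.absNorm_eq_zero_iff.mp h))
  have hNP : 0 < (Ideal.absNorm P : ℝ) :=
    Nat.cast_pos.mpr (Nat.pos_of_ne_zero fun h => hP (Ideal.absNorm_eq_zero_iff.mp h))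
  set N := (Ideal.absNorm P : ℝ) with hN
  set u : InfinitePlace K → ℝ := fun w => (w (g : K)) ^ ((1 : ℝ) / ℓ) * N ^ ((1 : ℝ) / d) with hu
  have hu0 : ∀ w, 0 < u w := fun w =>
    mul_pos (Real.rpow_pos_of_pos (hgw w) _) (Real.rpow_pos_of_pos hNP _)
  have huprod : ∏ w, u w ^ w.mult = Ideal.absNorm I * N := by
    simp only [hu, mul_pow, Finset.prod_mul_distrib]
    congr 1
    · have : ∀ w : InfinitePlace K, ((w (g : K)) ^ ((1 : ℝ) / ℓ)) ^ w.mult =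
          (w (g : K) ^ w.mult) ^ ((1 : ℝ) / ℓ) := by
        intro w
        rw [← Real.rpow_natCast, ← Real.rpow_natCast, ← Real.rpow_mul (hgw w).le,
          ← Real.rpow_mul (hgw w).le, mul_comm]
      simp only [this]
      rw [Real.finsetProd_rpow _ _ fun w _ => pow_nonneg (hgw w).le _,
        InfinitePlace.prod_pow_mult_eq_absNorm_span, ← hg, map_pow, Nat.cast_pow, one_div,
        Real.pow_rpow_inv_natCast hNI.le hℓ.ne']
    · rw [Finset.prod_pow_eq_pow_sum, InfinitePlace.sum_mult_eq, ← hd, one_div,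
        Real.rpow_inv_natCast_pow hNP.le hd0.ne']
  have huℓ : ∀ w, u w ^ ℓ = w (g : K) * N ^ ((ℓ : ℝ) / d) := by
    intro w
    simp only [hu, mul_pow]
    rw [one_div, Real.rpow_inv_natCast_pow (hgw w).le hℓ.ne', ← Real.rpow_natCast,
      ← Real.rpow_mul hNP.le, one_div, inv_mul_eq_div]
  obtain ⟨β, hβ, hβ0, hβw⟩ := NumberField.exists_mem_ideal_forall_place_lt
    (I := I * P) (mul_ne_zero hI hP) (fun w => (B * u w).toNNReal) (by
      simp only [Real.coe_toNNReal _ (mul_pos hB0 (hu0 _)).le, mul_pow, Finset.prod_mul_distrib]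
      rw [huprod, map_mul, Nat.cast_mul, Finset.prod_pow_eq_pow_sum, InfinitePlace.sum_mult_eq]
      exact mul_lt_mul_of_pos_right hBd (mul_pos hNI hNP))
  simp only [Real.coe_toNNReal _ (mul_pos hB0 (hu0 _)).le] at hβw
  obtain ⟨J, hJ⟩ : I * P ∣ Ideal.span {β} :=
    Ideal.dvd_iff_le.mpr ((Ideal.span_singleton_le_iff_mem _).mpr hβ)
  rw [mul_comm] at hJ
  have hJ0 : J ≠ ⊥ := by
    rintro rfl
    rw [Ideal.bot_mul, Ideal.span_singleton_eq_bot] at hJ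
    exact hβ0 hJ
  have hβw0 : ∀ w : InfinitePlace K, 0 < w (β : K) := fun w =>
    InfinitePlace.pos_iff.mpr (by simpa using hβ0)
  set t : InfinitePlace K → ℝ := fun w => w (β : K) / u w with ht
  have ht0 : ∀ w, 0 < t w := fun w => div_pos (hβw0 w) (hu0 w)
  have htB : ∀ w, t w ≤ B := fun w => (div_le_iff₀ (hu0 w)).mpr (hβw w).le
  have htprod : ∏ w, t w ^ w.mult = Ideal.absNorm J := by
    simp only [ht, div_pow, Finset.prod_div_distrib]
    rw [huprod, InfinitePlace.prod_pow_mult_eq_absNorm_span, hJ, map_mul, map_mul]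
    push_cast
    rw [← hN]
    field_simp
  refine ⟨β, J, t, hβ0, hJ0, hJ, ?_, fun w => ⟨ht0 w, htB w, ?_⟩, fun w => ?_⟩
  · rw [← htprod, hd, ← InfinitePlace.sum_mult_eq, ← Finset.prod_pow_eq_pow_sum]
    exact Finset.prod_le_prod (fun w _ => (pow_pos (ht0 w) _).le)
      fun w _ => pow_le_pow_left₀ (ht0 w).le (htB w) _
  · classical
    have hJ1 : (1 : ℝ) ≤ Ideal.absNorm J :=
      Nat.one_le_cast.mpr (Nat.pos_of_ne_zero fun h => hJ0 (Ideal.absNorm_eq_zero_iff.mp h))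
    rw [← htprod, ← Finset.mul_prod_erase _ _ (Finset.mem_univ w)] at hJ1
    have hsum : w.mult + ∑ v ∈ Finset.univ.erase w, v.mult = d := by
      rw [Finset.add_sum_erase _ _ (Finset.mem_univ w), InfinitePlace.sum_mult_eq]
    have hm : 0 < w.mult := InfinitePlace.mult_pos
    calc 1 ≤ _ := hJ1
      _ ≤ (t w * B ^ (w.mult - 1)) * ∏ v ∈ Finset.univ.erase w, B ^ v.mult := by
        refine mul_le_mul ?_ ?_ (Finset.prod_nonneg fun v _ => (pow_pos (ht0 v) _).le)
          (mul_nonneg (ht0 w).le (pow_nonneg hB0.le _))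
        · conv_lhs => rw [← Nat.succ_pred_eq_of_pos hm, pow_succ']
          exact mul_le_mul_of_nonneg_left (pow_le_pow_left₀ (ht0 w).le (htB w) _) (ht0 w).le
        · exact Finset.prod_le_prod (fun w _ => (pow_pos (ht0 w) _).le)
            fun w _ => pow_le_pow_left₀ (ht0 w).le (htB w) _
      _ = t w * B ^ (d - 1) := by
        rw [Finset.prod_pow_eq_pow_sum, mul_assoc, ← pow_add]
        congr 2
        omega
  · rw [mul_assoc, ← huℓ, ← mul_pow]
    simp only [ht]
    rw [div_mul_cancel₀ _ (hu0 w).ne']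

theorem NumberField.card_torsion_mul_card_le {ℓ : ℕ} (hℓ : 0 < ℓ) (S : Finset (Ideal (𝓞 K)))
    (hS0 : ∀ P ∈ S, P ≠ ⊥)
    (hS : ∀ P ∈ S, ∀ Q ∈ S, P ≠ Q → ∀ x y : 𝓞 K, x ≠ 0 → y ≠ 0 →
      Ideal.span {x} * Q ^ ℓ = Ideal.span {y} * P ^ ℓ →
      ∃ w : InfinitePlace K, Real.exp ℓ * (w (y : K) *
        (Ideal.absNorm P : ℝ) ^ ((ℓ : ℝ) / Module.finrank ℚ K)) <
        w (x : K) * (Ideal.absNorm Q : ℝ) ^ ((ℓ : ℝ) / Module.finrank ℚ K))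
    {B s : ℝ} (hB : 1 ≤ B) (hs : 1 < s)
    (hBd : (2 : ℝ) ^ Module.finrank ℚ K * √|(discr K : ℝ)| < B ^ Module.finrank ℚ K) :
    (Nat.card {c : ClassGroup (𝓞 K) // c ^ ℓ = 1} : ℝ) * S.card ≤
      (B ^ Module.finrank ℚ K) ^ s * (∑' n : ℕ, 1 / (n : ℝ) ^ s) ^ Module.finrank ℚ K *
        (Module.finrank ℚ K * Real.log B + 2) ^ Module.finrank ℚ K := by
  classical
  set d := Module.finrank ℚ K with hd
  have hd0 : 0 < d := Module.finrank_pos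
  have hB0 : 0 < B := by linarith
  have hc : ∀ c : {c : ClassGroup (𝓞 K) // c ^ ℓ = 1}, ∃ (I : nonZeroDivisors (Ideal (𝓞 K)))
      (g : 𝓞 K), ClassGroup.mk0 I = c ∧ (I : Ideal (𝓞 K)) ^ ℓ = Ideal.span {g} := by
    rintro ⟨c, hc⟩
    obtain ⟨I, rfl⟩ := ClassGroup.mk0_surjective c
    rw [← map_pow, ClassGroup.mk0_eq_one_iff] at hc
    obtain ⟨g, hg⟩ := hc.principal
    exact ⟨I, g, rfl, by simpa using hg⟩
  choose I g hIc hIg using hc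
  have hI0 : ∀ c, (I c : Ideal (𝓞 K)) ≠ ⊥ := fun c => nonZeroDivisors.coe_ne_zero _
  have hg0 : ∀ c, g c ≠ 0 := by
    intro c h
    have := hIg c
    rw [h, Ideal.span_singleton_zero] at this
    exact hI0 c (pow_eq_zero_iff hℓ.ne' |>.mp this)
  choose β J t hβ0 hJ0 hβ hJN ht htw using
    fun c : {c : ClassGroup (𝓞 K) // c ^ ℓ = 1} => fun P : S =>
      NumberField.exists_reduced_mul (hI0 c) (hS0 P P.2) hℓ (hIg c) hB hBd
  have hlog : ∀ c P w, -((d : ℝ) - 1) * Real.log B ≤ Real.log (t c P w) ∧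
      Real.log (t c P w) ≤ Real.log B := by
    intro c P w
    obtain ⟨h0, h1, h2⟩ := ht c P w
    refine ⟨?_, Real.log_le_log h0 h1⟩
    have := Real.log_nonneg h2
    rw [Real.log_mul h0.ne' (pow_pos hB0 _).ne', Real.log_pow, Nat.cast_sub hd0] at this
    push_cast at this
    linarith
  set F : ({c : ClassGroup (𝓞 K) // c ^ ℓ = 1} × S) → Ideal (𝓞 K) × (InfinitePlace K → ℤ) :=
    fun x => (J x.1 x.2, fun w => ⌊Real.log (t x.1 x.2 w)⌋) with hF
  have hFinj : Function.Injective F := by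
    rintro ⟨c, P⟩ ⟨c', Q⟩ h
    simp only [hF, Prod.mk.injEq] at h
    obtain ⟨hJJ, hfl⟩ := h
    have hPQ : P = Q := by
      by_contra hne
      obtain ⟨w, hw⟩ := hS P P.2 Q Q.2 (fun h => hne (Subtype.ext h))
        (β c P ^ ℓ * g c') (β c' Q ^ ℓ * g c)
        (mul_ne_zero (pow_ne_zero _ (hβ0 _ _)) (hg0 _))
        (mul_ne_zero (pow_ne_zero _ (hβ0 _ _)) (hg0 _)) (by
          rw [← Ideal.span_singleton_mul_span_singleton, ← Ideal.span_singleton_mul_span_singleton,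
            ← Ideal.span_singleton_pow, ← Ideal.span_singleton_pow, hβ, hβ, ← hIg, ← hIg, hJJ]
          simp only [mul_pow]
          ring)
      refine absurd hw (not_lt.mpr ?_)
      push_cast
      rw [map_mul, map_mul, map_pow, map_pow, htw, htw]
      have hlt : Real.log (t c P w) ≤ Real.log (t c' Q w) + 1 := by
        have h1 := congrFun hfl w
        have h2 := Int.lt_floor_add_one (Real.log (t c P w))
        have h3 := Int.floor_le (Real.log (t c' Q w))
        rw [h1] at h2
        linarith
      have hle : t c P w ≤ t c' Q w * Real.exp 1 := by
        rw [← Real.log_le_log_iff (ht c P w).1 (mul_pos (ht c' Q w).1 (Real.exp_pos 1)),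
          Real.log_mul (ht c' Q w).1.ne' (Real.exp_pos 1).ne', Real.log_exp]
        exact hlt
      have hle' : t c P w ^ ℓ ≤ t c' Q w ^ ℓ * Real.exp ℓ := by
        have := pow_le_pow_left₀ (ht c P w).1.le hle ℓ
        rwa [mul_pow, ← Real.exp_nat_mul, mul_one] at this
      have hnn : 0 ≤ w (g c : K) * (Ideal.absNorm (P : Ideal (𝓞 K)) : ℝ) ^ ((ℓ : ℝ) / d) *
          w (g c' : K) * (Ideal.absNorm (Q : Ideal (𝓞 K)) : ℝ) ^ ((ℓ : ℝ) / d) := by positivity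
      have := mul_le_mul_of_nonneg_right hle' hnn
      rw [← hd]
      linarith
    subst hPQ
    have hcc : c = c' := by
      apply Subtype.ext
      rw [← hIc c, ← hIc c', ClassGroup.mk0_eq_mk0_iff]
      refine ⟨β c' P, β c P, hβ0 _ _, hβ0 _ _, ?_⟩
      rw [hβ, hβ, hJJ]
      ring
    rw [hcc]
  have hfin : {J : Ideal (𝓞 K) | J ≠ ⊥ ∧ (Ideal.absNorm J : ℝ) ≤ B ^ d}.Finite := by
    refine (Ideal.finite_setOfPred_absNorm_le ⌊B ^ d⌋₊).subset ?_
    rintro J ⟨_, hJ⟩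
    exact Nat.le_floor hJ
  set T : Finset (Ideal (𝓞 K) × (InfinitePlace K → ℤ)) := hfin.toFinset ×ˢ
    Fintype.piFinset fun _ => Finset.Icc ⌊-((d : ℝ) - 1) * Real.log B⌋ ⌊Real.log B⌋ with hT
  have hFT : ∀ x, F x ∈ T := by
    rintro ⟨c, P⟩
    simp only [hT, hF, Finset.mem_product, Set.Finite.mem_toFinset, Set.mem_ofPred_eq,
      Fintype.mem_piFinset, Finset.mem_Icc]
    exact ⟨⟨hJ0 c P, hJN c P⟩, fun w => ⟨Int.floor_le_floor (hlog c P w).1,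
      Int.floor_le_floor (hlog c P w).2⟩⟩
  have hcard : Nat.card ({c : ClassGroup (𝓞 K) // c ^ ℓ = 1} × S) ≤ T.card := by
    rw [← Nat.card_eq_finsetCard]
    exact Nat.card_le_card_of_injective (fun x => (⟨F x, hFT x⟩ : T))
      fun x y h => hFinj (Subtype.ext_iff.mp h)
  rw [Nat.card_prod, Nat.card_eq_finsetCard] at hcard
  have hlogB : 0 ≤ Real.log B := Real.log_nonneg hB
  have hT1 : (T.card : ℝ) ≤ ((B ^ d) ^ s * (∑' n : ℕ, 1 / (n : ℝ) ^ s) ^ d) *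
      (d * Real.log B + 2) ^ d := by
    rw [hT, Finset.card_product, Nat.cast_mul]
    have hnn : (0 : ℝ) ≤ d * Real.log B + 2 := by positivity
    refine mul_le_mul ?_ ?_ (Nat.cast_nonneg _) ?_
    · exact NumberField.card_ideals_absNorm_le _ (by positivity) hs fun J hJ => by simpa using hJ
    · rw [Fintype.card_piFinset, Finset.prod_const, Finset.card_univ, Nat.cast_pow, Int.card_Icc]
      have h_int : (((⌊Real.log B⌋ + 1 - ⌊-((d : ℝ) - 1) * Real.log B⌋).toNat : ℕ) : ℝ) ≤
          d * Real.log B + 2 := by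
        have h1 := Int.floor_le (Real.log B)
        have h2 := Int.lt_floor_add_one (-((d : ℝ) - 1) * Real.log B)
        rcases le_total 0 (⌊Real.log B⌋ + 1 - ⌊-((d : ℝ) - 1) * Real.log B⌋) with h | h
        · have h3 : (((⌊Real.log B⌋ + 1 - ⌊-((d : ℝ) - 1) * Real.log B⌋).toNat : ℕ) : ℝ) =
            ((⌊Real.log B⌋ + 1 - ⌊-((d : ℝ) - 1) * Real.log B⌋ : ℤ) : ℝ) := by
            exact_mod_cast Int.toNat_of_nonneg h
          rw [h3]
          push_cast
          linarith
        · rw [Int.toNat_of_nonpos h]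
          simpa using hnn
      have hplaces : Fintype.card (InfinitePlace K) ≤ d := by
        rw [hd, ← InfinitePlace.sum_mult_eq, ← Finset.card_univ, Finset.card_eq_sum_ones]
        exact Finset.sum_le_sum fun w _ => InfinitePlace.mult_pos
      calc _ ≤ (d * Real.log B + 2) ^ Fintype.card (InfinitePlace K) :=
            pow_le_pow_left₀ (Nat.cast_nonneg _) h_int _
        _ ≤ _ := pow_le_pow_right₀ (by nlinarith [mul_nonneg (Nat.cast_nonneg (α := ℝ) d) hlogB])
            hplaces
    · refine mul_nonneg (by positivity) (pow_nonneg (tsum_nonneg fun n => by positivity) _)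
  calc _ = ((Nat.card {c : ClassGroup (𝓞 K) // c ^ ℓ = 1} * S.card : ℕ) : ℝ) := by push_cast; rfl
    _ ≤ T.card := by exact_mod_cast hcard
    _ ≤ _ := hT1

end TorsionPigeonhole

section PureField

/-- `K` is generated by a `d`-th root `θ` of the cubefree integer `A₁ * A₂ ^ 2`. -/
structure IsPureCubefree (K : Type*) [Field K] [NumberField K] (d A₁ A₂ : ℕ) (θ : 𝓞 K) :
    Prop where
  three_le : 3 ≤ d
  odd : Odd d
  squarefree_left : Squarefree A₁
  squarefree_right : Squarefree A₂
  coprime : A₁.Coprime A₂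
  one_lt : 1 < A₁ * A₂ ^ 2
  irreducible : Irreducible ((X : ℚ[X]) ^ d - C ((A₁ * A₂ ^ 2 : ℕ) : ℚ))
  pow_eq : θ ^ d = ((A₁ * A₂ ^ 2 : ℕ) : 𝓞 K)
  finrank_eq : Module.finrank ℚ K = d

namespace IsPureCubefree

variable {K : Type*} [Field K] [NumberField K] {d A₁ A₂ : ℕ} {θ : 𝓞 K}

theorem coe_pow_eq (h : IsPureCubefree K d A₁ A₂ θ) :
    (θ : K) ^ d = ((A₁ * A₂ ^ 2 : ℕ) : K) := by
  have := congrArg (algebraMap (𝓞 K) K) h.pow_eq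
  rwa [map_pow, map_natCast] at this

theorem d_pos (h : IsPureCubefree K d A₁ A₂ θ) : 0 < d := by have := h.three_le; omega

theorem left_pos (h : IsPureCubefree K d A₁ A₂ θ) : 0 < A₁ :=
  Nat.pos_of_ne_zero h.squarefree_left.ne_zero

theorem right_pos (h : IsPureCubefree K d A₁ A₂ θ) : 0 < A₂ :=
  Nat.pos_of_ne_zero h.squarefree_right.ne_zero

theorem ne_zero (h : IsPureCubefree K d A₁ A₂ θ) : θ ≠ 0 := by
  rintro rfl
  have h1 := h.pow_eq
  rw [zero_pow h.d_pos.ne'] at h1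
  have h2 := Nat.cast_eq_zero.mp h1.symm
  have := h.one_lt
  omega

theorem minpoly_eq (h : IsPureCubefree K d A₁ A₂ θ) :
    minpoly ℚ (θ : K) = (X : ℚ[X]) ^ d - C ((A₁ * A₂ ^ 2 : ℕ) : ℚ) := by
  refine (minpoly.eq_of_irreducible_of_monic h.irreducible ?_ ?_).symm
  · simp only [map_sub, map_pow, aeval_X, map_natCast, h.coe_pow_eq, sub_self]
  · exact monic_X_pow_sub_C _ h.d_pos.ne'

theorem exists_basis (h : IsPureCubefree K d A₁ A₂ θ) :
    ∃ b : Module.Basis (Fin d) ℚ K, ∀ i, b i = (θ : K) ^ (i : ℕ) := by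
  have hdeg : (minpoly ℚ (θ : K)).natDegree = d := by
    rw [h.minpoly_eq, natDegree_X_pow_sub_C]
  have hli : LinearIndependent ℚ fun i : Fin d => (θ : K) ^ (i : ℕ) := by
    have := linearIndependent_pow (K := ℚ) (θ : K)
    exact this.comp (finCongr hdeg.symm) (finCongr hdeg.symm).injective
  have : Nonempty (Fin d) := ⟨⟨0, h.d_pos⟩⟩
  refine ⟨basisOfLinearIndependentOfCardEqFinrank hli (by simp [h.finrank_eq]), fun i => ?_⟩
  simp

theorem trace_pow_eq_zero (h : IsPureCubefree K d A₁ A₂ θ) {n : ℕ} (hn : ¬ d ∣ n) :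
    Algebra.trace ℚ K ((θ : K) ^ n) = 0 := by
  obtain ⟨b, hb⟩ := h.exists_basis
  rw [Algebra.trace_eq_matrix_trace b, Matrix.trace]
  refine Finset.sum_eq_zero fun i _ => ?_
  rw [Matrix.diag_apply, Algebra.leftMulMatrix_eq_repr_mul, hb, ← pow_add]
  have hmod : (n + i) % d < d := Nat.mod_lt _ h.d_pos
  have h1 : (θ : K) ^ (n + i) =
      (((A₁ * A₂ ^ 2 : ℕ) : ℚ) ^ ((n + i) / d)) • b ⟨(n + i) % d, hmod⟩ := by
    rw [hb, Algebra.smul_def, map_pow, map_natCast, ← h.coe_pow_eq, ← pow_mul, ← pow_add,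
      Nat.div_add_mod]
  rw [h1, map_smul, Finsupp.smul_apply, b.repr_self, Finsupp.single_apply, if_neg, smul_zero]
  intro h2
  have h3 : (n + i) % d = i := congrArg Fin.val h2
  apply hn
  have h4 := Nat.div_add_mod (n + i) d
  rw [h3] at h4
  exact ⟨(n + i) / d, by omega⟩

theorem trace_pow (h : IsPureCubefree K d A₁ A₂ θ) (n : ℕ) :
    Algebra.trace ℚ K ((θ : K) ^ (d * n)) = d * ((A₁ * A₂ ^ 2 : ℕ) : ℚ) ^ n := by
  have h1 : (θ : K) ^ (d * n) = algebraMap ℚ K (((A₁ * A₂ ^ 2 : ℕ) : ℚ) ^ n) := by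
    rw [pow_mul, h.coe_pow_eq, map_pow, map_natCast]
  rw [h1, Algebra.trace_algebraMap, h.finrank_eq, nsmul_eq_mul]

theorem repr_eq (h : IsPureCubefree K d A₁ A₂ θ) (b : Module.Basis (Fin d) ℚ K)
    (hb : ∀ i, b i = (θ : K) ^ (i : ℕ)) (x : K) (k : Fin d) :
    Algebra.trace ℚ K (x * (θ : K) ^ (d - k : ℕ)) = d * (A₁ * A₂ ^ 2 : ℕ) * b.repr x k := by
  conv_lhs => rw [← b.sum_repr x]
  rw [Finset.sum_mul, map_sum, Finset.sum_eq_single k]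
  · have h1 : (k : ℕ) + (d - k) = d * 1 := by have := k.2; omega
    rw [smul_mul_assoc, map_smul, hb, ← pow_add, h1, h.trace_pow, pow_one, smul_eq_mul]
    ring
  · intro j _ hj
    rw [smul_mul_assoc, map_smul, hb, ← pow_add, h.trace_pow_eq_zero, smul_zero]
    rintro ⟨c, hc⟩
    have hj2 := j.2
    have hk2 := k.2
    have hne : (j : ℕ) ≠ k := fun h => hj (Fin.ext h)
    rcases lt_trichotomy c 1 with h0 | h0 | h0
    · have : c = 0 := by omega
      subst this
      omega
    · subst h0
      omega
    · have : d * 2 ≤ d * c := Nat.mul_le_mul_left d h0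
      omega
  · simp

theorem smul_eq_sum (h : IsPureCubefree K d A₁ A₂ θ) (x : 𝓞 K) :
    ((d * (A₁ * A₂ ^ 2) : ℕ) : 𝓞 K) * x =
      ∑ k : Fin d, (Algebra.trace ℤ (𝓞 K) (x * θ ^ (d - k : ℕ)) : 𝓞 K) * θ ^ (k : ℕ) := by
  obtain ⟨b, hb⟩ := h.exists_basis
  apply RingOfIntegers.ext
  simp only [map_mul, map_sum, map_natCast, map_intCast, map_pow]
  change ((d * (A₁ * A₂ ^ 2) : ℕ) : K) * (x : K) = ∑ k : Fin d,
    (Algebra.trace ℤ (𝓞 K) (x * θ ^ (d - k : ℕ)) : K) * (θ : K) ^ (k : ℕ)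
  conv_lhs => rw [← b.sum_repr (x : K)]
  rw [Finset.mul_sum]
  refine Finset.sum_congr rfl fun k _ => ?_
  rw [hb, Algebra.smul_def, ← mul_assoc]
  congr 1
  have h1 := h.repr_eq b hb x k
  have h2 : (Algebra.trace ℚ K) ((x : K) * (θ : K) ^ (d - k : ℕ)) =
      (Algebra.trace ℤ (𝓞 K) (x * θ ^ (d - k : ℕ)) : ℚ) := by
    rw [Algebra.coe_trace_int]
    simp
  rw [h2] at h1
  have h3 := congrArg (algebraMap ℚ K) h1
  simp only [map_mul, map_intCast, map_natCast] at h3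
  rw [h3]
  push_cast
  ring

theorem natCast_dvd_of_forall_dvd_trace (h : IsPureCubefree K d A₁ A₂ θ) {p : ℕ}
    (hp : p.Prime) (hpd : ¬ p ∣ d * (A₁ * A₂ ^ 2)) {x : 𝓞 K}
    (hx : ∀ y, (p : ℤ) ∣ Algebra.trace ℤ (𝓞 K) (x * y)) : (p : 𝓞 K) ∣ x := by
  have h1 : (p : 𝓞 K) ∣ ((d * (A₁ * A₂ ^ 2) : ℕ) : 𝓞 K) * x := by
    rw [h.smul_eq_sum x]
    refine Finset.dvd_sum fun k _ => Dvd.dvd.mul_right ?_ _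
    have := map_dvd (Int.castRingHom (𝓞 K)) (hx (θ ^ (d - k : ℕ)))
    simpa using this
  have h2 : IsCoprime (p : 𝓞 K) ((d * (A₁ * A₂ ^ 2) : ℕ) : 𝓞 K) :=
    Nat.Coprime.cast ((Nat.Prime.coprime_iff_not_dvd hp).mpr hpd)
  exact h2.dvd_of_dvd_mul_left h1

end IsPureCubefree

theorem NumberField.dvd_trace_of_dvd_pow {K : Type*} [Field K] [NumberField K] {p : ℕ}
    (hp : p.Prime) {x : 𝓞 K} {n : ℕ} (hx : (p : 𝓞 K) ∣ x ^ n) :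
    (p : ℤ) ∣ Algebra.trace ℤ (𝓞 K) x := by
  classical
  have : Fact p.Prime := ⟨hp⟩
  set b := RingOfIntegers.basis K
  obtain ⟨y, hy⟩ := hx
  rw [Algebra.trace_eq_matrix_trace b, ← ZMod.intCast_zmod_eq_zero_iff_dvd]
  have h1 : IsNilpotent ((Int.castRingHom (ZMod p)).mapMatrix (Algebra.leftMulMatrix b x)) := by
    refine ⟨n, ?_⟩
    rw [← map_pow, ← map_pow, hy, map_mul, map_mul, map_natCast, map_natCast]
    have : ((p : ℕ) : Matrix (Module.Free.ChooseBasisIndex ℤ (𝓞 K))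
        (Module.Free.ChooseBasisIndex ℤ (𝓞 K)) (ZMod p)) = 0 := by
      rw [← map_natCast (Matrix.scalar _), CharP.cast_eq_zero, map_zero]
    rw [this, zero_mul]
  have h2 := (Matrix.isNilpotent_trace_of_isNilpotent h1).eq_zero
  rw [← h2]
  simp [Matrix.trace]

namespace IsPureCubefree

variable {K : Type*} [Field K] [NumberField K] {d A₁ A₂ : ℕ} {θ : 𝓞 K}

theorem mul_dvd_trace (h : IsPureCubefree K d A₁ A₂ θ) (x : 𝓞 K) {m : ℕ} (hm : 0 < m) :
    ((A₁ * A₂ : ℕ) : ℤ) ∣ Algebra.trace ℤ (𝓞 K) (x * θ ^ m) := by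
  have hsq : Squarefree (A₁ * A₂) :=
    (Nat.squarefree_mul h.coprime).mpr ⟨h.squarefree_left, h.squarefree_right⟩
  rw [Int.natCast_dvd, ← Nat.prod_primeFactors_of_squarefree hsq]
  refine Finset.prod_primes_dvd _ (fun p hp => (Nat.prime_of_mem_primeFactors hp).prime) ?_
  intro p hp
  rw [← Int.natCast_dvd]
  refine NumberField.dvd_trace_of_dvd_pow (Nat.prime_of_mem_primeFactors hp) (n := d) ?_
  have h1 : p ∣ A₁ * A₂ ^ 2 :=
    (Nat.dvd_of_mem_primeFactors hp).trans ⟨A₂, by ring⟩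
  rw [mul_pow, ← pow_mul, mul_comm m d, pow_mul, h.pow_eq]
  refine Dvd.dvd.mul_left (dvd_pow ?_ hm.ne') _
  exact_mod_cast Nat.cast_dvd_cast h1

theorem place_eq (h : IsPureCubefree K d A₁ A₂ θ) (w : InfinitePlace K) :
    w (θ : K) = ((A₁ * A₂ ^ 2 : ℕ) : ℝ) ^ ((1 : ℝ) / d) := by
  have h1 : w (θ : K) ^ d = ((A₁ * A₂ ^ 2 : ℕ) : ℝ) := by
    rw [← map_pow, h.coe_pow_eq, ← InfinitePlace.norm_embedding_eq, map_natCast, Complex.norm_natCast]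
  rw [← h1, one_div, Real.pow_rpow_inv_natCast (apply_nonneg w _) h.d_pos.ne']

theorem abs_trace_le (h : IsPureCubefree K d A₁ A₂ θ) {x : 𝓞 K} {R : ℝ}
    (hx : ∀ w : InfinitePlace K, w (x : K) ≤ R) (m : ℕ) :
    |(Algebra.trace ℤ (𝓞 K) (x * θ ^ m) : ℝ)| ≤
      d * (R * (((A₁ * A₂ ^ 2 : ℕ) : ℝ) ^ ((1 : ℝ) / d)) ^ m) := by
  have h1 : ((Algebra.trace ℤ (𝓞 K) (x * θ ^ m) : ℝ) : ℂ) =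
      ∑ σ : K →ₐ[ℚ] ℂ, σ ((x : K) * (θ : K) ^ m) := by
    rw [← trace_eq_sum_embeddings ℂ]
    have h2 : Algebra.trace ℚ K ((x : K) * (θ : K) ^ m) =
        (Algebra.trace ℤ (𝓞 K) (x * θ ^ m) : ℚ) := by
      rw [Algebra.coe_trace_int]
      simp
    rw [h2]
    simp
  rw [← Real.norm_eq_abs, ← Complex.norm_real, h1]
  have h3 : ∀ σ : K →ₐ[ℚ] ℂ, ‖σ ((x : K) * (θ : K) ^ m)‖ ≤
      R * (((A₁ * A₂ ^ 2 : ℕ) : ℝ) ^ ((1 : ℝ) / d)) ^ m := by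
    intro σ
    have h4 : ‖σ ((x : K) * (θ : K) ^ m)‖ =
        InfinitePlace.mk (σ : K →+* ℂ) ((x : K) * (θ : K) ^ m) := rfl
    rw [h4, map_mul, map_pow, h.place_eq]
    exact mul_le_mul_of_nonneg_right (hx _) (by positivity)
  refine (norm_sum_le _ _).trans ((Finset.sum_le_sum fun σ _ => h3 σ).trans ?_)
  rw [Finset.sum_const, Finset.card_univ, AlgHom.card, h.finrank_eq, nsmul_eq_mul]

end IsPureCubefree

end PureField

section DegreeOnePrimes

theorem Algebra.dvd_trace_of_natCast_dvd {K : Type*} [Field K] {p : ℕ} {x : 𝓞 K} (hx : (p : 𝓞 K) ∣ x) :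
    (p : ℤ) ∣ Algebra.trace ℤ (𝓞 K) x := by
  obtain ⟨y, rfl⟩ := hx
  refine ⟨Algebra.trace ℤ (𝓞 K) y, ?_⟩
  rw [← nsmul_eq_mul, map_nsmul, nsmul_eq_mul]

theorem Algebra.trace_mul_intCast {K : Type*} [Field K] (x : 𝓞 K) (n : ℤ) :
    Algebra.trace ℤ (𝓞 K) (x * n) = n * Algebra.trace ℤ (𝓞 K) x := by
  rw [mul_comm, ← zsmul_eq_mul, map_zsmul, smul_eq_mul]

/-- A prime `P` of degree one above `p`, with `p` prime to `d * (A₁ * A₂ ^ 2)`. -/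
structure IsDegreeOnePrime {K : Type*} [Field K] [NumberField K] (d A₁ A₂ : ℕ) (θ : 𝓞 K)
    (p : ℕ) (P : Ideal (𝓞 K)) : Prop where
  prime : p.Prime
  not_dvd : ¬ p ∣ d * (A₁ * A₂ ^ 2)
  isMaximal : P.IsMaximal
  absNorm_eq : Ideal.absNorm P = p
  natCast_mem : (p : 𝓞 K) ∈ P
  exists_root : ∃ r : ℤ, ¬ (p : ℤ) ∣ r ∧ θ - r ∈ P
  exists_sub_mem : ∀ x : 𝓞 K, ∃ n : ℤ, x - n ∈ P

variable {K : Type*} [Field K] [NumberField K] {d A₁ A₂ : ℕ} {θ : 𝓞 K}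

theorem ZMod.exists_pow_eq_of_coprime {p d : ℕ} (hp : p.Prime) (hd : (p - 1).Coprime d) {a : ℤ}
    (ha : ¬ (p : ℤ) ∣ a) : ∃ r : ℤ, ¬ (p : ℤ) ∣ r ∧ (p : ℤ) ∣ r ^ d - a := by
  have : Fact p.Prime := ⟨hp⟩
  have ha' : (a : ZMod p) ≠ 0 := by rwa [Ne, ZMod.intCast_zmod_eq_zero_iff_dvd]
  have hcop : (Nat.card (ZMod p)ˣ).Coprime d := by
    rwa [Nat.card_eq_fintype_card, ZMod.card_units]
  obtain ⟨u, hu⟩ := (powCoprime hcop).surjective (Units.mk0 _ ha')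
  have hu' : (u : ZMod p) ^ d = a := by
    have := congrArg Units.val hu
    simpa [powCoprime] using this
  obtain ⟨r, hr⟩ := ZMod.intCast_surjective (u : ZMod p)
  refine ⟨r, ?_, ?_⟩
  · rw [← ZMod.intCast_zmod_eq_zero_iff_dvd, hr]
    exact u.ne_zero
  · rw [← ZMod.intCast_zmod_eq_zero_iff_dvd]
    push_cast
    rw [hr, hu', sub_self]

namespace IsPureCubefree

theorem exists_isDegreeOnePrime (h : IsPureCubefree K d A₁ A₂ θ) {p : ℕ} (hp : p.Prime)
    (hpd : (p : ZMod d) = 2) (hpA : ¬ p ∣ A₁ * A₂) :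
    ∃ P : Ideal (𝓞 K), IsDegreeOnePrime d A₁ A₂ θ p P := by
  have hmod : p ≡ 2 [MOD d] := by
    rw [← ZMod.natCast_eq_natCast_iff]
    exact_mod_cast hpd
  have hndvd : ¬ p ∣ d * (A₁ * A₂ ^ 2) := by
    intro hdvd
    rcases (Nat.Prime.dvd_mul hp).mp hdvd with h1 | h1
    · have h2 : p ∣ 2 := by
        have h3 : p ≡ 2 [MOD p] := hmod.of_dvd h1
        exact (Nat.modEq_zero_iff_dvd.mp (h3.symm.trans (by simp [Nat.ModEq])))
      have h3 : p = 2 := (Nat.prime_dvd_prime_iff_eq hp Nat.prime_two).mp h2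
      subst h3
      have := h.odd
      rw [← Nat.not_even_iff_odd] at this
      exact this (even_iff_two_dvd.mpr h1)
    · rcases (Nat.Prime.dvd_mul hp).mp h1 with h2 | h2
      · exact hpA (h2.mul_right _)
      · exact hpA ((hp.dvd_of_dvd_pow h2).mul_left _)
  have hcop : (p - 1).Coprime d := by
    have h1 : p - 1 ≡ 1 [MOD d] := by
      have h2 : p - 1 + 1 ≡ 1 + 1 [MOD d] := by rwa [Nat.sub_add_cancel hp.one_le]
      exact Nat.ModEq.add_right_cancel' 1 h2
    have h2 := h1.gcd_eq
    rw [Nat.Coprime, h2, Nat.gcd_one_left]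
  have hna : ¬ (p : ℤ) ∣ ((A₁ * A₂ ^ 2 : ℕ) : ℤ) := by
    rw [Int.natCast_dvd_natCast]
    exact fun hh => hndvd (hh.mul_left _)
  obtain ⟨r, hr, hra⟩ := ZMod.exists_pow_eq_of_coprime hp hcop hna
  have hpprime : Prime (p : ℤ) := Nat.prime_iff_prime_int.mp hp
  have hne : Ideal.span {(p : 𝓞 K), θ - r} ≠ ⊤ := by
    intro htop
    rw [Ideal.eq_top_iff_one, Ideal.mem_span_pair] at htop
    obtain ⟨u, v, huv⟩ := htop
    set g : 𝓞 K := ∑ i ∈ Finset.range d, θ ^ i * (r : 𝓞 K) ^ (d - 1 - i) with hg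
    have hgeom : g * (θ - r) = θ ^ d - (r : 𝓞 K) ^ d := (Commute.all _ _).geom_sum₂_mul d
    have h1 : (p : 𝓞 K) ∣ g * (θ - r) := by
      rw [hgeom, h.pow_eq, ← dvd_neg, neg_sub]
      have := map_dvd (Int.castRingHom (𝓞 K)) hra
      simpa using this
    have h2 : (p : 𝓞 K) ∣ g := by
      have : g = (p : 𝓞 K) * (g * u) + g * (θ - r) * v := by
        calc g = g * 1 := (mul_one g).symm
          _ = _ := by rw [← huv]; ring
      rw [this]
      exact dvd_add (Dvd.intro _ rfl) (h1.mul_right _)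
    have h3 := Algebra.dvd_trace_of_natCast_dvd h2
    have h4 : Algebra.trace ℤ (𝓞 K) g = d * r ^ (d - 1) := by
      have h5 : ∀ i ∈ Finset.range d, Algebra.trace ℤ (𝓞 K) (θ ^ i * (r : 𝓞 K) ^ (d - 1 - i)) =
          if i = 0 then (d : ℤ) * r ^ (d - 1) else 0 := by
        intro i hi
        rw [← Int.cast_pow, Algebra.trace_mul_intCast]
        split_ifs with h0
        · subst h0
          have : Algebra.trace ℤ (𝓞 K) (1 : 𝓞 K) = d := by
            have h6 := Algebra.trace_algebraMap (R := ℤ) (S := 𝓞 K) 1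
            rw [map_one, RingOfIntegers.rank, h.finrank_eq] at h6
            simpa using h6
          rw [pow_zero, this, Nat.sub_zero, mul_comm]
        · have : ((Algebra.trace ℤ (𝓞 K) (θ ^ i) : ℤ) : ℚ) = 0 := by
            rw [Algebra.coe_trace_int]
            have h7 := h.trace_pow_eq_zero (n := i) (fun hd => h0
              (Nat.eq_zero_of_dvd_of_lt hd (Finset.mem_range.mp hi)))
            simpa using h7
          rw [Int.cast_eq_zero.mp this, mul_zero]
      rw [hg, map_sum, Finset.sum_congr rfl h5, Finset.sum_ite_eq']
      simp [h.d_pos]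
    rw [h4] at h3
    rcases hpprime.dvd_or_dvd h3 with h5 | h5
    · exact hndvd ((Int.natCast_dvd_natCast.mp h5).mul_right _)
    · exact hr (hpprime.dvd_of_dvd_pow h5)
  obtain ⟨P, hP, hle⟩ := Ideal.exists_le_maximal _ hne
  have hpP : (p : 𝓞 K) ∈ P := hle (Ideal.subset_span (by simp))
  have hθP : θ - r ∈ P := hle (Ideal.subset_span (by simp))
  have hsub : ∀ x : 𝓞 K, ∃ n : ℤ, x - n ∈ P := by
    intro x
    obtain ⟨s, e, hse⟩ : IsCoprime (p : ℤ) ((d * (A₁ * A₂ ^ 2) : ℕ) : ℤ) :=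
      Nat.Coprime.isCoprime ((Nat.Prime.coprime_iff_not_dvd hp).mpr hndvd)
    have h1 := h.smul_eq_sum x
    have hq : ((Ideal.Quotient.mk P) θ) = ((r : ℤ) : 𝓞 K ⧸ P) := by
      rw [← map_intCast (Ideal.Quotient.mk P), Ideal.Quotient.mk_eq_mk_iff_sub_mem]
      exact hθP
    refine ⟨e * ∑ k : Fin d, (Algebra.trace ℤ (𝓞 K) (x * θ ^ (d - k : ℕ))) * r ^ (k : ℕ), ?_⟩
    rw [← Ideal.Quotient.mk_eq_mk_iff_sub_mem]
    have h2 := congrArg (Ideal.Quotient.mk P) h1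
    have h3 : ((p : ℕ) : 𝓞 K ⧸ P) = 0 := by
      rw [← map_natCast (Ideal.Quotient.mk P)]
      exact Ideal.Quotient.eq_zero_iff_mem.mpr hpP
    have h4 : (e : 𝓞 K ⧸ P) * (((d * (A₁ * A₂ ^ 2) : ℕ)) : 𝓞 K ⧸ P) = 1 := by
      have := congrArg (Int.cast : ℤ → 𝓞 K ⧸ P) hse
      simp only [Int.cast_add, Int.cast_mul, Int.cast_natCast, h3, mul_zero, zero_add,
        Int.cast_one] at this
      exact this
    simp only [map_mul, map_sum, map_natCast, map_intCast, map_pow, hq] at h2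
    simp only [map_mul, map_sum, map_intCast, map_pow, Int.cast_mul, Int.cast_sum, Int.cast_pow]
    rw [← h2, ← mul_assoc, h4, one_mul]
  refine ⟨P, hp, hndvd, hP, ?_, hpP, ⟨r, hr, hθP⟩, hsub⟩
  have hsurj : Function.Surjective ((Ideal.Quotient.mk P).comp (Int.castRingHom (𝓞 K))) := by
    intro y
    obtain ⟨x, rfl⟩ := Ideal.Quotient.mk_surjective y
    obtain ⟨n, hn⟩ := hsub x
    exact ⟨n, (Ideal.Quotient.mk_eq_mk_iff_sub_mem _ _).mpr hn |>.symm⟩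
  have hker : RingHom.ker ((Ideal.Quotient.mk P).comp (Int.castRingHom (𝓞 K))) =
      Ideal.span {(p : ℤ)} := by
    have hmax : (Ideal.span {(p : ℤ)}).IsMaximal :=
      PrincipalIdealRing.isMaximal_of_irreducible hpprime.irreducible
    refine (hmax.eq_of_le ?_ ?_).symm
    · exact RingHom.ker_ne_top _
    · rw [Ideal.span_singleton_le_iff_mem, RingHom.mem_ker]
      simpa using Ideal.Quotient.eq_zero_iff_mem.mpr hpP
  have e := RingHom.quotientKerEquivOfSurjective hsurj
  rw [Ideal.absNorm_apply, Submodule.cardQuot_apply]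
  have := Nat.card_congr e.toEquiv
  rw [hker, Int.card_ideal_quot] at this
  exact this.symm

end IsPureCubefree

namespace IsDegreeOnePrime

variable {p q : ℕ} {P Q : Ideal (𝓞 K)}

theorem ne_bot (hP : IsDegreeOnePrime d A₁ A₂ θ p P) : P ≠ ⊥ := by
  rintro rfl
  have := hP.absNorm_eq
  rw [Ideal.absNorm_bot] at this
  exact hP.prime.ne_zero this.symm

theorem not_dvd_of_mul_eq_span (hP : IsDegreeOnePrime d A₁ A₂ θ p P)
    (h : IsPureCubefree K d A₁ A₂ θ) {J : Ideal (𝓞 K)} (hJ : Ideal.span {(p : 𝓞 K)} = P * J) :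
    ¬ P ∣ J := by
  rintro ⟨L, rfl⟩
  have hp0 : (p : 𝓞 K) ≠ 0 := Nat.cast_ne_zero.mpr hP.prime.ne_zero
  have hle : ¬ P * L ≤ Ideal.span {(p : 𝓞 K)} := by
    rw [← Ideal.dvd_iff_le, hJ]
    intro hdvd
    have h0 : P * L ≠ 0 := by
      intro h0
      rw [h0, mul_zero] at hJ
      exact hp0 (Ideal.span_singleton_eq_bot.mp hJ)
    have h1 : P ∣ 1 := by
      have : P * (P * L) ∣ 1 * (P * L) := by rwa [one_mul]
      exact (mul_dvd_mul_iff_right h0).mp this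
    exact hP.isMaximal.ne_top (Ideal.isUnit_iff.mp (isUnit_of_dvd_one h1))
  obtain ⟨x, hx, hxp⟩ := SetLike.not_le_iff_exists.mp hle
  rw [Ideal.mem_span_singleton] at hxp
  refine hxp (h.natCast_dvd_of_forall_dvd_trace hP.prime hP.not_dvd fun y => ?_)
  refine NumberField.dvd_trace_of_dvd_pow hP.prime (n := 2) ?_
  rw [mul_pow]
  refine Dvd.dvd.mul_right ?_ _
  rw [← Ideal.mem_span_singleton, hJ, sq]
  have h1 : x * x ∈ (P * L) * (P * L) := Ideal.mul_mem_mul hx hx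
  have h2 : (P * L) * (P * L) = P * (P * L) * L := by ring
  have h3 : P * (P * L) * L ≤ P * (P * L) := Ideal.mul_le_left
  exact h3 (h2 ▸ h1)

theorem not_dvd_trace_mul_pow (hP : IsDegreeOnePrime d A₁ A₂ θ p P)
    (h : IsPureCubefree K d A₁ A₂ θ) {x : 𝓞 K} (hx : ¬ (p : 𝓞 K) ∣ x)
    (hxP : ∀ z ∈ P, (p : 𝓞 K) ∣ x * z) (m : ℕ) :
    ¬ (p : ℤ) ∣ Algebra.trace ℤ (𝓞 K) (x * θ ^ m) := by
  have key : ∀ (y : 𝓞 K) (n : ℤ), y - n ∈ P →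
      (p : ℤ) ∣ Algebra.trace ℤ (𝓞 K) (x * y) - n * Algebra.trace ℤ (𝓞 K) x := by
    intro y n hyn
    have := Algebra.dvd_trace_of_natCast_dvd (hxP _ hyn)
    rwa [mul_sub, map_sub, Algebra.trace_mul_intCast] at this
  obtain ⟨r, hr, hθr⟩ := hP.exists_root
  have hpprime : Prime (p : ℤ) := Nat.prime_iff_prime_int.mp hP.prime
  intro hdvd
  have h1 : θ ^ m - ((r ^ m : ℤ) : 𝓞 K) ∈ P := by
    push_cast
    exact P.mem_of_dvd (sub_dvd_pow_sub_pow θ (r : 𝓞 K) m) hθr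
  have h2 := (dvd_sub_right hdvd).mp (key _ _ h1)
  have h3 : (p : ℤ) ∣ Algebra.trace ℤ (𝓞 K) x := by
    rcases hpprime.dvd_or_dvd h2 with h4 | h4
    · exact absurd (hpprime.dvd_of_dvd_pow h4) hr
    · exact h4
  refine hx (h.natCast_dvd_of_forall_dvd_trace hP.prime hP.not_dvd fun y => ?_)
  obtain ⟨n, hn⟩ := hP.exists_sub_mem y
  exact (dvd_sub_left (h3.mul_left n)).mp (key y n hn)

/-- Powers of distinct degree one primes that differ by an element of small height force the
coefficients of the field to be small. -/
theorem mul_le_of_forall_place_le (h : IsPureCubefree K d A₁ A₂ θ) {ℓ : ℕ} (hℓ : 0 < ℓ)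
    (hP : IsDegreeOnePrime d A₁ A₂ θ p P) (hQ : IsDegreeOnePrime d A₁ A₂ θ q Q) (hPQ : P ≠ Q)
    {Y : ℝ} (hpY : (p : ℝ) ≤ Y) (hqY : (q : ℝ) ≤ Y) {x y : 𝓞 K} (hy : y ≠ 0)
    (hxy : Ideal.span {x} * Q ^ ℓ = Ideal.span {y} * P ^ ℓ)
    (hw : ∀ w : InfinitePlace K, w (x : K) * (q : ℝ) ^ ((ℓ : ℝ) / d) ≤
      Real.exp ℓ * (w (y : K) * (p : ℝ) ^ ((ℓ : ℝ) / d))) :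
    (A₁ * A₂ : ℝ) ≤ d * (Real.exp ℓ * Y ^ ℓ *
      (((A₁ * A₂ ^ 2 : ℕ) : ℝ) ^ ((1 : ℝ) / d)) ^ ((d - 1) / 2)) := by
  have hd := h.three_le
  obtain ⟨J, hJ⟩ : Q ∣ Ideal.span {(q : 𝓞 K)} :=
    Ideal.dvd_iff_le.mpr ((Ideal.span_singleton_le_iff_mem _).mpr hQ.natCast_mem)
  have hQJ := hQ.not_dvd_of_mul_eq_span h hJ
  have hQprime : Prime Q := Ideal.prime_of_isPrime hQ.ne_bot hQ.isMaximal.isPrime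
  have h1 : Ideal.span {x * (q : 𝓞 K) ^ ℓ} = Ideal.span {y} * (P ^ ℓ * J ^ ℓ) := by
    rw [← Ideal.span_singleton_mul_span_singleton, ← Ideal.span_singleton_pow, hJ, mul_pow,
      ← mul_assoc, hxy, mul_assoc]
  obtain ⟨g, hg⟩ : y ∣ x * (q : 𝓞 K) ^ ℓ := by
    rw [← Ideal.span_singleton_le_span_singleton, h1]
    exact (Ideal.mul_le_left : Ideal.span {y} * (P ^ ℓ * J ^ ℓ) ≤ Ideal.span {y})
  have hg1 : Ideal.span {g} = P ^ ℓ * J ^ ℓ := by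
    rw [hg, ← Ideal.span_singleton_mul_span_singleton] at h1
    exact mul_left_cancel₀ (by simpa using hy) h1
  have hgq : ¬ (q : 𝓞 K) ∣ g := by
    intro hdvd
    have h2 : Q ∣ P ^ ℓ * J ^ ℓ := by
      rw [← hg1]
      have h3 : Ideal.span {(q : 𝓞 K)} ∣ Ideal.span {g} :=
        Ideal.dvd_iff_le.mpr (Ideal.span_singleton_le_span_singleton.mpr hdvd)
      exact (Dvd.intro J hJ.symm).trans h3
    rcases hQprime.dvd_or_dvd h2 with h3 | h3
    · have h4 := Ideal.dvd_iff_le.mp (hQprime.dvd_of_dvd_pow h3)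
      exact hPQ (hP.isMaximal.eq_of_le hQ.isMaximal.ne_top h4)
    · exact hQJ (hQprime.dvd_of_dvd_pow h3)
  have hgQ : ∀ z ∈ Q, (q : 𝓞 K) ∣ g * z := by
    intro z hz
    rw [← Ideal.mem_span_singleton]
    have h2 : g * z ∈ Ideal.span {g} * Q :=
      Ideal.mul_mem_mul (Ideal.mem_span_singleton_self g) hz
    have h3 : Ideal.span {g} * Q = Q * J * (P ^ ℓ * J ^ (ℓ - 1)) := by
      rw [hg1]
      conv_lhs => rw [← Nat.sub_add_cancel hℓ, pow_succ J]
      rw [Nat.sub_add_cancel hℓ]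
      ring
    have h4 : Q * J * (P ^ ℓ * J ^ (ℓ - 1)) ≤ Q * J := Ideal.mul_le_left
    rw [h3] at h2
    exact hJ ▸ h4 h2
  have hT0 := hQ.not_dvd_trace_mul_pow h hgq hgQ ((d - 1) / 2)
  have hTdvd := h.mul_dvd_trace g (m := (d - 1) / 2) (by omega)
  have hp0 : 0 < (p : ℝ) := Nat.cast_pos.mpr hP.prime.pos
  have hq0 : 0 < (q : ℝ) := Nat.cast_pos.mpr hQ.prime.pos
  have hY0 : 0 < Y := hp0.trans_le hpY
  have hgw : ∀ w : InfinitePlace K, w (g : K) ≤ Real.exp ℓ * Y ^ ℓ := by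
    intro w
    have hyw : 0 < w (y : K) := InfinitePlace.pos_iff.mpr (by simpa using hy)
    have h2 : w (x : K) * (q : ℝ) ^ ℓ = w (y : K) * w (g : K) := by
      have := congrArg (fun z : 𝓞 K => w (z : K)) hg
      simp only [map_mul, map_pow, map_natCast] at this
      rwa [← InfinitePlace.norm_embedding_eq w (q : K), map_natCast, Complex.norm_natCast] at this
    set e : ℝ := (ℓ : ℝ) / d with he
    have he0 : 0 ≤ e := by positivity
    have heℓ : e ≤ ℓ := div_le_self (Nat.cast_nonneg _) (by exact_mod_cast h.d_pos)
    have h3 : (q : ℝ) ^ ℓ = (q : ℝ) ^ e * (q : ℝ) ^ (ℓ - e : ℝ) := by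
      rw [← Real.rpow_add hq0, add_sub_cancel, Real.rpow_natCast]
    have h4 : Y ^ ℓ = Y ^ e * Y ^ (ℓ - e : ℝ) := by
      rw [← Real.rpow_add hY0, add_sub_cancel, Real.rpow_natCast]
    have h5 : (p : ℝ) ^ e * (q : ℝ) ^ (ℓ - e : ℝ) ≤ Y ^ ℓ := by
      rw [h4]
      exact mul_le_mul (Real.rpow_le_rpow hp0.le hpY he0)
        (Real.rpow_le_rpow hq0.le hqY (by linarith)) (by positivity) (by positivity)
    have h6 : w (y : K) * w (g : K) ≤ w (y : K) * (Real.exp ℓ * Y ^ ℓ) := by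
      calc w (y : K) * w (g : K) = (w (x : K) * (q : ℝ) ^ e) * (q : ℝ) ^ (ℓ - e : ℝ) := by
            rw [← h2, h3]; ring
        _ ≤ (Real.exp ℓ * (w (y : K) * (p : ℝ) ^ e)) * (q : ℝ) ^ (ℓ - e : ℝ) :=
            mul_le_mul_of_nonneg_right (hw w) (by positivity)
        _ = w (y : K) * (Real.exp ℓ * ((p : ℝ) ^ e * (q : ℝ) ^ (ℓ - e : ℝ))) := by ring
        _ ≤ _ := by gcongr
    exact le_of_mul_le_mul_left h6 hyw
  have hle := h.abs_trace_le hgw ((d - 1) / 2)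
  refine le_trans ?_ hle
  have hne : Algebra.trace ℤ (𝓞 K) (g * θ ^ ((d - 1) / 2)) ≠ 0 := fun h0 => hT0 (h0 ▸ dvd_zero _)
  have h7 := Int.le_of_dvd (abs_pos.mpr hne) ((dvd_abs _ _).mpr hTdvd)
  have h8 : (((A₁ * A₂ : ℕ) : ℤ) : ℝ) ≤ ((|Algebra.trace ℤ (𝓞 K) (g * θ ^ ((d - 1) / 2))| : ℤ) : ℝ) :=
    Int.cast_le.mpr h7
  push_cast at h8
  exact h8

end IsDegreeOnePrime

end DegreeOnePrimes

section Discriminant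

namespace IsPureCubefree

variable {K : Type*} [Field K] [NumberField K] {d A₁ A₂ : ℕ} {θ : 𝓞 K}

theorem int_trace_pow_eq_zero (h : IsPureCubefree K d A₁ A₂ θ) {n : ℕ} (hn : ¬ d ∣ n) :
    Algebra.trace ℤ (𝓞 K) (θ ^ n) = 0 := by
  have : ((Algebra.trace ℤ (𝓞 K) (θ ^ n) : ℤ) : ℚ) = 0 := by
    rw [Algebra.coe_trace_int]
    simpa using h.trace_pow_eq_zero hn
  exact Int.cast_eq_zero.mp this

theorem int_trace_pow (h : IsPureCubefree K d A₁ A₂ θ) (n : ℕ) :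
    Algebra.trace ℤ (𝓞 K) (θ ^ (d * n)) = d * ((A₁ * A₂ ^ 2 : ℕ) : ℤ) ^ n := by
  have : ((Algebra.trace ℤ (𝓞 K) (θ ^ (d * n)) : ℤ) : ℚ) = d * ((A₁ * A₂ ^ 2 : ℕ) : ℚ) ^ n := by
    rw [Algebra.coe_trace_int]
    simpa using h.trace_pow n
  exact_mod_cast this

theorem exists_reduced_pow (h : IsPureCubefree K d A₁ A₂ θ) (k : ℕ) :
    ∃ η : 𝓞 K, (A₂ : 𝓞 K) ^ (2 * k / d) * η = θ ^ k ∧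
      η ^ d = ((A₁ ^ k * A₂ ^ (2 * k % d) : ℕ) : 𝓞 K) := by
  have hA₂ : (A₂ : K) ≠ 0 := Nat.cast_ne_zero.mpr h.right_pos.ne'
  set x : K := (θ : K) ^ k / (A₂ : K) ^ (2 * k / d) with hx
  have hxd : x ^ d = ((A₁ ^ k * A₂ ^ (2 * k % d) : ℕ) : K) := by
    rw [hx, div_pow, div_eq_iff (pow_ne_zero _ (pow_ne_zero _ hA₂)), ← pow_mul, mul_comm k d,
      pow_mul, h.coe_pow_eq, ← pow_mul]
    push_cast
    rw [mul_assoc, ← pow_add, mul_pow, ← pow_mul, mul_comm (2 * k / d) d, Nat.mod_add_div]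
  have h_int : IsIntegral ℤ x := by
    refine IsIntegral.of_pow h.d_pos ?_
    rw [hxd]
    simpa using isIntegral_algebraMap (R := ℤ) (A := K) (x := ((A₁ ^ k * A₂ ^ (2 * k % d) : ℕ) : ℤ))
  obtain ⟨η, hη⟩ : ∃ η : 𝓞 K, algebraMap (𝓞 K) K η = x :=
    ⟨_, IsIntegralClosure.algebraMap_mk' (𝓞 K) x h_int⟩
  refine ⟨η, FaithfulSMul.algebraMap_injective (𝓞 K) K ?_,
    FaithfulSMul.algebraMap_injective (𝓞 K) K ?_⟩
  · rw [map_mul, map_pow, map_pow, map_natCast, hη]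
    exact mul_div_cancel₀ _ (pow_ne_zero _ hA₂)
  · rw [map_pow, map_natCast, hη, hxd]

theorem two_mul_div_add (hodd : Odd d) {i : ℕ} (hi : 0 < i) (hid : i < d) :
    2 * i / d + 2 * (d - i) / d = 1 := by
  obtain ⟨c, hc⟩ := hodd
  rcases lt_or_ge (2 * i) d with h1 | h1
  · rw [Nat.div_eq_of_lt h1, Nat.div_eq_of_lt_le (k := 1)] <;> omega
  · rw [Nat.div_eq_of_lt_le (k := 1) (m := 2 * i), Nat.div_eq_of_lt] <;> omega

theorem discr_bounds (h : IsPureCubefree K d A₁ A₂ θ) :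
    (discr K).natAbs ≤ d ^ d * (A₁ * A₂) ^ (d - 1) ∧
      d ^ d * (A₁ * A₂) ^ (d - 1) ≤ d ^ (2 * d) * (discr K).natAbs := by
  classical
  have hd0 := h.d_pos
  have : NeZero d := ⟨hd0.ne'⟩
  set tr := Algebra.trace ℤ (𝓞 K) with htr
  choose η hη hηd using h.exists_reduced_pow
  have hA₂ : (A₂ : ℤ) ≠ 0 := Nat.cast_ne_zero.mpr h.right_pos.ne'
  have hA₂' : (A₂ : 𝓞 K) ≠ 0 := Nat.cast_ne_zero.mpr h.right_pos.ne'
  have hη0 : η 0 = 1 := by simpa using hη 0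
  have htr_natCast_mul : ∀ (n : ℕ) (x : 𝓞 K), tr ((n : 𝓞 K) * x) = n * tr x := by
    intro n x
    rw [← nsmul_eq_mul, map_nsmul, nsmul_eq_mul]
  have htrη : ∀ i j : ℕ, (A₂ : ℤ) ^ (2 * i / d + 2 * j / d) * tr (η i * η j) =
      tr (θ ^ (i + j)) := by
    intro i j
    rw [pow_add θ, ← hη, ← hη, ← Nat.cast_pow, ← htr_natCast_mul]
    congr 1
    push_cast
    ring
  -- The trace matrix of `η` is monomial.
  have hzero : ∀ i j : ℕ, ¬ d ∣ i + j → tr (η i * η j) = 0 := by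
    intro i j hij
    have := htrη i j
    rw [h.int_trace_pow_eq_zero hij] at this
    exact (mul_eq_zero.mp this).resolve_left (pow_ne_zero _ hA₂)
  have hdiag : ∀ i : ℕ, 0 < i → i < d → tr (η (d - i) * η i) = d * (A₁ * A₂ : ℕ) := by
    intro i hi hid
    have h1 := htrη (d - i) i
    have h2 := two_mul_div_add h.odd hi hid
    have h3 : d - i + i = d * 1 := by omega
    rw [add_comm, h2, pow_one, h3, h.int_trace_pow, pow_one] at h1
    apply mul_left_cancel₀ hA₂
    rw [h1]
    push_cast
    ring
  have hdiag0 : tr (η 0 * η 0) = d := by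
    rw [hη0, mul_one, ← pow_zero θ]
    simpa using h.int_trace_pow 0
  have hcop : ∀ i : ℕ, 0 < i → i < d → ∀ x : 𝓞 K, ((A₁ * A₂ : ℕ) : ℤ) ∣ tr (x * η i) := by
    intro i hi hid x
    have hsq : Squarefree (A₁ * A₂) :=
      (Nat.squarefree_mul h.coprime).mpr ⟨h.squarefree_left, h.squarefree_right⟩
    rw [Int.natCast_dvd, ← Nat.prod_primeFactors_of_squarefree hsq]
    refine Finset.prod_primes_dvd _ (fun p hp => (Nat.prime_of_mem_primeFactors hp).prime) ?_
    intro p hp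
    have hpp := Nat.prime_of_mem_primeFactors hp
    rw [← Int.natCast_dvd]
    refine NumberField.dvd_trace_of_dvd_pow hpp (n := d) ?_
    rw [mul_pow, hηd]
    refine Dvd.dvd.mul_left (Nat.cast_dvd_cast ?_) _
    have hmod : 2 * i % d ≠ 0 := by
      intro h0
      have h1 := Nat.dvd_of_mod_eq_zero h0
      have h2 : d ∣ i := (Nat.Coprime.dvd_of_dvd_mul_left
        (Nat.Coprime.symm (Nat.coprime_two_left.mpr h.odd)) h1)
      exact absurd (Nat.le_of_dvd hi h2) (by omega)
    rcases (Nat.Prime.dvd_mul hpp).mp (Nat.dvd_of_mem_primeFactors hp) with h1 | h1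
    · exact (dvd_pow h1 hi.ne').mul_right _
    · exact (dvd_pow h1 hmod).mul_left _
  -- Every `d * x` is an integral combination of the `η k`.
  have hspan : ∀ x : 𝓞 K, ∃ n : Fin d → ℤ, (d : 𝓞 K) * x = ∑ k : Fin d, (n k : 𝓞 K) * η k := by
    intro x
    have hn : ∀ k : Fin d, ∃ n : ℤ, (tr (x * θ ^ (d - k : ℕ)) : 𝓞 K) * θ ^ (k : ℕ) =
        ((A₁ * A₂ ^ 2 : ℕ) : 𝓞 K) * ((n : 𝓞 K) * η k) := by
      intro k
      rcases Nat.eq_zero_or_pos (k : ℕ) with h0 | h0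
      · refine ⟨tr x, ?_⟩
        rw [h0, Nat.sub_zero, h.pow_eq, mul_comm x, htr_natCast_mul, hη0]
        push_cast
        ring
      · obtain ⟨n, hn⟩ := hcop (d - k) (by have := k.2; omega) (by omega) x
        refine ⟨n, ?_⟩
        have h1 := two_mul_div_add h.odd h0 k.2
        rw [← hη, ← hη]
        have h2 : x * ((A₂ : 𝓞 K) ^ (2 * (d - k) / d) * η (d - k)) =
            ((A₂ ^ (2 * (d - k) / d) : ℕ) : 𝓞 K) * (x * η (d - k)) := by
          push_cast
          ring
        rw [h2, htr_natCast_mul, hn]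
        have h3 : (A₂ : 𝓞 K) ^ (2 * (d - k) / d) * (A₂ : 𝓞 K) ^ (2 * k / d) = A₂ := by
          rw [← pow_add, add_comm, h1, pow_one]
        push_cast
        calc _ = ((A₂ : 𝓞 K) ^ (2 * (d - k) / d) * (A₂ : 𝓞 K) ^ (2 * k / d)) *
            (A₁ * A₂ * n * η k) := by ring
          _ = _ := by rw [h3]; ring
    choose n hn using hn
    refine ⟨n, ?_⟩
    have ha : ((A₁ * A₂ ^ 2 : ℕ) : 𝓞 K) ≠ 0 :=
      Nat.cast_ne_zero.mpr (by have := h.one_lt; omega)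
    apply mul_left_cancel₀ ha
    rw [Finset.mul_sum, ← Finset.sum_congr rfl fun k _ => hn k, ← h.smul_eq_sum x]
    push_cast
    ring
  -- Change of basis.
  obtain ⟨ω⟩ : Nonempty (Module.Basis (Fin d) ℤ (𝓞 K)) :=
    ⟨Module.finBasisOfFinrankEq ℤ (𝓞 K) (by rw [RingOfIntegers.rank, h.finrank_eq])⟩
  set M : Matrix (Fin d) (Fin d) ℤ := Matrix.of fun i j => ω.repr (η i) j with hM
  have hMη : ∀ i : Fin d, η i = ∑ j, (M i j : 𝓞 K) * ω j := by
    intro i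
    conv_lhs => rw [← ω.sum_repr (η i)]
    simp [hM]
  choose N hN using fun j : Fin d => hspan (ω j)
  have hNM : Matrix.of N * M = (d : ℤ) • (1 : Matrix (Fin d) (Fin d) ℤ) := by
    ext i j
    have h1 := hN i
    simp only [hMη, Finset.mul_sum] at h1
    rw [Finset.sum_comm] at h1
    have h2 : (d : 𝓞 K) * ω i = ∑ j, ((Matrix.of N * M) i j) • ω j := by
      rw [h1]
      refine Finset.sum_congr rfl fun j _ => ?_
      rw [Matrix.mul_apply, Finset.sum_smul]
      refine Finset.sum_congr rfl fun k _ => ?_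
      rw [zsmul_eq_mul]
      push_cast
      simp [mul_assoc]
    have h3 := congrArg (fun z => ω.repr z j) h2
    simp only [ω.repr_sum_self] at h3
    rw [← h3, ← nsmul_eq_mul, map_nsmul]
    simp [Matrix.one_apply, Finsupp.single_apply]
  have hdet : (Matrix.of N).det * M.det = (d : ℤ) ^ d := by
    rw [← Matrix.det_mul, hNM, Matrix.det_smul, Matrix.det_one, mul_one, Fintype.card_fin]
  have hdiscr : Algebra.discr ℤ (fun i : Fin d => η i) = M.det ^ 2 * discr K := by
    rw [← NumberField.discr_eq_discr K ω, ← Algebra.discr_of_matrix_mulVec]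
    congr 1
    ext1 i
    rw [hMη]
    simp [Matrix.mulVec, dotProduct]
  have hval : (Algebra.discr ℤ (fun i : Fin d => η i)).natAbs = d ^ d * (A₁ * A₂) ^ (d - 1) := by
    set T := Algebra.traceMatrix ℤ (fun i : Fin d => η i) with hT
    have hTapp : ∀ i j : Fin d, T i j = tr (η i * η j) := fun i j => rfl
    set c : Fin d → ℤ := fun i => if i = 0 then (d : ℤ) else d * (A₁ * A₂ : ℕ) with hc
    have hsub : T.submatrix (Equiv.neg (Fin d)) id = Matrix.diagonal c := by
      ext i j
      rw [Matrix.submatrix_apply, id, Equiv.neg_apply, hTapp, Matrix.diagonal_apply, Fin.val_neg]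
      have hi := i.2
      have hj := j.2
      by_cases hij : i = j
      · subst hij
        rw [if_pos rfl]
        by_cases h0 : i = 0
        · subst h0
          simpa [hc] using hdiag0
        · have h0' : 0 < (i : ℕ) := Nat.pos_of_ne_zero fun hh => h0 (Fin.ext hh)
          simp only [hc, if_neg h0]
          exact hdiag i h0' hi
      · rw [if_neg hij]
        apply hzero
        have hij' : (i : ℕ) ≠ j := fun hh => hij (Fin.ext hh)
        split_ifs with h0
        · subst h0
          intro hdvd
          have := Nat.eq_zero_of_dvd_of_lt hdvd (by simp)
          simp at hij'
          omega
        · have h0' : 0 < (i : ℕ) := Nat.pos_of_ne_zero fun hh => h0 (Fin.ext hh)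
          rintro ⟨m, hm⟩
          rcases lt_trichotomy m 1 with h1 | h1 | h1
          · have : m = 0 := by omega
            subst this
            omega
          · subst h1
            omega
          · have : d * 2 ≤ d * m := Nat.mul_le_mul_left d h1
            omega
    have h1 := Matrix.det_permute (Equiv.neg (Fin d)) T
    rw [hsub, Matrix.det_diagonal] at h1
    have h2 : (∏ i, c i).natAbs = T.det.natAbs := by
      rw [h1, Int.natAbs_mul]
      rcases Int.units_eq_one_or (Equiv.Perm.sign (Equiv.neg (Fin d))) with hs | hs <;> simp [hs]
    rw [Algebra.discr_def, ← h2]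
    have h3 : ∏ i, c i = (d : ℤ) * (d * (A₁ * A₂ : ℕ)) ^ (d - 1) := by
      rw [← Finset.mul_prod_erase _ _ (Finset.mem_univ (0 : Fin d))]
      have h4 : ∀ i ∈ Finset.univ.erase (0 : Fin d), c i = (d : ℤ) * (A₁ * A₂ : ℕ) := by
        intro i hi
        simp only [hc, if_neg (Finset.ne_of_mem_erase hi)]
      rw [Finset.prod_congr rfl h4, Finset.prod_const, Finset.card_erase_of_mem (Finset.mem_univ _),
        Finset.card_univ, Fintype.card_fin]
      simp [hc]
    rw [h3]
    have h5 : (d : ℤ) * (d * (A₁ * A₂ : ℕ)) ^ (d - 1) =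
        ((d ^ d * (A₁ * A₂) ^ (d - 1) : ℕ) : ℤ) := by
      push_cast
      rw [mul_pow, ← mul_assoc, ← pow_succ', Nat.sub_add_cancel hd0]
    rw [h5, Int.natAbs_natCast]
  have hMdvd : M.det.natAbs ∣ d ^ d := by
    rw [← Int.natCast_dvd_natCast, Int.natAbs_dvd]
    push_cast
    exact Dvd.intro_left _ hdet
  have hM1 : 1 ≤ M.det.natAbs := Nat.pos_of_dvd_of_pos hMdvd (pow_pos hd0 d)
  have hM2 : M.det.natAbs ≤ d ^ d := Nat.le_of_dvd (pow_pos hd0 d) hMdvd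
  rw [← hval, hdiscr, Int.natAbs_mul, Int.natAbs_pow]
  refine ⟨Nat.le_mul_of_pos_left _ (pow_pos hM1 2), Nat.mul_le_mul_right _ ?_⟩
  rw [mul_comm 2 d, pow_mul]
  exact Nat.pow_le_pow_left hM2 2

end IsPureCubefree

end Discriminant

section Assembly

theorem Real.exists_log_add_two_pow_le_rpow (k : ℕ) {δ : ℝ} (hδ : 0 < δ) :
    ∃ C : ℝ, 0 < C ∧ ∀ x : ℝ, 1 ≤ x → (Real.log x + 2) ^ k ≤ C * x ^ δ := by
  set η : ℝ := δ / (k + 1) with hη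
  have hη0 : 0 < η := by positivity
  refine ⟨(1 / η + 2) ^ k, by positivity, fun x hx => ?_⟩
  have hx0 : 0 ≤ x := by linarith
  have h1 : Real.log x + 2 ≤ (1 / η + 2) * x ^ η := by
    have h2 := Real.log_le_rpow_div hx0 hη0
    have h3 := Real.one_le_rpow hx hη0.le
    rw [add_mul, one_div_mul_eq_div]
    linarith
  have h0 : 0 ≤ Real.log x + 2 := by linarith [Real.log_nonneg hx]
  calc (Real.log x + 2) ^ k ≤ ((1 / η + 2) * x ^ η) ^ k := by gcongr
    _ = (1 / η + 2) ^ k * x ^ (η * k) := by rw [mul_pow, ← Real.rpow_mul_natCast hx0]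
    _ ≤ (1 / η + 2) ^ k * x ^ δ := by
      gcongr
      rw [hη, div_mul_eq_mul_div, div_le_iff₀ (by positivity)]
      nlinarith

theorem Nat.card_primeFactors_mul_log_two_le {m : ℕ} (hm : m ≠ 0) :
    m.primeFactors.card * Real.log 2 ≤ Real.log m := by
  rw [← Real.log_pow]
  apply Real.log_le_log (by positivity)
  have h1 : 2 ^ m.primeFactors.card ≤ m := calc
    2 ^ m.primeFactors.card ≤ ∏ p ∈ m.primeFactors, p :=
      Finset.pow_card_le_prod _ _ _ fun p hp => (Nat.prime_of_mem_primeFactors hp).two_le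
    _ ≤ m := Nat.le_of_dvd (Nat.pos_of_ne_zero hm) (Nat.prod_primeFactors_dvd m)
  exact_mod_cast h1

/-- There are almost as many primes `p ≤ z` with `p ≡ a mod q` and `p ∤ m` as there are
integers `≤ z`, up to a factor `m ^ δ`. -/
theorem exists_le_mul_card_primes_not_dvd {q : ℕ} [NeZero q] {a : ZMod q} (ha : IsUnit a)
    {δ : ℝ} (hδ : 0 < δ) :
    ∃ C : ℝ, 0 < C ∧ ∀ (m : ℕ) (z : ℝ), 1 ≤ m → z ≤ m →
      z ≤ C * (m : ℝ) ^ δ * max 1 (((Finset.Ioc 0 ⌊z⌋₊).filter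
        fun p : ℕ => p.Prime ∧ (p : ZMod q) = a ∧ ¬ p ∣ m).card : ℝ) := by
  obtain ⟨c, hc, N₀, hN₀⟩ := exists_card_primes_eq_ge ha
  obtain ⟨C, hC, hlog⟩ := Real.exists_log_add_two_pow_le_rpow 2 hδ
  refine ⟨4 * C / c + (N₀ + 3), by positivity, fun m z hm hzm => ?_⟩
  have hm1 : (1 : ℝ) ≤ m := by exact_mod_cast hm
  have hmδ := Real.one_le_rpow hm1 hδ.le
  set N := ⌊z⌋₊
  set T := (Finset.Ioc 0 N).filter fun p : ℕ => p.Prime ∧ (p : ZMod q) = a ∧ ¬ p ∣ m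
  set t : ℝ := max 1 (T.card : ℝ)
  have ht1 : 1 ≤ t := le_max_left _ _
  have htT : (T.card : ℝ) ≤ t := le_max_right _ _
  have hmt : 1 ≤ (m : ℝ) ^ δ * t := one_le_mul_of_one_le_of_one_le hmδ ht1
  have hzN : z < N + 1 := Nat.lt_floor_add_one z
  rcases lt_or_ge N (max N₀ 2) with hN | hN
  · have h1 : (N : ℝ) ≤ N₀ + 2 := by
      have : N ≤ N₀ + 2 := by omega
      exact_mod_cast this
    have h2 : 0 ≤ 4 * C / c := by positivity
    calc z ≤ (4 * C / c + (N₀ + 3)) * 1 := by linarith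
      _ ≤ (4 * C / c + (N₀ + 3)) * ((m : ℝ) ^ δ * t) := by gcongr
      _ = _ := by ring
  · have hN2 : 2 ≤ N := le_trans (le_max_right _ _) hN
    have hN2' : (2 : ℝ) ≤ N := by exact_mod_cast hN2
    have hz0 : 0 ≤ z := by
      by_contra hz
      have : N = 0 := Nat.floor_of_nonpos (not_le.mp hz).le
      omega
    have hNm : (N : ℝ) ≤ m := (Nat.floor_le hz0).trans hzm
    have hcard : ((Finset.Ioc 0 N).filter fun p : ℕ => p.Prime ∧ (p : ZMod q) = a).card ≤
        T.card + m.primeFactors.card := by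
      refine (Finset.card_le_card fun p hp => ?_).trans (Finset.card_union_le _ _)
      simp only [Finset.mem_filter, Finset.mem_union, T, Nat.mem_primeFactors] at hp ⊢
      by_cases hpm : p ∣ m
      · exact Or.inr ⟨hp.2.1, hpm, by omega⟩
      · exact Or.inl ⟨hp.1, hp.2.1, hp.2.2, hpm⟩
    have hcard' : (((Finset.Ioc 0 N).filter fun p : ℕ => p.Prime ∧ (p : ZMod q) = a).card : ℝ) ≤
        T.card + m.primeFactors.card := by exact_mod_cast hcard
    have hω := Nat.card_primeFactors_mul_log_two_le (m := m) (by omega)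
    have hω' : (m.primeFactors.card : ℝ) ≤ 2 * Real.log m := by
      have := Real.log_two_gt_d9
      have h0 : (0 : ℝ) ≤ m.primeFactors.card := by positivity
      nlinarith
    have hlogm : 0 ≤ Real.log m := Real.log_nonneg hm1
    have hlogN : Real.log N ≤ Real.log m := Real.log_le_log (by linarith) hNm
    have key : c * N ≤ 2 * C * ((m : ℝ) ^ δ * t) := calc
      c * N ≤ _ * Real.log N := hN₀ N (le_trans (le_max_left _ _) hN)
      _ ≤ (T.card + m.primeFactors.card) * Real.log m := by
        gcongr
      _ ≤ (t + 2 * Real.log m * t) * Real.log m := by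
        gcongr
        nlinarith
      _ ≤ 2 * t * (Real.log m + 2) ^ 2 := by nlinarith
      _ ≤ 2 * t * (C * (m : ℝ) ^ δ) := by
        gcongr
        exact hlog m hm1
      _ = _ := by ring
    have h4 : z ≤ 2 * N := by linarith
    have h5 : (N : ℝ) ≤ 2 * C / c * ((m : ℝ) ^ δ * t) := by
      rw [div_mul_eq_mul_div, le_div_iff₀ hc]
      linarith
    have h6 : 0 ≤ ((N₀ : ℝ) + 3) * ((m : ℝ) ^ δ * t) := by positivity
    calc z ≤ 2 * (2 * C / c * ((m : ℝ) ^ δ * t)) + (N₀ + 3) * ((m : ℝ) ^ δ * t) := by linarith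
      _ = _ := by ring

variable {K : Type*} [Field K] [NumberField K] {d A₁ A₂ : ℕ} {θ : 𝓞 K}

theorem IsPureCubefree.exists_separated_finset (h : IsPureCubefree K d A₁ A₂ θ) {ℓ : ℕ}
    (hℓ : 0 < ℓ) {N : ℕ}
    (hN : d * (Real.exp ℓ * (N : ℝ) ^ ℓ *
      (((A₁ * A₂ ^ 2 : ℕ) : ℝ) ^ ((1 : ℝ) / d)) ^ ((d - 1) / 2)) < (A₁ * A₂ : ℝ)) :
    ∃ S : Finset (Ideal (𝓞 K)), (∀ P ∈ S, P ≠ ⊥) ∧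
      (∀ P ∈ S, ∀ Q ∈ S, P ≠ Q → ∀ x y : 𝓞 K, x ≠ 0 → y ≠ 0 →
        Ideal.span {x} * Q ^ ℓ = Ideal.span {y} * P ^ ℓ → ∃ w : InfinitePlace K,
          Real.exp ℓ * (w (y : K) * (Ideal.absNorm P : ℝ) ^ ((ℓ : ℝ) / Module.finrank ℚ K)) <
            w (x : K) * (Ideal.absNorm Q : ℝ) ^ ((ℓ : ℝ) / Module.finrank ℚ K)) ∧
      S.card = ((Finset.Ioc 0 N).filter
        fun p : ℕ => p.Prime ∧ (p : ZMod d) = 2 ∧ ¬ p ∣ A₁ * A₂).card := by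
  classical
  set T := (Finset.Ioc 0 N).filter fun p : ℕ => p.Prime ∧ (p : ZMod d) = 2 ∧ ¬ p ∣ A₁ * A₂
    with hT
  have hex : ∀ p : T, ∃ P, IsDegreeOnePrime d A₁ A₂ θ (p : ℕ) P := fun p => by
    have hp := (Finset.mem_filter.mp p.2).2
    exact h.exists_isDegreeOnePrime hp.1 hp.2.1 hp.2.2
  choose f hf using hex
  have hinj : Function.Injective f := fun p q hpq => by
    have h1 := (hf p).absNorm_eq
    rw [hpq, (hf q).absNorm_eq] at h1
    exact Subtype.ext h1.symm
  have hle : ∀ p : T, ((p : ℕ) : ℝ) ≤ N := fun p => by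
    exact_mod_cast (Finset.mem_Ioc.mp (Finset.mem_filter.mp p.2).1).2
  refine ⟨Finset.univ.image f, ?_, ?_, ?_⟩
  · intro P hP
    obtain ⟨p, -, rfl⟩ := Finset.mem_image.mp hP
    exact (hf p).ne_bot
  · intro P hP Q hQ hPQ x y hx hy hxy
    obtain ⟨p, -, rfl⟩ := Finset.mem_image.mp hP
    obtain ⟨q, -, rfl⟩ := Finset.mem_image.mp hQ
    by_contra! hw
    rw [h.finrank_eq, (hf p).absNorm_eq, (hf q).absNorm_eq] at hw
    exact absurd ((hf p).mul_le_of_forall_place_le h hℓ (hf q) hPQ (hle p) (hle q) hy hxy hw)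
      (not_le.mpr hN)
  · rw [Finset.card_image_of_injective _ hinj, Finset.card_univ, Fintype.card_coe]

end Assembly

theorem NumberField.exists_card_torsion_mul_max_card_le (d : ℕ) (hd : 0 < d) {ℓ : ℕ} (hℓ : 0 < ℓ)
    {δ : ℝ} (hδ : 0 < δ) :
    ∃ C : ℝ, 0 < C ∧ ∀ (K : Type*) [Field K] [NumberField K], Module.finrank ℚ K = d →
      ∀ S : Finset (Ideal (𝓞 K)), (∀ P ∈ S, P ≠ ⊥) →
      (∀ P ∈ S, ∀ Q ∈ S, P ≠ Q → ∀ x y : 𝓞 K, x ≠ 0 → y ≠ 0 →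
        Ideal.span {x} * Q ^ ℓ = Ideal.span {y} * P ^ ℓ → ∃ w : InfinitePlace K,
          Real.exp ℓ * (w (y : K) * (Ideal.absNorm P : ℝ) ^ ((ℓ : ℝ) / Module.finrank ℚ K)) <
            w (x : K) * (Ideal.absNorm Q : ℝ) ^ ((ℓ : ℝ) / Module.finrank ℚ K)) →
      (Nat.card {c : ClassGroup (𝓞 K) // c ^ ℓ = 1} : ℝ) * max 1 (S.card : ℝ) ≤
        C * ((discr K).natAbs : ℝ) ^ ((1 : ℝ) / 2 + δ) := by
  obtain ⟨C, hC, hlog⟩ := Real.exists_log_add_two_pow_le_rpow d hδ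
  set Z : ℝ := ∑' n : ℕ, 1 / (n : ℝ) ^ (1 + δ) with hZ
  have hZ0 : 0 < Z := by
    have hs : Summable fun n : ℕ => 1 / (n : ℝ) ^ (1 + δ) :=
      Real.summable_one_div_nat_rpow.mpr (by linarith)
    exact hs.tsum_pos (fun n => by positivity) 1 (by simp)
  refine ⟨((2 : ℝ) ^ (d + 1)) ^ (1 + 2 * δ) * (Z ^ d * C), by positivity, ?_⟩
  intro K _ _ hK S hS0 hS
  set D : ℝ := ((discr K).natAbs : ℝ) with hD
  have hD1 : 1 ≤ D := by
    have : (discr K).natAbs ≠ 0 := Int.natAbs_ne_zero.mpr (discr_ne_zero K)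
    rw [hD]
    exact_mod_cast Nat.one_le_iff_ne_zero.mpr this
  have hDabs : |(discr K : ℝ)| = D := by rw [hD, Nat.cast_natAbs, Int.cast_abs]
  set x : ℝ := 2 ^ (d + 1) * √D with hx
  have hx1 : 1 ≤ x := one_le_mul_of_one_le_of_one_le (one_le_pow₀ one_le_two)
    (Real.one_le_sqrt.mpr hD1)
  have hx0 : 0 ≤ x := by linarith
  set B : ℝ := x ^ ((d : ℝ)⁻¹) with hB
  have hBd : B ^ d = x := Real.rpow_inv_natCast_pow hx0 hd.ne'
  have hB1 : 1 ≤ B := Real.one_le_rpow hx1 (by positivity)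
  have hlogB : d * Real.log B = Real.log x := by rw [← hBd, Real.log_pow]
  have hBx : (2 : ℝ) ^ Module.finrank ℚ K * √|(discr K : ℝ)| < B ^ Module.finrank ℚ K := by
    rw [hK, hBd, hDabs, hx, pow_succ]
    have : 0 < (2 : ℝ) ^ d * √D := by positivity
    linarith
  have hbound : x ^ (1 + δ) * Z ^ d * (Real.log x + 2) ^ d ≤
      ((2 : ℝ) ^ (d + 1)) ^ (1 + 2 * δ) * (Z ^ d * C) * D ^ ((1 : ℝ) / 2 + δ) := calc
    x ^ (1 + δ) * Z ^ d * (Real.log x + 2) ^ d ≤ x ^ (1 + δ) * Z ^ d * (C * x ^ δ) := by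
      gcongr
      exact hlog x hx1
    _ = x ^ (1 + 2 * δ) * (Z ^ d * C) := by
      have : x ^ (1 + 2 * δ) = x ^ (1 + δ) * x ^ δ := by
        rw [← Real.rpow_add (by linarith)]
        ring_nf
      rw [this]
      ring
    _ = _ := by
      rw [hx, Real.mul_rpow (by positivity) (by positivity), Real.sqrt_eq_rpow,
        ← Real.rpow_mul (by linarith), show 1 / 2 * (1 + 2 * δ) = 1 / 2 + δ by ring]
      ring
  refine le_trans ?_ hbound
  have hmain : ∀ S : Finset (Ideal (𝓞 K)), (∀ P ∈ S, P ≠ ⊥) →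
      (∀ P ∈ S, ∀ Q ∈ S, P ≠ Q → ∀ x y : 𝓞 K, x ≠ 0 → y ≠ 0 →
        Ideal.span {x} * Q ^ ℓ = Ideal.span {y} * P ^ ℓ → ∃ w : InfinitePlace K,
          Real.exp ℓ * (w (y : K) * (Ideal.absNorm P : ℝ) ^ ((ℓ : ℝ) / Module.finrank ℚ K)) <
            w (x : K) * (Ideal.absNorm Q : ℝ) ^ ((ℓ : ℝ) / Module.finrank ℚ K)) →
      (Nat.card {c : ClassGroup (𝓞 K) // c ^ ℓ = 1} : ℝ) * (S.card : ℝ) ≤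
        x ^ (1 + δ) * Z ^ d * (Real.log x + 2) ^ d := by
    intro S hS0 hS
    have := card_torsion_mul_card_le hℓ S hS0 hS hB1 (by linarith : 1 < 1 + δ) hBx
    rwa [hK, hBd, hlogB] at this
  rcases le_total (S.card : ℝ) 1 with h1 | h1
  · rw [max_eq_left h1]
    have := hmain {⊤} (by simp) (by
      intro P hP Q hQ hPQ
      rw [Finset.mem_singleton] at hP hQ
      exact absurd (hP.trans hQ.symm) hPQ)
    simpa using this
  · rw [max_eq_right h1]
    exact hmain S hS0 hS

namespace IsPureCubefree

variable {K : Type*} [Field K] [NumberField K] {d A₁ A₂ : ℕ} {θ : 𝓞 K}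

theorem log_discr_le (h : IsPureCubefree K d A₁ A₂ θ) :
    Real.log ((discr K).natAbs : ℝ) ≤
      d * Real.log d + (d - 1) * (Real.log A₁ + Real.log A₂) := by
  have h1 := h.three_le
  have hA₁ : (A₁ : ℝ) ≠ 0 := Nat.cast_ne_zero.mpr h.left_pos.ne'
  have hA₂ : (A₂ : ℝ) ≠ 0 := Nat.cast_ne_zero.mpr h.right_pos.ne'
  have hd : (d : ℝ) ≠ 0 := Nat.cast_ne_zero.mpr h.d_pos.ne'
  have hD : (discr K).natAbs ≠ 0 := Int.natAbs_ne_zero.mpr (discr_ne_zero K)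
  have hle : ((discr K).natAbs : ℝ) ≤ (d : ℝ) ^ d * (A₁ * A₂) ^ (d - 1) := by
    exact_mod_cast h.discr_bounds.1
  refine (Real.log_le_log (by positivity) hle).trans_eq ?_
  rw [Real.log_mul (by positivity) (by positivity), Real.log_pow, Real.log_pow,
    Real.log_mul hA₁ hA₂, Nat.cast_sub (by omega), Nat.cast_one]

theorem rpow_discr_mul_le (h : IsPureCubefree K d A₁ A₂ θ) {ℓ : ℕ} (hℓ : 0 < ℓ) :
    ((discr K).natAbs : ℝ) ^ ((1 : ℝ) / (2 * ((d : ℝ) - 1) * ℓ)) *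
        ((A₁ : ℝ) / (A₂ : ℝ) ^ (d - 2)) ^ ((1 : ℝ) / (2 * d * ℓ)) ≤
      (d : ℝ) ^ ((d : ℝ) / (2 * ((d : ℝ) - 1) * ℓ)) *
        (A₁ * A₂ / (((A₁ * A₂ ^ 2 : ℕ) : ℝ) ^ ((1 : ℝ) / d)) ^ ((d - 1) / 2)) ^ ((ℓ : ℝ)⁻¹) := by
  have h3 := h.three_le
  obtain ⟨k, hk⟩ := h.odd
  have hA₁ : (0 : ℝ) < A₁ := Nat.cast_pos.mpr h.left_pos
  have hA₂ : (0 : ℝ) < A₂ := Nat.cast_pos.mpr h.right_pos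
  have hd : (0 : ℝ) < d := Nat.cast_pos.mpr h.d_pos
  have hd1 : (0 : ℝ) < (d : ℝ) - 1 := by
    have : (3 : ℝ) ≤ d := by exact_mod_cast h3
    linarith
  have hℓ' : (0 : ℝ) < ℓ := Nat.cast_pos.mpr hℓ
  have hD : (0 : ℝ) < (discr K).natAbs :=
    Nat.cast_pos.mpr (Int.natAbs_pos.mpr (discr_ne_zero K))
  have hk2 : (((d - 1) / 2 : ℕ) : ℝ) = ((d : ℝ) - 1) / 2 := by
    rw [show (d - 1) / 2 = k by omega, hk]
    push_cast
    ring
  have hlog := h.log_discr_le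
  push_cast
  rw [← Real.log_le_log_iff (by positivity) (by positivity), Real.log_mul (by positivity)
    (by positivity), Real.log_mul (by positivity) (by positivity), Real.log_rpow hD,
    Real.log_rpow (by positivity), Real.log_rpow hd, Real.log_rpow (by positivity),
    Real.log_div (by positivity) (by positivity), Real.log_div (by positivity) (by positivity),
    Real.log_mul hA₁.ne' hA₂.ne', Real.log_pow, Real.log_pow, Real.log_rpow (by positivity),
    Real.log_mul (by positivity) (by positivity), Real.log_pow, hk2,
    Nat.cast_sub (by omega : 2 ≤ d)]
  have h4 : 1 / (2 * ((d : ℝ) - 1) * ℓ) * Real.log ((discr K).natAbs : ℝ) ≤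
      1 / (2 * ((d : ℝ) - 1) * ℓ) * (d * Real.log d + (d - 1) * (Real.log A₁ + Real.log A₂)) := by
    gcongr
  refine (add_le_add_left h4 _).trans_eq ?_
  push_cast
  field_simp
  ring

theorem mul_le_discr (h : IsPureCubefree K d A₁ A₂ θ) :
    (A₁ * A₂ : ℝ) ≤ (d : ℝ) ^ d * ((discr K).natAbs : ℝ) := by
  have h3 := h.three_le
  have h1 : A₁ * A₂ ≤ (A₁ * A₂) ^ (d - 1) :=
    Nat.le_self_pow (by omega) _
  have h2 := h.discr_bounds.2
  rw [two_mul, pow_add, mul_assoc] at h2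
  have h4 := Nat.le_of_mul_le_mul_left h2 (pow_pos h.d_pos d)
  exact_mod_cast h1.trans h4

end IsPureCubefree

theorem exists_card_torsion_le_of_isPureCubefree (d ℓ : ℕ) (hd3 : 3 ≤ d) (hodd : Odd d)
    (hℓ : 0 < ℓ) (ε : ℝ) (hε : 0 < ε) :
    ∃ C : ℝ, 0 < C ∧ ∀ (K : Type*) [Field K] [NumberField K] (A₁ A₂ : ℕ) (θ : 𝓞 K),
      IsPureCubefree K d A₁ A₂ θ →
      (Nat.card {c : ClassGroup (𝓞 K) // c ^ ℓ = 1} : ℝ) ≤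
        C * ((discr K).natAbs : ℝ) ^ ((1 : ℝ) / 2 - 1 / (2 * ((d : ℝ) - 1) * (ℓ : ℝ)) + ε) *
          ((A₂ : ℝ) ^ (d - 2) / (A₁ : ℝ)) ^ ((1 : ℝ) / (2 * (d : ℝ) * (ℓ : ℝ))) := by
  have : NeZero d := ⟨by omega⟩
  have hd0 : (0 : ℝ) < d := Nat.cast_pos.mpr (by omega)
  have hℓ0 : (0 : ℝ) < ℓ := Nat.cast_pos.mpr hℓ
  have hδ : 0 < ε / 2 := by linarith
  have hunit : IsUnit (2 : ZMod d) := by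
    have := (ZMod.isUnit_iff_coprime 2 d).mpr (Nat.coprime_two_left.mpr hodd)
    exact_mod_cast this
  obtain ⟨C₁, hC₁, hprimes⟩ := exists_le_mul_card_primes_not_dvd hunit hδ
  obtain ⟨C₂, hC₂, htors⟩ := exists_card_torsion_mul_max_card_le d (by omega) hℓ hδ
  set E : ℝ := 2 * d * Real.exp ℓ with hE
  have hE0 : 0 < E := by positivity
  have hE1 : 1 ≤ E := by
    have h1 : (3 : ℝ) ≤ d := by exact_mod_cast hd3
    have h2 := Real.one_le_exp hℓ0.le
    nlinarith
  set κ : ℝ := (d : ℝ) ^ ((d : ℝ) / (2 * ((d : ℝ) - 1) * ℓ)) with hκ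
  have hκ0 : 0 < κ := by positivity
  refine ⟨κ * E ^ ((ℓ : ℝ)⁻¹) * (C₁ * ((d : ℝ) ^ d) ^ (ε / 2) * C₂), by positivity, ?_⟩
  intro K _ _ A₁ A₂ θ h
  have hA₁ : (0 : ℝ) < A₁ := Nat.cast_pos.mpr h.left_pos
  have hA₂ : (0 : ℝ) < A₂ := Nat.cast_pos.mpr h.right_pos
  have hm1 : 1 ≤ A₁ * A₂ := Nat.mul_pos h.left_pos h.right_pos
  have hm1' : (1 : ℝ) ≤ A₁ * A₂ := by exact_mod_cast hm1
  have hscale := h.rpow_discr_mul_le hℓ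
  have hmD := h.mul_le_discr
  set D : ℝ := ((discr K).natAbs : ℝ) with hDdef
  have hD : 0 < D := Nat.cast_pos.mpr (Int.natAbs_pos.mpr (discr_ne_zero K))
  set U : ℝ := (((A₁ * A₂ ^ 2 : ℕ) : ℝ) ^ ((1 : ℝ) / d)) ^ ((d - 1) / 2) with hU
  have hU1 : 1 ≤ U := by
    refine one_le_pow₀ (Real.one_le_rpow ?_ (by positivity))
    exact_mod_cast h.one_lt.le
  have hU0 : 0 < U := by linarith
  set V : ℝ := A₁ * A₂ / U with hV
  have hV0 : 0 < V := by positivity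
  set z : ℝ := (V / E) ^ ((ℓ : ℝ)⁻¹) with hz
  have hz0 : 0 < z := by positivity
  have hzℓ : z ^ ℓ = V / E := Real.rpow_inv_natCast_pow (by positivity) hℓ.ne'
  have hzm : z ≤ ((A₁ * A₂ : ℕ) : ℝ) := by
    push_cast
    rcases le_or_gt z 1 with h1 | h1
    · exact h1.trans hm1'
    · calc z ≤ z ^ ℓ := le_self_pow₀ h1.le hℓ.ne'
        _ = A₁ * A₂ / (U * E) := by rw [hzℓ, hV, div_div]
        _ ≤ A₁ * A₂ := div_le_self (by positivity) (one_le_mul_of_one_le_of_one_le hU1 hE1)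
  have hN : d * (Real.exp ℓ * (⌊z⌋₊ : ℝ) ^ ℓ * U) < (A₁ * A₂ : ℝ) := calc
    d * (Real.exp ℓ * (⌊z⌋₊ : ℝ) ^ ℓ * U) ≤ d * (Real.exp ℓ * z ^ ℓ * U) := by
      gcongr
      exact Nat.floor_le hz0.le
    _ = A₁ * A₂ / 2 := by
      rw [hzℓ, hV, hE]
      field_simp
    _ < A₁ * A₂ := half_lt_self (by positivity)
  obtain ⟨S, hS0, hS, hcard⟩ := h.exists_separated_finset hℓ hN
  have hH := htors K h.finrank_eq S hS0 hS
  have hzS := hprimes (A₁ * A₂) z hm1 hzm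
  rw [← hcard] at hzS
  set H : ℝ := (Nat.card {c : ClassGroup (𝓞 K) // c ^ ℓ = 1} : ℝ) with hHdef
  set t : ℝ := max 1 (S.card : ℝ)
  have hVz : V ^ ((ℓ : ℝ)⁻¹) = E ^ ((ℓ : ℝ)⁻¹) * z := by
    rw [hz, ← Real.mul_rpow hE0.le (by positivity), mul_div_cancel₀ _ hE0.ne']
  have hmδ : (((A₁ * A₂ : ℕ) : ℝ)) ^ (ε / 2) ≤ ((d : ℝ) ^ d) ^ (ε / 2) * D ^ (ε / 2) := by
    rw [← Real.mul_rpow (by positivity) hD.le]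
    push_cast
    gcongr
  have hHz : H * z ≤ C₁ * ((d : ℝ) ^ d) ^ (ε / 2) * C₂ * D ^ (1 / 2 + ε) := calc
    H * z ≤ H * (C₁ * (((A₁ * A₂ : ℕ) : ℝ)) ^ (ε / 2) * t) := by gcongr
    _ = C₁ * (((A₁ * A₂ : ℕ) : ℝ)) ^ (ε / 2) * (H * t) := by ring
    _ ≤ C₁ * (((d : ℝ) ^ d) ^ (ε / 2) * D ^ (ε / 2)) * (C₂ * D ^ (1 / 2 + ε / 2)) := by gcongr
    _ = C₁ * ((d : ℝ) ^ d) ^ (ε / 2) * C₂ * (D ^ (1 / 2 + ε / 2) * D ^ (ε / 2)) := by ring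
    _ = _ := by
      rw [← Real.rpow_add hD]
      ring_nf
  set e₁ : ℝ := 1 / (2 * ((d : ℝ) - 1) * ℓ)
  set e₂ : ℝ := 1 / (2 * d * ℓ)
  rw [hVz] at hscale
  have hinv : (A₂ : ℝ) ^ (d - 2) / A₁ = (A₁ / (A₂ : ℝ) ^ (d - 2))⁻¹ := by rw [inv_div]
  have hR : 0 < (A₁ : ℝ) / (A₂ : ℝ) ^ (d - 2) := by positivity
  set R : ℝ := A₁ / (A₂ : ℝ) ^ (d - 2)
  rw [hinv, Real.inv_rpow hR.le, ← div_eq_mul_inv, show 1 / 2 - e₁ + ε = 1 / 2 + ε - e₁ by ring,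
    Real.rpow_sub hD, mul_div_assoc', div_div, le_div_iff₀ (by positivity)]
  calc H * (D ^ e₁ * R ^ e₂) ≤ H * (κ * (E ^ ((ℓ : ℝ)⁻¹) * z)) := by gcongr
    _ = κ * E ^ ((ℓ : ℝ)⁻¹) * (H * z) := by ring
    _ ≤ κ * E ^ ((ℓ : ℝ)⁻¹) * (C₁ * ((d : ℝ) ^ d) ^ (ε / 2) * C₂ * D ^ (1 / 2 + ε)) := by gcongr
    _ = _ := by ring

/-- torsion bound for pure fields of odd degree `d` with `a = A₁A₂²` cubefree. -/
theorem torsion_pure_field_cubefree (d ℓ : ℕ) (hd3 : 3 ≤ d) (hodd : Odd d) (hℓ : 0 < ℓ)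
    (ε : ℝ) (hε : 0 < ε) :
    ∃ C : ℝ, 0 < C ∧
      ∀ (K : Type) (_ : Field K) (_ : NumberField K) (A₁ A₂ a : ℕ) (θ : K),
        Squarefree A₁ → Squarefree A₂ → Nat.Coprime A₁ A₂ → 0 < A₁ → 0 < A₂ →
        a = A₁ * A₂ ^ 2 → 1 < a →
        Irreducible ((Polynomial.X : ℚ[X]) ^ d - Polynomial.C (a : ℚ)) →
        θ ^ d = (a : K) → IntermediateField.adjoin ℚ {θ} = ⊤ →
        Module.finrank ℚ K = d →
        (Nat.card {c : ClassGroup (𝓞 K) // c ^ ℓ = 1} : ℝ) ≤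
          C * (DK K : ℝ) ^ ((1 : ℝ) / 2 - 1 / (2 * ((d : ℝ) - 1) * (ℓ : ℝ)) + ε) *
            ((A₂ : ℝ) ^ (d - 2) / (A₁ : ℝ)) ^ ((1 : ℝ) / (2 * (d : ℝ) * (ℓ : ℝ))) := by
  obtain ⟨C, hC, hbound⟩ := exists_card_torsion_le_of_isPureCubefree d ℓ hd3 hodd hℓ ε hε
  refine ⟨C, hC, ?_⟩
  intro K _ _ A₁ A₂ a θ hs₁ hs₂ hcop _ _ ha ha1 hirr hθ _ hK
  subst ha
  have h_int : IsIntegral ℤ θ := by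
    refine IsIntegral.of_pow (by omega : 0 < d) ?_
    rw [hθ, ← map_natCast (algebraMap ℤ K)]
    exact isIntegral_algebraMap
  obtain ⟨η, hη⟩ : ∃ η : 𝓞 K, algebraMap (𝓞 K) K η = θ :=
    ⟨_, IsIntegralClosure.algebraMap_mk' (𝓞 K) θ h_int⟩
  refine hbound K A₁ A₂ η ⟨hd3, hodd, hs₁, hs₂, hcop, ha1, hirr, ?_, hK⟩
  apply FaithfulSMul.algebraMap_injective (𝓞 K) K
  rw [map_pow, map_natCast, hη, hθ]
end

section
/- There is an absolute constant c > 0 such that for every number field K of degree d > 1 over ℚ and every real δ > 0, the number of primitive elements of height less than η(K)·D_K^δ satisfies N'_K(η(K)·D_K^δ) ≥ c · D_K^{2δ/d}. -/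
open NumberField Polynomial

lemma mem_denIdeal {K : Type*} [Field K] [NumberField K] {α : K} {x : 𝓞 K} :
    x ∈ denIdeal K α ↔ ∃ y : 𝓞 K, (x : K) * α = (y : K) := Iff.rfl

lemma absNorm_denIdeal_pos {K : Type*} [Field K] [NumberField K] (α : K) :
    0 < Ideal.absNorm (denIdeal K α) := by
  refine Nat.pos_of_ne_zero fun h => ?_
  rw [Ideal.absNorm_eq_zero_iff] at h
  obtain ⟨x, y, hy, rfl⟩ := IsFractionRing.div_surjective (A := 𝓞 K) α
  have hy0 : y ≠ 0 := nonZeroDivisors.ne_zero hy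
  have hmem : y ∈ denIdeal K (algebraMap (𝓞 K) K x / algebraMap (𝓞 K) K y) := by
    refine mem_denIdeal.2 ⟨x, mul_div_cancel₀ _ ?_⟩
    simpa using hy0
  rw [h] at hmem
  exact hy0 (by simpa using hmem)

lemma one_le_prod_max {K : Type*} [Field K] [NumberField K] (α : K) :
    (1 : ℝ) ≤ ∏ w : InfinitePlace K, max 1 (w α) ^ w.mult :=
  Finset.one_le_prod fun _ _ => one_le_pow₀ (le_max_left _ _)

lemma absNorm_denIdeal_le_heightK {K : Type*} [Field K] [NumberField K] (α : K) :
    (Ideal.absNorm (denIdeal K α) : ℝ) ≤ heightK K α :=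
  le_mul_of_one_le_right (Nat.cast_nonneg _) (one_le_prod_max α)

lemma one_le_heightK {K : Type*} [Field K] [NumberField K] (α : K) : 1 ≤ heightK K α :=
  le_trans (by exact_mod_cast absNorm_denIdeal_pos α) (absNorm_denIdeal_le_heightK α)

lemma apply_le_heightK {K : Type*} [Field K] [NumberField K] (α : K) (w : InfinitePlace K) :
    w α ≤ heightK K α := by
  classical
  have h1 : max 1 (w α) ^ w.mult ≤ ∏ v : InfinitePlace K, max 1 (v α) ^ v.mult := by
    rw [← Finset.mul_prod_erase _ _ (Finset.mem_univ w)]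
    exact le_mul_of_one_le_right (by positivity)
      (Finset.one_le_prod fun _ _ => one_le_pow₀ (le_max_left _ _))
  have h2 : max 1 (w α) ≤ max 1 (w α) ^ w.mult :=
    le_self_pow₀ (le_max_left _ _) w.mult_ne_zero
  have h3 : (1 : ℝ) ≤ Ideal.absNorm (denIdeal K α) := by
    exact_mod_cast absNorm_denIdeal_pos α
  calc w α ≤ ∏ v : InfinitePlace K, max 1 (v α) ^ v.mult :=
        (le_max_right _ _).trans (h2.trans h1)
    _ ≤ heightK K α := le_mul_of_one_le_left (zero_le_one.trans (one_le_prod_max α)) h3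

lemma infinitePlace_natCast {K : Type*} [Field K] (w : InfinitePlace K) (n : ℕ) :
    w (n : K) = n := by
  rw [← InfinitePlace.norm_embedding_eq, map_natCast, Complex.norm_natCast]

/-- Northcott's theorem for a fixed number field. -/
lemma finite_setOf_heightK_lt (K : Type*) [Field K] [NumberField K] (X : ℝ) :
    {α : K | heightK K α < X}.Finite := by
  have hfin := Embeddings.finite_of_norm_le K ℂ (X * X)
  refine (((Set.finite_Iic ⌊X⌋₊).prod hfin).image
    fun p : ℕ × K => p.2 / (p.1 : K)).subset ?_
  intro α (hα : heightK K α < X)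
  have hN := absNorm_denIdeal_pos α
  have hNX := (absNorm_denIdeal_le_heightK α).trans hα.le
  obtain ⟨y, hy⟩ := mem_denIdeal.1 (Ideal.absNorm_mem (denIdeal K α))
  set N := Ideal.absNorm (denIdeal K α)
  have hy' : (N : K) * α = y := by simpa using hy
  refine ⟨(N, y), ⟨Nat.le_floor hNX, y.isIntegral_coe, fun φ => ?_⟩, ?_⟩
  · have h := apply_le_heightK α (InfinitePlace.mk φ)
    rw [InfinitePlace.apply] at h
    rw [← hy', map_mul, map_natCast, norm_mul, Complex.norm_natCast]
    exact mul_le_mul hNX (h.trans hα.le) (norm_nonneg _) ((Nat.cast_nonneg N).trans hNX)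
  · have hN0 : (N : K) ≠ 0 := by exact_mod_cast hN.ne'
    simp only [← hy']
    field_simp

lemma heightK_mul_add_le {K : Type*} [Field K] [NumberField K] (α : K) (a b : ℕ) (ha : 1 ≤ a) :
    heightK K (a * α + b) ≤ ((a + b : ℕ) : ℝ) ^ Module.finrank ℚ K * heightK K α := by
  have hden : denIdeal K α ≤ denIdeal K (a * α + b) := by
    intro x hx
    obtain ⟨y, hy⟩ := mem_denIdeal.1 hx
    refine mem_denIdeal.2 ⟨a * y + x * b, ?_⟩
    push_cast
    linear_combination (a : K) * hy
  have hnorm : (Ideal.absNorm (denIdeal K (a * α + b)) : ℝ) ≤ Ideal.absNorm (denIdeal K α) := by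
    exact_mod_cast Nat.le_of_dvd (absNorm_denIdeal_pos α) (Ideal.absNorm_dvd_absNorm_of_le hden)
  have hplace (w : InfinitePlace K) :
      max 1 (w (a * α + b)) ≤ ((a + b : ℕ) : ℝ) * max 1 (w α) := by
    have ha' : (1 : ℝ) ≤ a := by exact_mod_cast ha
    have hb : (0 : ℝ) ≤ b := b.cast_nonneg
    have h1 := le_max_left 1 (w α)
    have h2 := le_max_right 1 (w α)
    have h3 : w (a * α + b) ≤ a * w α + b := by
      refine (w.1.add_le _ _).trans_eq ?_
      change w (a * α) + w b = _
      rw [map_mul, infinitePlace_natCast, infinitePlace_natCast]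
    push_cast
    refine max_le ?_ ?_ <;> nlinarith
  have hprod : ∏ w : InfinitePlace K, max 1 (w (a * α + b)) ^ w.mult ≤
      ((a + b : ℕ) : ℝ) ^ Module.finrank ℚ K * ∏ w : InfinitePlace K, max 1 (w α) ^ w.mult := by
    rw [← InfinitePlace.sum_mult_eq, ← Finset.prod_pow_eq_pow_sum, ← Finset.prod_mul_distrib]
    refine Finset.prod_le_prod (fun _ _ => by positivity) fun w _ => ?_
    rw [← mul_pow]
    exact pow_le_pow_left₀ (by positivity) (hplace w) _
  calc heightK K (a * α + b) ≤ Ideal.absNorm (denIdeal K α) *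
        (((a + b : ℕ) : ℝ) ^ Module.finrank ℚ K *
          ∏ w : InfinitePlace K, max 1 (w α) ^ w.mult) :=
        mul_le_mul hnorm hprod (zero_le_one.trans (one_le_prod_max _)) (Nat.cast_nonneg _)
    _ = _ := by rw [heightK]; ring

lemma adjoin_mul_add_eq_top {K : Type*} [Field K] [NumberField K] {α : K}
    (hα : IntermediateField.adjoin ℚ {α} = ⊤) (a b : ℕ) (ha : 1 ≤ a) :
    IntermediateField.adjoin ℚ {(a * α + b : K)} = ⊤ := by
  rw [eq_top_iff, ← hα, IntermediateField.adjoin_simple_le_iff]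
  have ha0 : (a : K) ≠ 0 := by exact_mod_cast (Nat.one_le_iff_ne_zero.1 ha)
  have h : α = (a * α + b - b) / a := by field_simp; ring
  have hmem := div_mem (sub_mem (IntermediateField.mem_adjoin_simple_self ℚ (a * α + b))
    (natCast_mem _ b)) (natCast_mem _ a)
  rwa [← h] at hmem

lemma mul_add_injective_of_adjoin_eq_top {K : Type*} [Field K] [NumberField K] {α : K}
    (hα : IntermediateField.adjoin ℚ {α} = ⊤) (hK : 1 < Module.finrank ℚ K) :
    Function.Injective fun p : ℕ × ℕ => (p.1 * α + p.2 : K) := by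
  rintro ⟨a, b⟩ ⟨a', b'⟩ (h : (a * α + b : K) = a' * α + b')
  have haa : a = a' := by
    by_contra hne
    have hne' : (a - a' : K) ≠ 0 := sub_ne_zero.2 (by exact_mod_cast hne)
    have hα' : α = (b' - b) / (a - a') := by
      rw [eq_div_iff hne']
      linear_combination h
    have hbot : α ∈ (⊥ : IntermediateField ℚ K) := by
      rw [hα']
      exact div_mem (sub_mem (natCast_mem _ _) (natCast_mem _ _))
        (sub_mem (natCast_mem _ _) (natCast_mem _ _))
    rw [IntermediateField.adjoin_simple_eq_bot_iff.2 hbot] at hα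
    have := IntermediateField.finrank_bot (F := ℚ) (E := K)
    have h2 := IntermediateField.finrank_top' (F := ℚ) (E := K)
    rw [← hα, this] at h2
    omega
  subst haa
  simpa using h

lemma sq_le_NprimeK {K : Type*} [Field K] [NumberField K] (hK : 1 < Module.finrank ℚ K)
    (B : ℕ) {α : K} (hα : IntermediateField.adjoin ℚ {α} = ⊤) {X : ℝ}
    (hX : (2 * B - 1 : ℝ) ^ Module.finrank ℚ K * heightK K α < X) :
    B ^ 2 ≤ NprimeK K X := by
  have : Finite {α : K // IntermediateField.adjoin ℚ {α} = ⊤ ∧ heightK K α < X} :=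
    ((finite_setOf_heightK_lt K X).subset fun _ h => h.2).to_subtype
  have hmem (p : Fin B × Fin B) :
      heightK K ((p.1 + 1 : ℕ) * α + (p.2 : ℕ)) < X := by
    refine (heightK_mul_add_le α _ _ (Nat.le_add_left _ _)).trans_lt (lt_of_le_of_lt ?_ hX)
    refine mul_le_mul_of_nonneg_right (pow_le_pow_left₀ (Nat.cast_nonneg _) ?_ _)
      (zero_le_one.trans (one_le_heightK α))
    have h : (p.1 + 1 + p.2 : ℕ) + 1 ≤ 2 * B := by omega
    have h' : (((p.1 + 1 + p.2 : ℕ) + 1 : ℕ) : ℝ) ≤ (2 * B : ℕ) := by exact_mod_cast h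
    push_cast at h' ⊢
    linarith
  let f : Fin B × Fin B → {α : K // IntermediateField.adjoin ℚ {α} = ⊤ ∧ heightK K α < X} :=
    fun p => ⟨(p.1 + 1 : ℕ) * α + (p.2 : ℕ),
      adjoin_mul_add_eq_top hα _ _ (Nat.le_add_left _ _), hmem p⟩
  have hf : Function.Injective f := by
    rintro ⟨i, j⟩ ⟨i', j'⟩ h
    have h2 := @mul_add_injective_of_adjoin_eq_top _ _ _ _ hα hK
      (i + 1, j) (i' + 1, j') (congrArg Subtype.val h)
    simp only [Prod.mk.injEq, Nat.add_right_cancel_iff, Fin.val_inj] at h2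
    simp [h2]
  simpa [NprimeK, sq] using Nat.card_le_card_of_injective f hf

lemma one_le_etaK (K : Type*) [Field K] [NumberField K] : 1 ≤ etaK K := by
  obtain ⟨α, hα⟩ := Field.exists_primitive_element ℚ K
  exact le_csInf ⟨_, α, hα, rfl⟩ (by rintro _ ⟨β, _, rfl⟩; exact one_le_heightK β)

lemma exists_heightK_lt {K : Type*} [Field K] [NumberField K] {x : ℝ} (hx : etaK K < x) :
    ∃ α : K, IntermediateField.adjoin ℚ {α} = ⊤ ∧ heightK K α < x := by
  obtain ⟨α, hα⟩ := Field.exists_primitive_element ℚ K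
  obtain ⟨_, ⟨β, hβ, rfl⟩, hlt⟩ := exists_lt_of_csInf_lt
    (s := {x : ℝ | ∃ α : K, IntermediateField.adjoin ℚ {α} = ⊤ ∧ heightK K α = x})
    ⟨_, α, hα, rfl⟩ hx
  exact ⟨β, hβ, hlt⟩

/-- `N'_K(η(K)·D_K^δ) ≫ D_K^{2δ/d}` with an absolute implied constant. -/
theorem many_small_generators :
    ∃ c : ℝ, 0 < c ∧
      ∀ (K : Type) (_ : Field K) (_ : NumberField K), 1 < Module.finrank ℚ K →
        ∀ δ : ℝ, 0 < δ →
          c * (DK K : ℝ) ^ (2 * δ / (Module.finrank ℚ K : ℝ)) ≤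
            (NprimeK K (etaK K * (DK K : ℝ) ^ δ) : ℝ) := by
  refine ⟨1 / 9, by norm_num, fun K _ _ hK δ hδ => ?_⟩
  have hD : (1 : ℝ) < DK K := by
    have h : 1 < DK K := by
      have := NumberField.abs_discr_gt_two hK
      rw [Int.abs_eq_natAbs] at this
      rw [DK]
      omega
    exact_mod_cast h
  have hD0 : (0 : ℝ) ≤ DK K := Nat.cast_nonneg _
  set d := Module.finrank ℚ K
  have hd0 : (0 : ℝ) < d := by exact_mod_cast zero_lt_one.trans hK
  set T : ℝ := (DK K : ℝ) ^ (δ / d) with hT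
  have hT1 : 1 < T := Real.one_lt_rpow hD (by positivity)
  have hTd : T ^ d = (DK K : ℝ) ^ δ := by
    rw [hT, ← Real.rpow_natCast, ← Real.rpow_mul hD0, div_mul_cancel₀ _ hd0.ne']
  have hT2 : (DK K : ℝ) ^ (2 * δ / d) = T ^ 2 := by
    rw [hT, ← Real.rpow_natCast, ← Real.rpow_mul hD0]
    congr 1
    push_cast
    ring
  -- `B` is the largest integer with `2 * B - 1 < T`.
  obtain ⟨B, hB1, hBT, hTB⟩ : ∃ B : ℕ, (1 : ℝ) ≤ B ∧ (2 * B - 1 : ℝ) < T ∧ T ≤ 2 * B + 1 := by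
    have h1 : 1 < ⌈(T + 1) / 2⌉₊ := Nat.lt_ceil.2 (by push_cast; linarith)
    have h2 := Nat.ceil_lt_add_one (show 0 ≤ (T + 1) / 2 by linarith)
    have h3 := Nat.le_ceil ((T + 1) / 2)
    refine ⟨⌈(T + 1) / 2⌉₊ - 1, ?_, ?_, ?_⟩
    · exact_mod_cast Nat.le_sub_of_add_le h1
    all_goals
      rw [Nat.cast_sub h1.le]
      push_cast
      linarith
  have hpos : (0 : ℝ) < (2 * B - 1) ^ d := pow_pos (by linarith) _
  have hlt : (2 * B - 1 : ℝ) ^ d < (DK K : ℝ) ^ δ :=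
    hTd ▸ pow_lt_pow_left₀ hBT (by linarith) (by omega)
  obtain ⟨α, hα, hαlt⟩ : ∃ α : K, IntermediateField.adjoin ℚ {α} = ⊤ ∧
      heightK K α < etaK K * (DK K : ℝ) ^ δ / (2 * B - 1) ^ d := by
    refine exists_heightK_lt ?_
    rw [lt_div_iff₀ hpos]
    exact mul_lt_mul_of_pos_left hlt (zero_lt_one.trans_le (one_le_etaK K))
  have hcount : B ^ 2 ≤ NprimeK K (etaK K * (DK K : ℝ) ^ δ) :=
    sq_le_NprimeK hK B hα (by rwa [lt_div_iff₀' hpos] at hαlt)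
  have hcount' : (B : ℝ) ^ 2 ≤ NprimeK K (etaK K * (DK K : ℝ) ^ δ) := by exact_mod_cast hcount
  rw [hT2]
  nlinarith
end

section
/- Let d ≥ 3 be odd and let K = ℚ(a^{1/d}) be a pure field of degree d with a = ∏_{i=1}^{d−1} A_i^i, where A_1,…,A_{d−1} are positive, squarefree and pairwise coprime integers. Then every α ∈ K with ℚ(α) = K satisfies H_K(α) > d^{−(2d−1)} · min over integers m with (d+1)/2 ≤ m ≤ d−1 of ∏_{i=1}^{d−1} A_i^{ (i·m)/d − ⌊(i·m)/d⌋ }. -/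
open NumberField Polynomial

section Height

variable {K : Type*} [Field K] [NumberField K]

/-- The height as a product over complex embeddings instead of infinite places. -/
theorem heightK_eq_prod_embeddings (α : K) :
    heightK K α =
      (Ideal.absNorm (denIdeal K α) : ℝ) * ∏ σ : K →ₐ[ℚ] ℂ, max 1 ‖σ α‖ := by
  classical
  rw [heightK]
  congr 1
  rw [← Fintype.prod_equiv (RingHom.equivRatAlgHom K ℂ) (fun f => max 1 ‖f α‖)
      (fun φ => max 1 ‖φ α‖) fun _ => by simp [RingHom.equivRatAlgHom_apply],
    ← Finset.prod_fiberwise Finset.univ InfinitePlace.mk (fun φ => max 1 ‖φ α‖)]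
  have h (w : InfinitePlace K) (φ) (hφ : φ ∈ ({φ | InfinitePlace.mk φ = w} : Finset _)) :
      max 1 ‖φ α‖ = max 1 (w α) := by
    rw [← (Finset.mem_filter.mp hφ).2, InfinitePlace.apply]
  simp_rw [Finset.prod_congr rfl (h _), Finset.prod_const, InfinitePlace.card_filter_mk_eq]

theorem denIdeal_ne_bot (α : K) : denIdeal K α ≠ ⊥ := by
  obtain ⟨x, s, hs, h⟩ := IsFractionRing.div_surjective (A := 𝓞 K) α
  have hs0 : s ≠ 0 := nonZeroDivisors.ne_zero hs
  have hmem : s ∈ denIdeal K α := by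
    refine ⟨x, ?_⟩
    rw [← h]
    exact mul_div_cancel₀ _ (RingOfIntegers.coe_ne_zero_iff.mpr hs0)
  intro hb
  rw [hb] at hmem
  exact hs0 hmem

/-- Clearing the denominator of any partial product of conjugates. -/
theorem isIntegral_absNorm_denIdeal_mul_prod (α : K) (S : Finset (K →ₐ[ℚ] ℂ)) :
    IsIntegral ℤ ((Ideal.absNorm (denIdeal K α) : ℂ) * ∏ σ ∈ S, σ α) := by
  classical
  suffices h : ∀ n ∈ Ideal.relNorm ℤ (denIdeal K α),
      IsIntegral ℤ ((n : ℂ) * ∏ σ ∈ S, σ α) by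
    have := h (Ideal.absNorm (denIdeal K α) : ℤ)
      (by rw [Ideal.relNorm_int]; exact Ideal.mem_span_singleton_self _)
    simpa using this
  intro n hn
  rw [Ideal.relNorm_apply] at hn
  induction hn using Submodule.span_induction with
  | mem n hn =>
    obtain ⟨x, ⟨y, hy⟩, rfl⟩ := hn
    have hnorm : ((Algebra.intNorm ℤ (𝓞 K) x : ℤ) : ℂ) = ∏ σ : K →ₐ[ℚ] ℂ, σ (x : K) := by
      rw [Algebra.intNorm_eq_norm, ← Algebra.norm_eq_prod_embeddings ℚ ℂ (x : K),
        ← Algebra.coe_norm_int]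
      simp
    rw [hnorm, ← Finset.prod_mul_prod_compl S, mul_right_comm, ← Finset.prod_mul_distrib]
    refine IsIntegral.mul (IsIntegral.prod _ fun σ _ => ?_) (IsIntegral.prod _ fun σ _ => ?_)
    · rw [← map_mul, hy]
      exact (RingOfIntegers.isIntegral_coe y).map (σ.restrictScalars ℤ)
    · exact (RingOfIntegers.isIntegral_coe x).map (σ.restrictScalars ℤ)
  | zero => simpa using isIntegral_zero
  | add a b _ _ ha hb =>
    push_cast
    rw [add_mul]
    exact ha.add hb
  | smul c a _ ha =>
    rw [smul_eq_mul, Int.cast_mul, mul_assoc]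
    exact (isIntegral_algebraMap (R := ℤ) (x := c)).mul ha

theorem absNorm_denIdeal_mul_norm_prod_le (α : K) (S : Finset (K →ₐ[ℚ] ℂ)) :
    ‖(Ideal.absNorm (denIdeal K α) : ℂ) * ∏ σ ∈ S, σ α‖ ≤ heightK K α := by
  rw [heightK_eq_prod_embeddings, norm_mul, Complex.norm_natCast, norm_prod]
  gcongr
  calc ∏ σ ∈ S, ‖σ α‖ ≤ ∏ σ ∈ S, max 1 ‖σ α‖ :=
        Finset.prod_le_prod (fun _ _ => norm_nonneg _) fun _ _ => le_max_right _ _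
    _ ≤ ∏ σ : K →ₐ[ℚ] ℂ, max 1 ‖σ α‖ :=
        Finset.prod_le_prod_of_subset_of_one_le (Finset.subset_univ _)
          (fun _ _ => by positivity) fun _ _ _ => le_max_left _ _

/-- The coefficients of a product of linear factors, as sums over subsets of the roots. -/
theorem coeff_prod_X_sub_C_eq_sum_powerset {ι R : Type*} [CommRing R] [DecidableEq ι]
    (s : Finset ι) (f : ι → R) (j : ℕ) :
    (∏ i ∈ s, (X - C (f i))).coeff j =
      ∑ t ∈ s.powerset with t.card = j, (-1) ^ (s \ t).card * ∏ i ∈ s \ t, f i := by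
  simp_rw [sub_eq_add_neg, ← C_neg, Finset.prod_add, finsetSum_coeff, Finset.sum_filter,
    Finset.prod_const, ← map_prod, mul_comm (X ^ _), coeff_C_mul, coeff_X_pow]
  refine Finset.sum_congr rfl fun t _ => ?_
  by_cases h : t.card = j
  · simp [h, Finset.prod_neg]
  · simp [h, Ne.symm h]

theorem adjoin_singleton_algebra_eq_top {α : K} (hα : IntermediateField.adjoin ℚ {α} = ⊤) :
    Algebra.adjoin ℚ {α} = ⊤ := by
  rw [← IntermediateField.adjoin_simple_toSubalgebra_of_isAlgebraic
    (IsAlgebraic.of_finite ℚ α), hα, IntermediateField.top_toSubalgebra]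

theorem minpoly_map_eq_prod_embeddings {α : K} (hα : IntermediateField.adjoin ℚ {α} = ⊤) :
    (minpoly ℚ α).map (algebraMap ℚ ℂ) = ∏ τ : K →ₐ[ℚ] ℂ, (X - C (τ α)) := by
  have hinj : Function.Injective fun τ : K →ₐ[ℚ] ℂ => τ α := fun _ _ h =>
    AlgHom.ext_of_adjoin_eq_top (adjoin_singleton_algebra_eq_top hα) fun _ hx => hx ▸ h
  have hInt := Algebra.IsIntegral.isIntegral (R := ℚ) α
  refine eq_of_monic_of_dvd_of_natDegree_le (monic_prod_X_sub_C _ _)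
    ((minpoly.monic hInt).map _) ?_ ?_
  · refine Finset.prod_dvd_of_coprime
      ((pairwise_coprime_X_sub_C hinj).set_pairwise _) fun τ _ => ?_
    rw [dvd_iff_isRoot, IsRoot, eval_map_algebraMap, aeval_algHom_apply, minpoly.aeval, map_zero]
  · rw [natDegree_map, natDegree_finsetProd_X_sub_C_eq_card, Finset.card_univ, AlgHom.card]
    exact minpoly.natDegree_le α

theorem minpolyDiv_map_eq_prod_erase [DecidableEq (K →ₐ[ℚ] ℂ)] {α : K}
    (hα : IntermediateField.adjoin ℚ {α} = ⊤) (σ : K →ₐ[ℚ] ℂ) :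
    (minpolyDiv ℚ α).map (σ : K →+* ℂ) = ∏ τ ∈ Finset.univ.erase σ, (X - C (τ α)) := by
  have h := congrArg (Polynomial.map (σ : K →+* ℂ)) (minpolyDiv_spec ℚ α)
  rw [Polynomial.map_map, AlgHom.comp_algebraMap, minpoly_map_eq_prod_embeddings hα,
    ← Finset.prod_erase_mul _ _ (Finset.mem_univ σ)] at h
  refine mul_right_cancel₀ (X_sub_C_ne_zero (σ α)) ?_
  simpa using h

theorem absNorm_denIdeal_mul_minpolyDiv_coeff [DecidableEq (K →ₐ[ℚ] ℂ)] {α : K}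
    (hα : IntermediateField.adjoin ℚ {α} = ⊤) (σ : K →ₐ[ℚ] ℂ) (j : ℕ) :
    (Ideal.absNorm (denIdeal K α) : ℂ) * σ ((minpolyDiv ℚ α).coeff j) =
      ∑ t ∈ (Finset.univ.erase σ).powerset with t.card = j,
        (-1) ^ (Finset.univ.erase σ \ t).card *
          ((Ideal.absNorm (denIdeal K α) : ℂ) * ∏ τ ∈ Finset.univ.erase σ \ t, τ α) := by
  have h : σ ((minpolyDiv ℚ α).coeff j) = ((minpolyDiv ℚ α).map (σ : K →+* ℂ)).coeff j := by
    simp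
  rw [h, minpolyDiv_map_eq_prod_erase hα, coeff_prod_X_sub_C_eq_sum_powerset, Finset.mul_sum]
  exact Finset.sum_congr rfl fun _ _ => mul_left_comm _ _ _

theorem isIntegral_absNorm_denIdeal_mul_minpolyDiv_coeff {α : K}
    (hα : IntermediateField.adjoin ℚ {α} = ⊤) (σ : K →ₐ[ℚ] ℂ) (j : ℕ) :
    IsIntegral ℤ ((Ideal.absNorm (denIdeal K α) : ℂ) * σ ((minpolyDiv ℚ α).coeff j)) := by
  classical
  rw [absNorm_denIdeal_mul_minpolyDiv_coeff hα]
  exact IsIntegral.sum _ fun t _ => (isIntegral_one.neg.pow _).mul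
    (isIntegral_absNorm_denIdeal_mul_prod α _)

theorem norm_absNorm_denIdeal_mul_minpolyDiv_coeff_le {α : K}
    (hα : IntermediateField.adjoin ℚ {α} = ⊤) (σ : K →ₐ[ℚ] ℂ) (j : ℕ) :
    ‖(Ideal.absNorm (denIdeal K α) : ℂ) * σ ((minpolyDiv ℚ α).coeff j)‖ ≤
      2 ^ (Module.finrank ℚ K - 1) * heightK K α := by
  classical
  have hpos : 0 ≤ heightK K α :=
    (norm_nonneg _).trans (absNorm_denIdeal_mul_norm_prod_le α ∅)
  rw [absNorm_denIdeal_mul_minpolyDiv_coeff hα]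
  refine (norm_sum_le_of_le _ fun t _ => ?_).trans (?_ : ∑ t ∈ _, heightK K α ≤ _)
  · rw [norm_mul, norm_pow, norm_neg, norm_one, one_pow, one_mul]
    exact absNorm_denIdeal_mul_norm_prod_le α _
  · rw [Finset.sum_const, nsmul_eq_mul]
    gcongr
    refine (Nat.cast_le.mpr (Finset.card_filter_le _ _)).trans ?_
    simp [Finset.card_erase_of_mem, AlgHom.card]

/-- The trace form does not vanish on all coefficients of `minpolyDiv`. -/
theorem exists_trace_mul_minpolyDiv_coeff_ne_zero {α θ : K}
    (hα : IntermediateField.adjoin ℚ {α} = ⊤) (hθ : θ ≠ 0) :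
    ∃ j, Algebra.trace ℚ K (θ * (minpolyDiv ℚ α).coeff j) ≠ 0 := by
  by_contra! h
  have hspan : ∀ y ∈ Submodule.span ℚ (Set.range (minpolyDiv ℚ α).coeff),
      Algebra.trace ℚ K (θ * y) = 0 := by
    intro y hy
    induction hy using Submodule.span_induction with
    | mem y hy => obtain ⟨j, rfl⟩ := hy; exact h j
    | zero => simp
    | add a b _ _ ha hb => rw [mul_add, map_add, ha, hb, add_zero]
    | smul c a _ ha => rw [mul_smul_comm, map_smul, ha, smul_zero]
  rw [span_coeff_minpolyDiv (Algebra.IsIntegral.isIntegral α),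
    adjoin_singleton_algebra_eq_top hα] at hspan
  have := hspan θ⁻¹ (by simp)
  rw [mul_inv_cancel₀ hθ, ← map_one (algebraMap ℚ K), Algebra.trace_algebraMap] at this
  simp [Module.finrank_pos.ne'] at this

/-- In a pure field of degree `d`, the radical part `P` of `a` bounds the height of every
generator from below, up to a factor depending only on `d`. -/
theorem squarefree_le_mul_heightK_mul_rpow {d a P : ℕ} {θ α : K} (hd : d ≠ 0) (ha : a ≠ 0)
    (hP : Squarefree P) (hPa : P ∣ a) (hθ : θ ^ d = (a : K)) (hdeg : Module.finrank ℚ K = d)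
    (hα : IntermediateField.adjoin ℚ {α} = ⊤) :
    (P : ℝ) ≤ d * 2 ^ (d - 1) * heightK K α * (a : ℝ) ^ (1 / (d : ℝ)) := by
  have hθ0 : θ ≠ 0 := by
    rintro rfl
    rw [zero_pow hd] at hθ
    exact ha (by exact_mod_cast hθ.symm)
  obtain ⟨j, hj⟩ := exists_trace_mul_minpolyDiv_coeff_ne_zero hα hθ0
  set N := Ideal.absNorm (denIdeal K α) with hN
  have hN0 : N ≠ 0 := by
    rw [hN, Ne, Ideal.absNorm_eq_zero_iff]
    exact denIdeal_ne_bot α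
  set c := (minpolyDiv ℚ α).coeff j with hc
  set t : ℚ := N * Algebra.trace ℚ K (θ * c) with ht
  have ht0 : t ≠ 0 := mul_ne_zero (Nat.cast_ne_zero.mpr hN0) hj
  have htsum : (t : ℂ) = ∑ σ : K →ₐ[ℚ] ℂ, σ θ * (N * σ c) := by
    have h := trace_eq_sum_embeddings (K := ℚ) (L := K) ℂ (x := θ * c)
    rw [eq_ratCast] at h
    rw [ht, Rat.cast_mul, Rat.cast_natCast, h, Finset.mul_sum]
    refine Finset.sum_congr rfl fun σ _ => ?_
    rw [map_mul]
    ring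
  set Θ : ℝ := (a : ℝ) ^ (1 / (d : ℝ)) with hΘ
  have hΘpos : 0 < Θ := Real.rpow_pos_of_pos (by positivity) _
  have hΘd : Θ ^ d = a := by
    rw [hΘ, one_div, Real.rpow_inv_natCast_pow (by positivity) hd]
  have hΘC : (Θ : ℂ) ^ d = a := by exact_mod_cast congrArg (fun x : ℝ => (x : ℂ)) hΘd
  have hΘ0 : (Θ : ℂ) ≠ 0 := by exact_mod_cast hΘpos.ne'
  have hσθ (σ : K →ₐ[ℚ] ℂ) : σ θ ^ d = a := by rw [← map_pow, hθ, map_natCast]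
  have hG : IsIntegral ℤ ((t : ℂ) / Θ) := by
    rw [htsum, Finset.sum_div]
    refine IsIntegral.sum _ fun σ _ => ?_
    rw [mul_div_right_comm]
    refine IsIntegral.mul (IsIntegral.of_pow (Nat.pos_of_ne_zero hd) ?_)
      (isIntegral_absNorm_denIdeal_mul_minpolyDiv_coeff hα σ j)
    rw [div_pow, hσθ, hΘC, div_self (Nat.cast_ne_zero.mpr ha)]
    exact isIntegral_one
  have hInt (q : ℚ) (hq : IsIntegral ℤ (q : ℂ)) : ∃ z : ℤ, (z : ℚ) = q := by
    have hq' : IsIntegral ℤ q := by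
      rw [← isIntegral_algebraMap_iff (algebraMap ℚ ℂ).injective (R := ℤ)]
      simpa using hq
    simpa using IsIntegrallyClosed.isIntegral_iff.mp hq'
  obtain ⟨z, hz⟩ := hInt t (by
    rw [← div_mul_cancel₀ (t : ℂ) hΘ0]
    refine hG.mul (IsIntegral.of_pow (Nat.pos_of_ne_zero hd) ?_)
    rw [hΘC]
    simpa using isIntegral_algebraMap (R := ℤ) (A := ℂ) (x := (a : ℤ)))
  obtain ⟨y, hy⟩ := hInt (t ^ d / a) (by
    have h := hG.pow d
    rw [div_pow, hΘC] at h
    simpa using h)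
  have hdvd : (P : ℤ) ∣ z := by
    refine (Int.natCast_dvd.mpr ?_)
    refine (hP.dvd_pow_iff_dvd hd).mp (hPa.trans ?_)
    rw [← Int.natAbs_pow, ← Int.natCast_dvd]
    refine ⟨y, ?_⟩
    have ha' : (a : ℚ) ≠ 0 := Nat.cast_ne_zero.mpr ha
    rw [← hz, eq_div_iff ha', mul_comm] at hy
    exact_mod_cast hy.symm
  have hz0 : z ≠ 0 := by
    rintro rfl
    exact ht0 (by simpa using hz.symm)
  have hPz : (P : ℝ) ≤ ‖(t : ℂ)‖ := by
    rw [← hz, Rat.cast_intCast, Complex.norm_intCast]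
    have := Int.le_of_dvd (abs_pos.mpr hz0) ((dvd_abs _ _).mpr hdvd)
    exact_mod_cast this
  have hnorm (σ : K →ₐ[ℚ] ℂ) : ‖σ θ‖ = Θ := by
    refine (pow_left_inj₀ (norm_nonneg _) hΘpos.le hd).mp ?_
    rw [← norm_pow, hσθ, Complex.norm_natCast, hΘd]
  calc (P : ℝ) ≤ ‖(t : ℂ)‖ := hPz
    _ ≤ ∑ σ : K →ₐ[ℚ] ℂ, Θ * (2 ^ (d - 1) * heightK K α) := by
      rw [htsum]
      refine norm_sum_le_of_le _ fun σ _ => ?_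
      rw [norm_mul, hnorm, ← hdeg]
      gcongr
      exact norm_absNorm_denIdeal_mul_minpolyDiv_coeff_le hα σ j
    _ = d * 2 ^ (d - 1) * heightK K α * Θ := by
      rw [Finset.sum_const, Finset.card_univ, AlgHom.card, hdeg, nsmul_eq_mul]
      ring

end Height

/-- The product of the complementary fractional powers. -/
theorem prod_rpow_fract_mul_rpow_prod_pow {d : ℕ} (hd : d ≠ 0) (A : ℕ → ℕ)
    (hA : ∀ i ∈ Finset.Icc 1 (d - 1), 0 < A i) :
    (∏ i ∈ Finset.Icc 1 (d - 1), (A i : ℝ) ^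
        (((i * (d - 1) : ℕ) : ℝ) / (d : ℝ) - (((i * (d - 1)) / d : ℕ) : ℝ))) *
      ((∏ i ∈ Finset.Icc 1 (d - 1), A i ^ i : ℕ) : ℝ) ^ (1 / (d : ℝ)) =
      ((∏ i ∈ Finset.Icc 1 (d - 1), A i : ℕ) : ℝ) := by
  push_cast
  rw [← Real.finsetProd_rpow _ _ (fun i _ => by positivity), ← Finset.prod_mul_distrib]
  refine Finset.prod_congr rfl fun i hi => ?_
  have hAi : (0 : ℝ) < A i := Nat.cast_pos.mpr (hA i hi)
  obtain ⟨hi1, hid⟩ := Finset.mem_Icc.mp hi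
  have hdiv : i * (d - 1) / d = i - 1 := by
    obtain ⟨e, rfl⟩ := Nat.exists_eq_succ_of_ne_zero hd
    obtain ⟨k, rfl⟩ := Nat.exists_eq_add_of_le' hi1
    simp only [Nat.succ_eq_add_one, Nat.add_sub_cancel] at *
    exact Nat.div_eq_of_lt_le (by nlinarith) (by nlinarith)
  rw [hdiv, ← Real.rpow_natCast (A i : ℝ) i, ← Real.rpow_mul hAi.le, ← Real.rpow_add hAi]
  conv_rhs => rw [← Real.rpow_one (A i : ℝ)]
  congr 1
  have hd0 : (d : ℝ) ≠ 0 := Nat.cast_ne_zero.mpr hd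
  rw [Nat.cast_sub (Nat.pos_of_ne_zero hd), Nat.cast_sub hi1]
  field_simp
  push_cast
  ring

/-- Dubickas' height lower bound for generators of pure fields of odd
degree. -/
theorem dubickas_height_bound (K : Type*) [Field K] [NumberField K] (d : ℕ)
    (hd3 : 3 ≤ d) (hodd : Odd d) (a : ℕ) (A : ℕ → ℕ) (θ : K)
    (hsf : ∀ i ∈ Finset.Icc 1 (d - 1), Squarefree (A i) ∧ 0 < A i)
    (hcop : ∀ i ∈ Finset.Icc 1 (d - 1), ∀ j ∈ Finset.Icc 1 (d - 1), i ≠ j →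
      Nat.Coprime (A i) (A j))
    (ha : a = ∏ i ∈ Finset.Icc 1 (d - 1), A i ^ i) (ha1 : 1 < a)
    (hθ : θ ^ d = (a : K)) (hgen : IntermediateField.adjoin ℚ {θ} = ⊤)
    (hdeg : Module.finrank ℚ K = d)
    (α : K) (hα : IntermediateField.adjoin ℚ {α} = ⊤) :
    ((d : ℝ) ^ (2 * d - 1))⁻¹ *
        sInf {x : ℝ | ∃ m : ℕ, (d + 1) / 2 ≤ m ∧ m ≤ d - 1 ∧
          x = ∏ i ∈ Finset.Icc 1 (d - 1),
            (A i : ℝ) ^ (((i * m : ℕ) : ℝ) / (d : ℝ) - (((i * m) / d : ℕ) : ℝ))} <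
      heightK K α := by
  have hd0 : d ≠ 0 := by lia
  have hdvd : ∏ i ∈ Finset.Icc 1 (d - 1), A i ∣ a :=
    ha ▸ Finset.prod_dvd_prod_of_dvd _ _ fun i hi =>
      dvd_pow_self _ (Nat.one_le_iff_ne_zero.mp (Finset.mem_Icc.mp hi).1)
  have hsq : Squarefree (∏ i ∈ Finset.Icc 1 (d - 1), A i) :=
    Finset.squarefree_prod_of_pairwise_isCoprime
      (fun i hi j hj hij => Nat.coprime_iff_isRelPrime.mp (hcop i hi j hj hij))
      fun i hi => (hsf i hi).1
  have hmain := squarefree_le_mul_heightK_mul_rpow hd0 (by lia) hsq hdvd hθ hdeg hα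
  rw [← prod_rpow_fract_mul_rpow_prod_pow hd0 A fun i hi => (hsf i hi).2, ← ha] at hmain
  have hE := le_of_mul_le_mul_right hmain
    (Real.rpow_pos_of_pos (Nat.cast_pos.mpr (by lia : 0 < a)) _)
  have hEpos : 0 < ∏ i ∈ Finset.Icc 1 (d - 1), (A i : ℝ) ^
      (((i * (d - 1) : ℕ) : ℝ) / (d : ℝ) - (((i * (d - 1)) / d : ℕ) : ℝ)) :=
    Finset.prod_pos fun i hi => Real.rpow_pos_of_pos (Nat.cast_pos.mpr (hsf i hi).2) _
  have hH : 0 < heightK K α := pos_of_mul_pos_right (hEpos.trans_le hE) (by positivity)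
  rw [inv_mul_lt_iff₀ (by positivity)]
  refine (csInf_le ⟨0, ?_⟩ (Set.mem_ofPred.mpr ⟨d - 1, by lia, le_rfl, rfl⟩)).trans_lt (hE.trans_lt ?_)
  · rintro _ ⟨m, -, -, rfl⟩
    positivity
  · gcongr
    have hlt : d * 2 ^ (d - 1) < d ^ (2 * d - 1) := by
      calc d * 2 ^ (d - 1) < d * d ^ (d - 1) := by
            gcongr <;> lia
        _ = d ^ d := by rw [← pow_succ', Nat.sub_add_cancel (by lia)]
        _ ≤ d ^ (2 * d - 1) := Nat.pow_le_pow_right (by lia) (by lia)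
    exact_mod_cast hlt
end
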